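/- For q = 4 and n ≥ 3, we have (4,n) ∈ B(3,2) for n = 11 and for all n ≥ 13. -/

import Mathlib

open Polynomial

noncomputable section

/-- An element of a finite field is *primitive* if it generates the multiplicative group. -/
def IsPrimitiveElem {L : Type} [Field L] [Fintype L] (α : L) : Prop :=
  orderOf α = Fintype.card L - 1

/-- `β` is a *normal element* of `L` over `K`, where `n = [L : K]`:
the conjugates `β, β^q, …, β^(q^(n-1))` form a `K`-basis of `L`. -/
def IsNormalElem (K : Type) {L : Type} [Field K] [Fintype K] [Field L] [Algebra K L]
    (n : ℕ) (β : L) : Prop :=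
  LinearIndependent K (fun i : Fin n => β ^ Fintype.card K ^ (i : ℕ)) ∧
    Submodule.span K (Set.range fun i : Fin n => β ^ Fintype.card K ^ (i : ℕ)) = ⊤

/-- The set `Υ_Q(m₁, m₂)` of rational functions over the field `F` with `Q` elements. -/
def Upsilon (F : Type) [Field F] [Fintype F] (m₁ m₂ : ℕ) : Set (RatFunc F) :=
  {f | ∃ f₁ f₂ : F[X], f₂ ≠ 0 ∧
      f = algebraMap F[X] (RatFunc F) f₁ / algebraMap F[X] (RatFunc F) f₂ ∧
      f₁.natDegree ≤ m₁ ∧ f₂.natDegree ≤ m₂ ∧ IsCoprime f₁ f₂ ∧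
      ∃ (k : ℕ) (g : F[X]), 0 < k ∧ g.Monic ∧ Irreducible g ∧ g ≠ X ∧
        Nat.gcd k (Fintype.card F - 1) = 1 ∧
        g ^ k ∣ f₁ * f₂ ∧ ¬ g ^ (k + 1) ∣ f₁ * f₂}

/-- Evaluation of a rational function at a point of the same field (`0` if undefined). -/
def ratEval {F : Type} [Field F] (f : RatFunc F) (α : F) : F :=
  f.eval (RingHom.id F) α

/-- `α` is `s`-free. -/
def IsFree {F : Type} [Field F] (s : ℕ) (α : F) : Prop :=
  α ≠ 0 ∧ ∀ d : ℕ, d ∣ s → d ≠ 1 → ¬ ∃ β : F, β ^ d = α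

/-- The `F_q[x]`-module action `h ∘ β = ∑ hᵢ β^(qⁱ)` on `L`. -/
def polyAct {K L : Type} [Field K] [Fintype K] [Field L] [Algebra K L]
    (h : K[X]) (β : L) : L :=
  h.sum fun i a => algebraMap K L a * β ^ Fintype.card K ^ i

/-- `α` is `g`-free with respect to the `F_q[x]`-module structure of `L`. -/
def IsPolyFree (K : Type) {L : Type} [Field K] [Fintype K] [Field L] [Algebra K L]
    (g : K[X]) (α : L) : Prop :=
  ∀ h : K[X], h.Monic → h ∣ g → (∃ lam : L, α = polyAct h lam) → h = 1

/-- `N_f(e₁, e₂, g)`: the number of `α ∈ L` such that `α` is `e₁`-free,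
`f(α)` is `e₂`-free and `α` is `g`-free. -/
def NElems (K : Type) {L : Type} [Field K] [Fintype K] [Field L] [Fintype L] [Algebra K L]
    (f : RatFunc L) (e₁ e₂ : ℕ) (g : K[X]) : ℕ :=
  Nat.card {α : L | IsFree e₁ α ∧ IsFree e₂ (ratEval f α) ∧ IsPolyFree K g α}

/-- `W(ℓ)`: the number of squarefree divisors of `ℓ`. -/
def Wnat (ℓ : ℕ) : ℕ := (ℓ.divisors.filter Squarefree).card

/-- `W_q(g)`: the number of monic squarefree divisors of `g` in `F_q[x]`. -/
def Wpoly {K : Type} [Field K] (g : K[X]) : ℕ :=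
  Nat.card {h : K[X] // h.Monic ∧ Squarefree h ∧ h ∣ g}

/-- `Φ(g) = |(F_q[x]/(g))ˣ|`. -/
def PhiPoly {K : Type} [Field K] (g : K[X]) : ℕ :=
  Nat.card ((K[X] ⧸ Ideal.span ({g} : Set K[X]))ˣ)

/-- `(q, n) ∈ B(m₁, m₂)`: for every `f ∈ Υ_{qⁿ}(m₁, m₂)` there is a primitive element
`α` of `F_{qⁿ}`, normal over `F_q`, with `f(α)` also primitive. -/
def memB (m₁ m₂ q n : ℕ) : Prop :=
  ∀ (K L : Type) [Field K] [Field L] [Fintype K] [Fintype L] [Algebra K L],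
    Fintype.card K = q → Fintype.card L = q ^ n →
    ∀ f ∈ Upsilon L m₁ m₂,
      ∃ α : L, IsPrimitiveElem α ∧ IsNormalElem K n α ∧ IsPrimitiveElem (ratEval f α)

/-- `𝔑(q, n)`: the number of primitive elements of `F_{qⁿ}` that are normal over `F_q`. -/
def NNum (K L : Type) [Field K] [Fintype K] [Field L] [Fintype L] [Algebra K L] (n : ℕ) : ℕ :=
  Nat.card {α : L | IsPrimitiveElem α ∧ IsNormalElem K n α}

end

open Polynomial

namespace Stp

section
variable {k : Type} [Field k]

lemma dvd_hasse (F : k[X]) (e l : ℕ) (hl : l ≤ e) : F ^ (e - l) ∣ hasseDeriv l (F ^ e) := by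
  induction e generalizing l with
  | zero => 
    simp
  | succ e ih =>
    rw [pow_succ', hasseDeriv_mul]
    apply Finset.dvd_sum
    rintro ⟨i, j⟩ hij
    rw [Finset.HasAntidiagonal.mem_antidiagonal] at hij
    simp only at hij ⊢
    rcases Nat.eq_zero_or_pos i with rfl | hi
    · simp only [zero_add] at hij
      subst hij
      rw [hasseDeriv_zero']
      rcases Nat.lt_or_ge e j with h | h
      · have : e + 1 - j = 0 := by omega
        rw [this]; simp
      · have : e + 1 - j = (e - j) + 1 := by omega
        rw [this, pow_succ']
        exact mul_dvd_mul_left _ (ih j h)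
    · have : e + 1 - l ≤ e - j := by omega
      exact ((pow_dvd_pow F this).trans (ih j (by omega))).mul_left _

lemma dvd_hasse_mul (F p : k[X]) (e l : ℕ) (hl : l ≤ e) :
    F ^ (e - l) ∣ hasseDeriv l (F ^ e * p) := by
  rw [hasseDeriv_mul]
  apply Finset.dvd_sum
  rintro ⟨i, j⟩ hij
  rw [Finset.HasAntidiagonal.mem_antidiagonal] at hij
  simp only at hij ⊢
  have : e - l ≤ e - i := by omega
  exact ((pow_dvd_pow F this).trans (dvd_hasse F e i (by omega))).mul_right _

lemma exists_beta (F : k[X]) (hF : F.Monic) (e l : ℕ) (hl : l ≤ e) :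
    ∃ β : k[X] →ₗ[k] k[X], ∀ p, hasseDeriv l (F ^ e * p) = F ^ (e - l) * β p ∧
      (β p).natDegree ≤ p.natDegree + l * F.natDegree := by
  choose b hb using fun p => dvd_hasse_mul F p e l hl
  have hne : F ^ (e - l) ≠ 0 := pow_ne_zero _ hF.ne_zero
  refine ⟨{ toFun := b, map_add' := ?_, map_smul' := ?_ }, ?_⟩
  · intro p q
    apply mul_left_cancel₀ hne
    rw [← hb, mul_add, mul_add, map_add, hb, hb]
  · intro c p
    apply mul_left_cancel₀ hne
    rw [← hb, RingHom.id_apply, mul_smul_comm, mul_smul_comm, ← hb, map_smul]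
  · intro p
    refine ⟨hb p, ?_⟩
    change (b p).natDegree ≤ _
    by_cases h0 : b p = 0
    · simp [h0]
    have h1 : (F ^ (e - l) * b p).natDegree = (e - l) * F.natDegree + (b p).natDegree := by
      rw [(hF.pow _).natDegree_mul' h0, hF.natDegree_pow]
    have h2 : (hasseDeriv l (F ^ e * p)).natDegree ≤ e * F.natDegree + p.natDegree := by
      refine (natDegree_hasseDeriv_le _ _).trans ((Nat.sub_le _ _).trans ?_)
      refine natDegree_mul_le.trans ?_
      rw [hF.natDegree_pow]
    rw [hb p, h1] at h2
    have : e * F.natDegree = (e - l) * F.natDegree + l * F.natDegree := by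
      rw [← add_mul]; congr 1; omega
    omega

variable [CharP k 2]

/-- `X^(2^m) - x0` -/
noncomputable def Wp (m : ℕ) (x0 : k) : k[X] := X ^ (2 ^ m) - C x0

lemma two_choose (m j : ℕ) (h0 : j ≠ 0) (h1 : j ≠ 2 ^ m) : ((2 ^ m).choose j : k) = 0 := by
  rw [CharP.cast_eq_zero_iff k 2]
  exact Nat.prime_two.dvd_choose_pow h0 h1

lemma hasse_Wp (m : ℕ) (x0 : k) (j : ℕ) (h0 : j ≠ 0) (h1 : j < 2 ^ m) :
    hasseDeriv j (Wp m x0) = 0 := by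
  rw [Wp, map_sub, hasseDeriv_C _ _ (Nat.pos_of_ne_zero h0), ← monomial_one_right_eq_X_pow,
    hasseDeriv_monomial, two_choose m j h0 h1.ne]
  simp

lemma hasse_mul_Wp (m : ℕ) (x0 : k) (u : k[X]) (j : ℕ) (h1 : j < 2 ^ m) :
    hasseDeriv j (u * Wp m x0) = hasseDeriv j u * Wp m x0 := by
  rw [hasseDeriv_mul, Finset.sum_eq_single (j, 0)]
  · simp
  · rintro ⟨a, b⟩ hab hne
    rw [Finset.HasAntidiagonal.mem_antidiagonal] at hab
    simp only at hab ⊢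
    rw [hasse_Wp m x0 b, mul_zero]
    · rintro rfl; apply hne; simp at hab; simp [hab]
    · omega
  · intro h; simp at h

lemma hasse_mul_Wp_pow (m : ℕ) (x0 : k) (u : k[X]) (j l : ℕ) (h1 : j < 2 ^ m) :
    hasseDeriv j (u * Wp m x0 ^ l) = hasseDeriv j u * Wp m x0 ^ l := by
  induction l with
  | zero => simp
  | succ l ih => rw [pow_succ, ← mul_assoc, hasse_mul_Wp _ _ _ _ h1, ih, mul_assoc]

/-- trace polynomial -/
noncomputable def Tp (m : ℕ) (c : k) : k[X] := ∑ i ∈ Finset.range m, (C c * X) ^ (2 ^ i)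

lemma hasse_Tp (m : ℕ) (c : k) (j : ℕ) (h0 : j ≠ 0) :
    ∃ τ : k, hasseDeriv j (Tp m c) = C τ := by
  have key : ∀ i : ℕ, ∃ τ : k, hasseDeriv j ((C c * X : k[X]) ^ (2 ^ i)) = C τ := by
    intro i
    rw [mul_pow, ← C_pow, C_mul_X_pow_eq_monomial, hasseDeriv_monomial]
    by_cases h : j = 2 ^ i
    · subst h
      exact ⟨c ^ 2 ^ i, by simp⟩
    · exact ⟨0, by rw [two_choose i j h0 h]; simp⟩
  choose τ hτ using key
  refine ⟨∑ i ∈ Finset.range m, τ i, ?_⟩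
  rw [Tp, map_sum, map_sum]
  exact Finset.sum_congr rfl fun i _ => hτ i

lemma Tp_sq (m : ℕ) (c : k) : Tp m c ^ 2 + Tp m c = (C c * X) ^ (2 ^ m) + C c * X := by
  induction m with
  | zero => 
    have := CharTwo.add_self_eq_zero (C c * X : k[X])
    simp [Tp, this]
  | succ m ih =>
    have h : Tp (m + 1) c = Tp m c + (C c * X) ^ (2 ^ m) := by
      rw [Tp, Finset.sum_range_succ, ← Tp]
    have h2 := CharTwo.add_self_eq_zero ((C c * X : k[X]) ^ (2 ^ m))
    rw [h, CharTwo.add_sq, pow_succ 2 m, pow_mul]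
    linear_combination ih + h2 

end
end Stp

open Polynomial

namespace Stp

section
variable {k : Type} [Field k] [CharP k 2]

lemma natDegree_beta_le {F p : k[X]} {D a l : ℕ} {q : k[X]}
    (h : q.natDegree ≤ p.natDegree + l * F.natDegree) (hp : p.natDegree ≤ D) (hl : l ≤ a) :
    q.natDegree ≤ D + a * F.natDegree := by
  have := Nat.mul_le_mul_right F.natDegree hl
  omega

/-- Hasse derivative of `F^e * p * T^j` at a point where `F^e'` ... ; the quotient form. -/
lemma exists_b (F : k[X]) (hF : F.Monic) (m : ℕ) (c t : k) (j : Fin 2) (e l : ℕ) (hl : l ≤ e) :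
    ∃ b : k[X] →ₗ[k] k[X], ∀ p, (b p).natDegree ≤ p.natDegree + l * F.natDegree ∧
      ∀ a : k, (Tp m c).eval a = t →
        (hasseDeriv l (F ^ e * p * Tp m c ^ (j : ℕ))).eval a =
          (F.eval a) ^ (e - l) * (b p).eval a := by
  fin_cases j
  · obtain ⟨β, hβ⟩ := exists_beta F hF e l hl
    refine ⟨β, fun p => ⟨(hβ p).2, fun a _ => ?_⟩⟩
    simp only [Fin.zero_eta, Fin.isValue, Fin.coe_ofNat_eq_mod, Nat.zero_mod, pow_zero, mul_one]
    rw [(hβ p).1, eval_mul, eval_pow]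
  · have h1 : ∀ i : ℕ, ∃ β : k[X] →ₗ[k] k[X], i ≤ l → ∀ p,
        hasseDeriv i (F ^ e * p) = F ^ (e - i) * β p ∧
        (β p).natDegree ≤ p.natDegree + i * F.natDegree := by
      intro i
      by_cases hi : i ≤ l
      · obtain ⟨β, hβ⟩ := exists_beta F hF e i (hi.trans hl)
        exact ⟨β, fun _ => hβ⟩
      · exact ⟨0, fun h => absurd h hi⟩
    choose β hβ using h1
    have h2 : ∀ i : ℕ, ∃ τ : k, ∀ a, (Tp m c).eval a = t →
        (hasseDeriv i (Tp m c)).eval a = τ := by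
      intro i
      by_cases hi : i = 0
      · subst hi; exact ⟨t, fun a ha => by simpa using ha⟩
      · obtain ⟨τ, hτ⟩ := hasse_Tp m c i hi
        exact ⟨τ, fun a _ => by simp [hτ]⟩
    choose τ hτ using h2
    refine ⟨∑ x ∈ Finset.HasAntidiagonal.antidiagonal l,
      (LinearMap.mulLeft k (C (τ x.2) * F ^ x.2)).comp (β x.1), fun p => ⟨?_, ?_⟩⟩
    · rw [LinearMap.sum_apply]
      apply natDegree_sum_le_of_forall_le
      rintro ⟨i, j⟩ hij
      rw [Finset.HasAntidiagonal.mem_antidiagonal] at hij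
      simp only at hij
      simp only [LinearMap.comp_apply, LinearMap.mulLeft_apply]
      refine natDegree_mul_le.trans ?_
      have := natDegree_C_mul_le (τ j) (F ^ j)
      rw [hF.natDegree_pow] at this
      have h3 := (hβ i (by omega) p).2
      have h4 : l * F.natDegree = i * F.natDegree + j * F.natDegree := by rw [← hij]; ring
      omega
    · intro a ha
      simp only [Fin.mk_one, Fin.isValue, Fin.coe_ofNat_eq_mod, Nat.mod_succ, pow_one]
      rw [hasseDeriv_mul, LinearMap.sum_apply, eval_finsetSum, eval_finsetSum, Finset.mul_sum]
      apply Finset.sum_congr rfl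
      rintro ⟨i, j⟩ hij
      rw [Finset.HasAntidiagonal.mem_antidiagonal] at hij
      simp only at hij
      simp only [LinearMap.comp_apply, LinearMap.mulLeft_apply]
      rw [(hβ i (by omega) p).1]
      simp only [eval_mul, eval_pow, eval_C]
      rw [hτ j a ha, show e - i = (e - l) + j by omega, pow_add]
      ring

/-- the auxiliary polynomial -/
noncomputable def auxPoly (F : k[X]) (m : ℕ) (c x0 : k) (d K M e : ℕ)
    (p : Fin d × Fin 2 × Fin K → k[X]) : k[X] :=
  ∑ x, F ^ (M + e * (x.1 : ℕ)) * p x * Tp m c ^ (x.2.1 : ℕ) * Wp m x0 ^ (x.2.2 : ℕ)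

lemma exists_aux (F : k[X]) (hF : F.Monic) (m : ℕ) (c x0 : k) (d K M D e : ℕ) (z t : k)
    (hM : M ≤ 2 ^ m)
    (hdim : M * (D + K + (M + d) * F.natDegree) < 2 * d * K * D) :
    ∃ p : Fin d × Fin 2 × Fin K → k[X], p ≠ 0 ∧ (∀ x, p x ∈ degreeLT k D) ∧
      ∀ a : k, a ^ (2 ^ m) = a → F.eval a ^ e = F.eval a * z → (Tp m c).eval a = t →
        ∀ l < M, (hasseDeriv l (auxPoly F m c x0 d K M e p)).eval a = 0 := by
  classical
  set s := F.natDegree with hs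
  have h1 : ∀ (l : Fin M) (i : Fin d) (j : Fin 2), ∃ b : k[X] →ₗ[k] k[X], ∀ p,
      (b p).natDegree ≤ p.natDegree + l * F.natDegree ∧
      ∀ a : k, (Tp m c).eval a = t →
        (hasseDeriv l (F ^ (M + e * i) * p * Tp m c ^ (j : ℕ))).eval a =
          (F.eval a) ^ (M + e * i - l) * (b p).eval a := fun l i j =>
    exists_b F hF m c t j _ l (by omega)
  choose b hb using h1
  let Q := D + K + (M + d) * s
  let Φ0 : (Fin d × Fin 2 × Fin K → degreeLT k D) →ₗ[k] (Fin M → k[X]) :=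
    LinearMap.pi fun l => ∑ x : Fin d × Fin 2 × Fin K,
      (LinearMap.mulLeft k (C (z ^ (x.1 : ℕ)) * F ^ (x.1 : ℕ) * (X - C x0) ^ (x.2.2 : ℕ))).comp
        ((b l x.1 x.2.1).comp ((degreeLT k D).subtype.comp (LinearMap.proj x)))
  have hD : 0 < D := by
    rcases Nat.eq_zero_or_pos D with h | h
    · simp [h] at hdim
    · exact h
  have hΦ : ∀ p l, Φ0 p l ∈ degreeLT k Q := by
    intro p l
    simp only [Φ0, LinearMap.pi_apply, LinearMap.sum_apply]
    apply Submodule.sum_mem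
    rintro ⟨i, j, r⟩ _
    simp only [LinearMap.comp_apply, LinearMap.mulLeft_apply, LinearMap.proj_apply,
      Submodule.subtype_apply]
    rw [mem_degreeLT]
    have hp : ((p (i, j, r) : degreeLT k D) : k[X]).natDegree < D := by
      have := (p (i, j, r)).2
      rw [mem_degreeLT] at this
      rcases eq_or_ne ((p (i, j, r) : degreeLT k D) : k[X]) 0 with h | h
      · rw [h]; simpa using hD
      · exact (natDegree_lt_iff_degree_lt h).2 this
    have hb1 := (hb l i j (p (i, j, r))).1
    rw [← hs] at hb1
    refine lt_of_le_of_lt (degree_le_natDegree) ?_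
    rw [Nat.cast_lt]
    refine lt_of_le_of_lt natDegree_mul_le ?_
    have h2 : (C (z ^ (i : ℕ)) * F ^ (i : ℕ) * (X - C x0) ^ (r : ℕ)).natDegree ≤ i * s + r := by
      refine natDegree_mul_le.trans ?_
      have h3 := natDegree_C_mul_le (z ^ (i : ℕ)) (F ^ (i : ℕ))
      rw [hF.natDegree_pow, ← hs] at h3
      have h4 : ((X - C x0) ^ (r : ℕ)).natDegree = (r : ℕ) := by
        rw [natDegree_pow, natDegree_X_sub_C, mul_one]
      omega
    have h5 : (l : ℕ) * s ≤ M * s := Nat.mul_le_mul_right _ l.2.le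
    have h6 : (i : ℕ) * s ≤ d * s := Nat.mul_le_mul_right _ i.2.le
    have h7 := r.2
    have h8 : (M + d) * s = M * s + d * s := by ring
    simp only [Q]
    omega
  let Φ : (Fin d × Fin 2 × Fin K → degreeLT k D) →ₗ[k] (Fin M → degreeLT k Q) :=
    LinearMap.pi fun l => LinearMap.codRestrict _ ((LinearMap.proj l).comp Φ0) (fun p => hΦ p l)
  have hfr : Module.finrank k (Fin M → degreeLT k Q) <
      Module.finrank k (Fin d × Fin 2 × Fin K → degreeLT k D) := by
    have e1 : ∀ n, Module.finrank k (degreeLT k n) = n := fun n => by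
      rw [LinearEquiv.finrank_eq (degreeLTEquiv k n)]; simp
    have : ∀ n, Module.Finite k (degreeLT k n) := fun n =>
      Module.Finite.equiv (degreeLTEquiv k n).symm
    rw [Module.finrank_pi_fintype, Module.finrank_pi_fintype]
    simp only [e1, Finset.sum_const, Finset.card_univ, Fintype.card_prod, Fintype.card_fin,
      smul_eq_mul]
    calc M * Q < 2 * d * K * D := hdim
      _ = _ := by ring
  have : ∀ n, Module.Finite k (degreeLT k n) := fun n =>
      Module.Finite.equiv (degreeLTEquiv k n).symm
  have hker := LinearMap.ker_ne_bot_of_finrank_lt (f := Φ) hfr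
  obtain ⟨p, hp, hp0⟩ := (Submodule.ne_bot_iff _).1 hker
  refine ⟨fun x => p x, ?_, fun x => (p x).2, ?_⟩
  · intro h
    apply hp0
    funext x
    have := congrFun h x
    exact Subtype.ext this
  · intro a ha hFa hTa l hl
    have hz : Φ0 p ⟨l, hl⟩ = 0 := by
      rw [LinearMap.mem_ker] at hp
      have := congrFun hp ⟨l, hl⟩
      exact congrArg Subtype.val this
    have hz2 := congrArg (eval a) hz
    simp only [Φ0, LinearMap.pi_apply, LinearMap.sum_apply, eval_finsetSum, eval_zero] at hz2
    rw [auxPoly, map_sum, eval_finsetSum]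
    rw [← mul_zero (F.eval a ^ (M - l)), ← hz2, Finset.mul_sum]
    apply Finset.sum_congr rfl
    rintro ⟨i, j, r⟩ _
    rw [hasse_mul_Wp_pow _ _ _ _ _ (by omega)]
    simp only [LinearMap.comp_apply, LinearMap.mulLeft_apply, LinearMap.proj_apply,
      Submodule.subtype_apply]
    rw [eval_mul, (hb ⟨l, hl⟩ i j _).2 a hTa]
    have hW : (Wp m x0).eval a = a - x0 := by simp [Wp, ha]
    simp only [eval_mul, eval_pow, hW, eval_C, eval_sub, eval_X]
    have : M + e * (i : ℕ) - l = (M - l) + e * i := by omega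
    simp only [this, pow_add, pow_mul, hFa, mul_pow]
    ring

end
end Stp

open Polynomial

namespace Stp

section
variable {k : Type} [Field k]

/-- entries of degree at most `e` -/
def MatDeg {d : ℕ} (e : ℕ) (A : Matrix (Fin d) (Fin d) k[X]) : Prop :=
  ∀ i j, (A i j).natDegree ≤ e

lemma MatDeg.mul {d a b : ℕ} {A B : Matrix (Fin d) (Fin d) k[X]} (hA : MatDeg a A)
    (hB : MatDeg b B) : MatDeg (a + b) (A * B) := by
  intro i j
  rw [Matrix.mul_apply]
  apply natDegree_sum_le_of_forall_le
  intro l _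
  exact natDegree_mul_le.trans (add_le_add (hA i l) (hB l j))

lemma MatDeg.mono {d a b : ℕ} {A : Matrix (Fin d) (Fin d) k[X]} (hA : MatDeg a A)
    (h : a ≤ b) : MatDeg b A := fun i j => (hA i j).trans h

lemma MatDeg.add {d a : ℕ} {A B : Matrix (Fin d) (Fin d) k[X]} (hA : MatDeg a A)
    (hB : MatDeg a B) : MatDeg a (A + B) := by
  intro i j
  exact (natDegree_add_le _ _).trans (max_le (hA i j) (hB i j))

lemma MatDeg.pow {d a : ℕ} {A : Matrix (Fin d) (Fin d) k[X]} (hA : MatDeg a A) (n : ℕ) :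
    MatDeg (n * a) (A ^ n) := by
  induction n with
  | zero => intro i j; simp [Matrix.one_apply]; split_ifs <;> simp
  | succ n ih => rw [pow_succ, add_mul, one_mul]; exact ih.mul hA

lemma MatDeg.smul {d a b : ℕ} {A : Matrix (Fin d) (Fin d) k[X]} (hA : MatDeg a A) {p : k[X]}
    (hp : p.natDegree ≤ b) : MatDeg (b + a) (p • A) := by
  intro i j
  rw [Matrix.smul_apply, smul_eq_mul]
  exact natDegree_mul_le.trans (add_le_add hp (hA i j))

lemma MatDeg.sum {d a : ℕ} {ι : Type} (s : Finset ι) (A : ι → Matrix (Fin d) (Fin d) k[X])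
    (hA : ∀ x ∈ s, MatDeg a (A x)) : MatDeg a (∑ x ∈ s, A x) := by
  intro i j
  rw [Matrix.sum_apply]
  exact natDegree_sum_le_of_forall_le _ _ (fun x hx => hA x hx i j)

lemma MatDeg.det {d a : ℕ} {A : Matrix (Fin d) (Fin d) k[X]} (hA : MatDeg a A) :
    A.det.natDegree ≤ d * a := by
  rw [Matrix.det_apply]
  apply natDegree_sum_le_of_forall_le
  intro σ _
  have h1 : (∏ i, A (σ i) i).natDegree ≤ d * a := by
    refine (natDegree_prod_le _ _).trans ?_
    refine (Finset.sum_le_card_nsmul _ _ a (fun i _ => hA _ _)).trans ?_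
    simp
  rcases Int.units_eq_one_or (Equiv.Perm.sign σ) with h | h <;> rw [h] <;> simpa using h1

/-- the companion matrix of `Y^d - G` -/
noncomputable def compM (d : ℕ) (G : k[X]) : Matrix (Fin d) (Fin d) k[X] :=
  Matrix.of fun i j => if (j : ℕ) + 1 = d then (if (i : ℕ) = 0 then G else 0)
    else if (i : ℕ) = j + 1 then 1 else 0

lemma compM_deg (d : ℕ) (G : k[X]) : MatDeg G.natDegree (compM d G) := by
  intro i j
  simp only [compM, Matrix.of_apply]
  split_ifs <;> simp

lemma compM_vec (d : ℕ) (G W y : k[X]) (hy : W ∣ y ^ d - G) (j : Fin d) :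
    W ∣ Matrix.vecMul (fun i : Fin d => y ^ (i : ℕ)) (compM d G) j - y * y ^ (j : ℕ) := by
  by_cases hj : (j : ℕ) + 1 = d
  · have : Matrix.vecMul (fun i : Fin d => y ^ (i : ℕ)) (compM d G) j = G := by
      simp only [Matrix.vecMul, dotProduct, compM, Matrix.of_apply, hj, if_true]
      rw [Finset.sum_eq_single ⟨0, by omega⟩]
      · simp
      · intro b _ hb
        rw [if_neg, mul_zero]
        intro h; exact hb (Fin.ext h)
      · simp
    rw [this, ← pow_succ', hj, ← dvd_neg]
    simpa using hy
  · have : Matrix.vecMul (fun i : Fin d => y ^ (i : ℕ)) (compM d G) j = y ^ ((j : ℕ) + 1) := by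
      simp only [Matrix.vecMul, dotProduct, compM, Matrix.of_apply, hj, if_false]
      rw [Finset.sum_eq_single ⟨(j : ℕ) + 1, by omega⟩]
      · simp
      · intro b _ hb
        rw [if_neg, mul_zero]
        intro h; exact hb (Fin.ext h)
      · simp
    rw [this, pow_succ']
    simp

/-- `e` is an eigenvector of `A` modulo `W` with eigenvalue `a` -/
def EigM {d : ℕ} (W : k[X]) (e : Fin d → k[X]) (A : Matrix (Fin d) (Fin d) k[X]) (a : k[X]) :
    Prop := ∀ j, W ∣ Matrix.vecMul e A j - a * e j

lemma EigM.add {d : ℕ} {W : k[X]} {e : Fin d → k[X]} {A B : Matrix (Fin d) (Fin d) k[X]}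
    {a b : k[X]} (hA : EigM W e A a) (hB : EigM W e B b) : EigM W e (A + B) (a + b) := by
  intro j
  have := dvd_add (hA j) (hB j)
  rw [Matrix.vecMul_add, Pi.add_apply]
  convert this using 1; ring

lemma EigM.smul {d : ℕ} {W : k[X]} {e : Fin d → k[X]} {A : Matrix (Fin d) (Fin d) k[X]}
    {a : k[X]} (hA : EigM W e A a) (p : k[X]) : EigM W e (p • A) (p * a) := by
  intro j
  have := (hA j).mul_left p
  rw [Matrix.vecMul_smul, Pi.smul_apply, smul_eq_mul]
  convert this using 1; ring

lemma EigM.mul {d : ℕ} {W : k[X]} {e : Fin d → k[X]} {A B : Matrix (Fin d) (Fin d) k[X]}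
    {a b : k[X]} (hA : EigM W e A a) (hB : EigM W e B b) : EigM W e (A * B) (a * b) := by
  intro j
  rw [← Matrix.vecMul_vecMul]
  have h1 : W ∣ Matrix.vecMul (Matrix.vecMul e A - a • e) B j := by
    simp only [Matrix.vecMul, dotProduct]
    apply Finset.dvd_sum
    intro i _
    apply Dvd.dvd.mul_right
    exact hA i
  rw [Matrix.sub_vecMul, Matrix.smul_vecMul, Pi.sub_apply, Pi.smul_apply, smul_eq_mul] at h1
  have := dvd_add h1 ((hB j).mul_left a)
  convert this using 1; ring

lemma EigM.one {d : ℕ} (W : k[X]) (e : Fin d → k[X]) : EigM W e 1 1 := by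
  intro j; simp

lemma EigM.pow {d : ℕ} {W : k[X]} {e : Fin d → k[X]} {A : Matrix (Fin d) (Fin d) k[X]}
    {a : k[X]} (hA : EigM W e A a) (n : ℕ) : EigM W e (A ^ n) (a ^ n) := by
  induction n with
  | zero => simpa using EigM.one W e
  | succ n ih => rw [pow_succ, pow_succ]; exact ih.mul hA

lemma EigM.sum {d : ℕ} {W : k[X]} {e : Fin d → k[X]} {ι : Type} (s : Finset ι)
    {A : ι → Matrix (Fin d) (Fin d) k[X]}
    {a : ι → k[X]} (hA : ∀ i, EigM W e (A i) (a i)) : EigM W e (∑ i ∈ s, A i) (∑ i ∈ s, a i) := by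
  classical
  induction s using Finset.induction_on with
  | empty => intro j; simp
  | insert x s hx ih => rw [Finset.sum_insert hx, Finset.sum_insert hx]; exact (hA x).add ih

lemma EigM.det {d : ℕ} {W : k[X]} {e : Fin d → k[X]} {A : Matrix (Fin d) (Fin d) k[X]}
    {a : k[X]} (hA : EigM W e A a) (ha : W ∣ a) (i0 : Fin d) (h1 : e i0 = 1) : W ∣ A.det := by
  have h2 : ∀ j, W ∣ Matrix.vecMul e A j := fun j => by
    have := dvd_add (hA j) (ha.mul_right (e j)); simpa using this
  have h3 : Matrix.vecMul (Matrix.vecMul e A) A.adjugate i0 = A.det := by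
    rw [Matrix.vecMul_vecMul, Matrix.mul_adjugate, Matrix.vecMul_smul, Matrix.vecMul_one]
    simp [h1]
  rw [← h3]
  simp only [Matrix.vecMul, dotProduct]
  apply Finset.dvd_sum
  intro i _
  exact (h2 i).mul_right _

lemma quad_zero {K E : Type} [Field K] [Field E] [Algebra k[X] K] [IsFractionRing k[X] K]
    [Algebra K E] [FiniteDimensional K E] (hodd : Odd (Module.finrank K E)) (γ : k[X])
    (hγ : γ.natDegree = 1) (a b : E)
    (h : a ^ 2 + a * b + algebraMap K E (algebraMap k[X] K γ) * b ^ 2 = 0) : a = 0 ∧ b = 0 := by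
  by_cases hb : b = 0
  · subst hb; simpa using h
  exfalso
  set τ := a / b with hτ
  have h1 : τ ^ 2 + τ + algebraMap K E (algebraMap k[X] K γ) = 0 := by
    rw [hτ]; field_simp; linear_combination h
  have hInt : IsIntegral K τ := IsIntegral.of_finite K τ
  have h2 : (minpoly K τ).natDegree ≤ 2 := by
    have h3 : aeval τ (X ^ 2 + X + C (algebraMap k[X] K γ)) = 0 := by simpa using h1
    have h4 : (X ^ 2 + X + C (algebraMap k[X] K γ) : K[X]).natDegree = 2 := by compute_degree!
    have h5 : (X ^ 2 + X + C (algebraMap k[X] K γ) : K[X]) ≠ 0 := by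
      intro h; rw [h] at h4; simp at h4
    have := natDegree_le_of_dvd (minpoly.dvd K τ h3) h5
    omega
  have h3 := Odd.of_dvd_nat hodd (minpoly.degree_dvd hInt)
  have h4 : (minpoly K τ).natDegree = 1 := by
    obtain ⟨r, hr⟩ := h3; omega
  obtain ⟨σ, hσ⟩ := minpoly.natDegree_eq_one_iff.1 h4
  have h5 : σ ^ 2 + σ + algebraMap k[X] K γ = 0 := by
    apply (algebraMap K E).injective
    simp only [map_add, map_pow, map_zero]
    rw [hσ]; exact h1
  have h6 : IsIntegral k[X] σ := by
    refine ⟨X ^ 2 + X + C γ, ?_, ?_⟩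
    · have : (X ^ 2 + X + C γ : k[X][X]) = X ^ 2 + (X + C γ) := by ring
      rw [this]
      apply monic_X_pow_add
      rw [degree_X_add_C]; norm_num
    · simpa using h5
  obtain ⟨ρ, hρ⟩ := IsIntegrallyClosed.isIntegral_iff.1 h6
  have h7 : ρ ^ 2 + ρ + γ = 0 := by
    apply IsFractionRing.injective k[X] K
    simp only [map_add, map_pow, map_zero]
    rw [hρ]; exact h5
  have h8 : γ = - (ρ * (ρ + 1)) := by linear_combination h7
  rw [h8, natDegree_neg] at hγ
  by_cases hρ0 : ρ.natDegree = 0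
  · obtain ⟨r, hr⟩ := natDegree_eq_zero.1 hρ0
    rw [← hr, ← C_1, ← C_add, ← C_mul, natDegree_C] at hγ
    omega
  · have h9 : (ρ + 1).natDegree = ρ.natDegree := by
      rw [← C_1, natDegree_add_C]
    rw [natDegree_mul, h9] at hγ
    · omega
    · intro h; simp [h] at hρ0
    · intro h; rw [h] at h9; simp at h9; omega

lemma nonvan_pb [CharP k 2] {K E : Type} [Field K] [Field E] [Algebra k[X] K]
    [IsFractionRing k[X] K]
    [Algebra K E] (pb : PowerBasis K E) (d : ℕ) (hd : pb.dim = d) (hodd : Odd d) (G γ : k[X])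
    (hmin : pb.minpolyGen = X ^ d - C (algebraMap k[X] K G)) (hγ : γ.natDegree = 1)
    (W y T : k[X]) (hy : W ∣ y ^ d - G) (hT : W ∣ T ^ 2 + T - γ) (p q : Fin d → k[X]) (D : ℕ)
    (hp : ∀ i, (p i).natDegree ≤ D) (hq : ∀ i, (q i).natDegree ≤ D)
    (hW : d * (2 * (D + d * G.natDegree) + 1) < W.natDegree)
    (hz : W ∣ ∑ i, p i * y ^ (i : ℕ) + (∑ i, q i * y ^ (i : ℕ)) * T) :
    p = 0 ∧ q = 0 := by
  subst hd
  have hfin : FiniteDimensional K E := pb.finite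
  have hd0 : 0 < pb.dim := hodd.pos
  set Y := compM pb.dim G with hY
  set A : Matrix (Fin pb.dim) (Fin pb.dim) k[X] := ∑ i, p i • Y ^ (i : ℕ) with hA
  set B : Matrix (Fin pb.dim) (Fin pb.dim) k[X] := ∑ i, q i • Y ^ (i : ℕ) with hB
  set V := A ^ 2 + A * B + γ • B ^ 2 with hV
  set e : Fin pb.dim → k[X] := fun i => y ^ (i : ℕ) with he
  have eY : EigM W e Y y := compM_vec pb.dim G W y hy
  have eA : EigM W e A (∑ i, p i * y ^ (i : ℕ)) := EigM.sum _ (fun i => (eY.pow i).smul _)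
  have eB : EigM W e B (∑ i, q i * y ^ (i : ℕ)) := EigM.sum _ (fun i => (eY.pow i).smul _)
  have eV := ((eA.pow 2).add (eA.mul eB)).add ((eB.pow 2).smul γ)
  rw [← hV] at eV
  have hdet : W ∣ V.det := by
    refine eV.det ?_ ⟨0, hd0⟩ (by simp [he])
    generalize (∑ i, p i * y ^ (i : ℕ)) = u0 at *
    generalize (∑ i, q i * y ^ (i : ℕ)) = u1 at *
    have h1 := (hz.mul_right (u0 + u1 * (T + 1))).add (hT.mul_left (- u1 ^ 2))
    have h2 : (2 : k[X]) = 0 := CharTwo.two_eq_zero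
    convert h1 using 1
    linear_combination (-u0 * u1 * T) * h2
  have dY : MatDeg G.natDegree Y := compM_deg _ _
  have dA : ∀ r : Fin pb.dim → k[X], (∀ i, (r i).natDegree ≤ D) →
      MatDeg (D + pb.dim * G.natDegree) (∑ i, r i • Y ^ (i : ℕ)) := by
    intro r hr
    apply MatDeg.sum
    intro i _
    refine ((dY.pow i).smul (hr i)).mono ?_
    have := Nat.mul_le_mul_right G.natDegree i.2.le
    omega
  have dV : MatDeg (2 * (D + pb.dim * G.natDegree) + 1) V := by
    refine MatDeg.add (MatDeg.add (((dA p hp).pow 2).mono (by omega))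
      (((dA p hp).mul (dA q hq)).mono (by omega))) ?_
    refine (((dA q hq).pow 2).smul (le_of_eq hγ)).mono (by omega)
  have hdet0 : V.det = 0 := by
    by_contra h
    have := natDegree_le_of_dvd hdet h
    have := dV.det
    omega
  -- now transfer to `E`
  have hYm : (algebraMap k[X] K).mapMatrix Y = Algebra.leftMulMatrix pb.basis pb.gen := by
    rw [pb.leftMulMatrix, hmin]
    ext i j
    simp only [RingHom.mapMatrix_apply, Matrix.map_apply, hY, compM, Matrix.of_apply, coeff_sub,
      coeff_X_pow, coeff_C]
    have := i.2
    split_ifs <;> first | omega | simp_all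
  have hc : ∀ r : k[X], ∀ M : Matrix (Fin pb.dim) (Fin pb.dim) k[X], ∀ v : E,
      (algebraMap k[X] K).mapMatrix M = Algebra.leftMulMatrix pb.basis v →
      (algebraMap k[X] K).mapMatrix (r • M) =
        Algebra.leftMulMatrix pb.basis (algebraMap K E (algebraMap k[X] K r) * v) := by
    intro r M v h
    rw [← Algebra.smul_def, map_smul (Algebra.leftMulMatrix pb.basis), ← h]
    ext i j
    simp
  have hr : ∀ r : Fin pb.dim → k[X],
      (algebraMap k[X] K).mapMatrix (∑ i, r i • Y ^ (i : ℕ)) =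
        Algebra.leftMulMatrix pb.basis
          (∑ i, algebraMap K E (algebraMap k[X] K (r i)) * pb.gen ^ (i : ℕ)) := by
    intro r
    rw [map_sum, map_sum]
    apply Finset.sum_congr rfl
    intro i _
    apply hc
    rw [map_pow, map_pow, hYm]
  set a := ∑ i, algebraMap K E (algebraMap k[X] K (p i)) * pb.gen ^ (i : ℕ) with ha
  set b := ∑ i, algebraMap K E (algebraMap k[X] K (q i)) * pb.gen ^ (i : ℕ) with hb
  have hVm : (algebraMap k[X] K).mapMatrix V = Algebra.leftMulMatrix pb.basis
      (a ^ 2 + a * b + algebraMap K E (algebraMap k[X] K γ) * b ^ 2) := by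
    have hA' := hr p
    have hB' := hr q
    rw [← hA, ← ha] at hA'
    rw [← hB, ← hb] at hB'
    rw [hV, map_add, map_add, hc γ (B ^ 2) (b ^ 2), map_mul, map_pow, hA', hB', ← map_mul,
      ← map_pow, ← map_add, ← map_add]
    rw [map_pow, map_pow, hB']
  have hn : a ^ 2 + a * b + algebraMap K E (algebraMap k[X] K γ) * b ^ 2 = 0 := by
    rw [← Algebra.norm_eq_zero_iff (R := K), Algebra.norm_eq_matrix_det pb.basis, ← hVm,
      ← RingHom.map_det, hdet0, map_zero]
  have hab := quad_zero (by rw [pb.finrank]; exact hodd) γ hγ a b hn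
  have hfinal : ∀ r : Fin pb.dim → k[X],
      ∑ i, algebraMap K E (algebraMap k[X] K (r i)) * pb.gen ^ (i : ℕ) = 0 → r = 0 := by
    intro r hr
    have h1 : ∑ i, (algebraMap k[X] K (r i)) • pb.basis i = 0 := by
      rw [← hr]
      apply Finset.sum_congr rfl
      intro i _
      rw [pb.basis_eq_pow, Algebra.smul_def]
    have h2 := Fintype.linearIndependent_iff.1 pb.basis.linearIndependent _ h1
    funext i
    apply IsFractionRing.injective k[X] K
    simpa using h2 i
  exact ⟨hfinal p hab.1, hfinal q hab.2⟩

lemma nonvan [CharP k 2] (d : ℕ) (hodd : Odd d) (G γ : k[X])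
    (hG : ∀ p : ℕ, p.Prime → p ∣ d → ∀ w : k[X], w ^ p ≠ G) (hγ : γ.natDegree = 1)
    (W y T : k[X]) (hy : W ∣ y ^ d - G) (hT : W ∣ T ^ 2 + T - γ) (p q : Fin d → k[X]) (D : ℕ)
    (hp : ∀ i, (p i).natDegree ≤ D) (hq : ∀ i, (q i).natDegree ≤ D)
    (hW : d * (2 * (D + d * G.natDegree) + 1) < W.natDegree)
    (hz : W ∣ ∑ i, p i * y ^ (i : ℕ) + (∑ i, q i * y ^ (i : ℕ)) * T) :
    p = 0 ∧ q = 0 := by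
  let K := FractionRing k[X]
  have hirr : Irreducible (X ^ d - C (algebraMap k[X] K G)) := by
    apply X_pow_sub_C_irreducible_of_odd hodd
    intro p hp hpd b hb
    have h1 : IsIntegral k[X] (b ^ p) := by rw [hb]; exact isIntegral_algebraMap
    obtain ⟨w, hw⟩ := IsIntegrallyClosed.exists_algebraMap_eq_of_isIntegral_pow hp.pos h1
    apply hG p hp hpd w
    apply IsFractionRing.injective k[X] K
    rw [map_pow, hw, hb]
  have := Fact.mk hirr
  have hm : (X ^ d - C (algebraMap k[X] K G)).Monic := monic_X_pow_sub_C _ hodd.pos.ne'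
  refine nonvan_pb (K := K) (E := AdjoinRoot (X ^ d - C (algebraMap k[X] K G)))
    (AdjoinRoot.powerBasis hirr.ne_zero) d ?_ hodd G γ ?_ hγ W y T hy hT p q D hp hq hW hz
  · rw [AdjoinRoot.powerBasis_dim, natDegree_X_pow_sub_C]
  · rw [PowerBasis.minpolyGen_eq, AdjoinRoot.minpoly_powerBasis_gen_of_monic hm]

end
end Stp

open Polynomial

namespace Stp

section
variable {k : Type} [Field k] [CharP k 2]

lemma natDegree_Wp (m : ℕ) (x0 : k) : (Wp m x0).natDegree = 2 ^ m := by
  rw [Wp, natDegree_X_pow_sub_C]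

lemma natDegree_Tp_le (m : ℕ) (c : k) : (Tp m c).natDegree ≤ 2 ^ m := by
  rw [Tp]
  apply natDegree_sum_le_of_forall_le
  intro i hi
  refine (natDegree_pow_le).trans ?_
  have h1 := natDegree_C_mul_le c (X : k[X])
  rw [natDegree_X] at h1
  have h2 : 2 ^ i ≤ 2 ^ m := Nat.pow_le_pow_right (by norm_num) (Finset.mem_range.1 hi).le
  exact (Nat.mul_le_mul_left _ h1).trans (by omega)

lemma low_zero {K : ℕ} {W : k[X]} (hW : W ≠ 0) (c : Fin K → k[X]) (h : ∑ l, c l * W ^ (l : ℕ) = 0)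
    (P : Fin K → Prop) (hP0 : ∀ l, P l → c l = 0) (hP1 : ∀ l, W ∣ c l → P l) : ∀ l, P l := by
  have : ∀ n : ℕ, ∀ l : Fin K, (l : ℕ) = n → P l := by
    intro n
    induction n using Nat.strong_induction_on with
    | _ n ih =>
      intro l hl
      apply hP1
      have h1 : W ^ (n + 1) ∣ c l * W ^ (l : ℕ) := by
        rw [← Finset.add_sum_erase _ _ (Finset.mem_univ l)] at h
        rw [eq_neg_of_add_eq_zero_left h, dvd_neg]
        apply Finset.dvd_sum
        intro l' hl'
        rcases lt_or_ge (l' : ℕ) n with h2 | h2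
        · rw [hP0 l' (ih _ h2 l' rfl), zero_mul]; exact dvd_zero _
        · have h3 : (l' : ℕ) ≠ n := by
            intro h; exact (Finset.ne_of_mem_erase hl') (Fin.ext (h.trans hl.symm))
          exact (pow_dvd_pow W (by omega)).mul_left _
      rw [hl, pow_succ', mul_dvd_mul_iff_right (pow_ne_zero _ hW)] at h1
      exact h1
  exact fun l => this l l rfl

lemma aux_ne_zero [Fintype k] (F : k[X]) (hF : F.Monic) (m : ℕ) (hk : Fintype.card k = 2 ^ m)
    (c x0 : k) (hc : c ≠ 0) (hx0 : F.eval x0 ≠ 0) (d K M D e : ℕ) (hodd : Odd d)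
    (he : e * d = 2 ^ m * (d - 1) + 1)
    (hFp : ∀ p : ℕ, p.Prime → p ∣ d → ∀ u : k, u ≠ 0 → ∀ w : k[X], C u * F ≠ w ^ p)
    (p : Fin d × Fin 2 × Fin K → k[X]) (hp : p ≠ 0) (hpD : ∀ x, p x ∈ degreeLT k D)
    (hD : d * (2 * (D + d * F.natDegree) + 1) < 2 ^ m) :
    auxPoly F m c x0 d K M e p ≠ 0 := by
  intro h0
  apply hp
  have hpow : ∀ a : k, a ^ (2 ^ m) = a := fun a => by rw [← hk]; exact FiniteField.pow_card a
  have hW : Wp m x0 ≠ 0 := by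
    intro h; have := natDegree_Wp m x0; rw [h] at this; simp at this
    exact absurd this.symm (by positivity)
  set W := Wp m x0 with hWdef
  set y := F ^ e with hy
  set T := Tp m c with hT
  set κ := (F.eval x0) ^ (d - 1) with hκ
  have hFN : W ∣ F ^ (2 ^ m) - C (F.eval x0) := by
    rw [← hk, ← FiniteField.expand_card, hk]
    have := sub_dvd_eval_sub (X ^ (2 ^ m) : k[X]) (C x0) (F.map C)
    rw [eval_map, eval_map] at this
    have h2 : eval₂ C (C x0) F = C (F.eval x0) := by
      rw [eval₂_at_apply]
    have h1 : eval₂ C (X ^ (2 ^ m)) F = expand k (2 ^ m) F := rfl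
    rw [h1, h2] at this
    exact this
  have hyd : W ∣ y ^ d - C κ * F := by
    have h1 : y ^ d = (F ^ (2 ^ m)) ^ (d - 1) * F := by
      rw [hy, ← pow_mul, he, pow_succ, pow_mul]
    rw [h1, ← sub_mul, hκ, C_pow]
    exact (hFN.trans (sub_dvd_pow_sub_pow _ _ _)).mul_right _
  have hTT : W ∣ T ^ 2 + T - (C c * X + C (c * x0)) := by
    rw [hT, Tp_sq, mul_pow, ← C_pow, hpow c]
    have : C c * X ^ 2 ^ m + C c * X - (C c * X + C (c * x0)) = C c * W := by
      rw [hWdef, Wp, C_mul]; ring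
    rw [this]; exact dvd_mul_left _ _
  have hκ0 : κ ≠ 0 := pow_ne_zero _ hx0
  have hpdeg : ∀ x, (p x).natDegree ≤ D := fun x => by
    have := (mem_degreeLT).1 (hpD x)
    exact natDegree_le_of_degree_le this.le
  let cc : Fin K → k[X] := fun l => ∑ i : Fin d, p (i, 0, l) * y ^ (i : ℕ) +
    (∑ i : Fin d, p (i, 1, l) * y ^ (i : ℕ)) * T
  have hsum : ∑ l, cc l * W ^ (l : ℕ) = 0 := by
    have h1 : auxPoly F m c x0 d K M e p = F ^ M * ∑ l, cc l * W ^ (l : ℕ) := by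
      have hl : ∀ l, F ^ M * (cc l * W ^ (l : ℕ)) = ∑ i : Fin d, ∑ j : Fin 2,
          F ^ (M + e * (i : ℕ)) * p (i, j, l) * T ^ (j : ℕ) * W ^ (l : ℕ) := by
        intro l
        simp only [cc, Fin.sum_univ_two, Fin.val_zero, Fin.val_one, pow_zero, pow_one, mul_one]
        rw [Finset.sum_mul, ← Finset.sum_add_distrib, Finset.sum_mul, Finset.mul_sum]
        apply Finset.sum_congr rfl
        intro i _
        rw [pow_add, pow_mul, ← hy]; ring
      rw [auxPoly, Fintype.sum_prod_type, Finset.mul_sum]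
      simp only [hl, Fintype.sum_prod_type]
      rw [Finset.sum_comm (s := Finset.univ (α := Fin K))]
      apply Finset.sum_congr rfl
      intro i _
      rw [Finset.sum_comm]
    rw [h1] at h0
    rcases mul_eq_zero.1 h0 with h | h
    · exact absurd h (pow_ne_zero _ hF.ne_zero)
    · exact h
  have key := low_zero hW cc hsum (fun l => (∀ i, p (i, 0, l) = 0) ∧ ∀ i, p (i, 1, l) = 0) ?_ ?_
  · funext ⟨i, j, l⟩
    fin_cases j
    · exact (key l).1 i
    · exact (key l).2 i
  · rintro l ⟨h1, h2⟩
    simp [cc, h1, h2]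
  · intro l hl
    have := nonvan d hodd (C κ * F) (C c * X + C (c * x0))
      (fun q hq hqd w h => hFp q hq hqd κ hκ0 w h.symm) (natDegree_linear hc) W y T hyd hTT
      (fun i => p (i, 0, l)) (fun i => p (i, 1, l)) D (fun i => hpdeg _) (fun i => hpdeg _)
      (by rw [hWdef, natDegree_Wp, natDegree_C_mul hκ0]; exact hD) hl
    exact ⟨fun i => congrFun this.1 i, fun i => congrFun this.2 i⟩

lemma count_mul_le (P : k[X]) (hP : P ≠ 0) (M : ℕ) (S : Finset k)
    (h : ∀ a ∈ S, ∀ l < M, (hasseDeriv l P).eval a = 0) : S.card * M ≤ P.natDegree := by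
  classical
  have h1 : ∀ a ∈ S, M ≤ P.roots.count a := by
    intro a ha
    rw [count_roots, le_rootMultiplicity_iff hP]
    have h2 : X ^ M ∣ taylor a P := by
      rw [X_pow_dvd_iff]
      intro l hl
      rw [taylor_coeff]
      exact h a ha l hl
    have h3 := map_dvd (taylorEquiv (-a)).toRingEquiv h2
    obtain ⟨r, hr⟩ := h2
    refine ⟨taylor (-a) r, ?_⟩
    have h4 : taylor (-a) (taylor a P) = P := by
      rw [taylor_taylor]; simp
    rw [← h4, hr]
    simp [taylor_mul, taylor_pow, taylor_X, sub_eq_add_neg]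
  calc S.card * M = ∑ a ∈ S, M := by simp
    _ ≤ ∑ a ∈ S, P.roots.count a := Finset.sum_le_sum h1
    _ ≤ P.roots.card := by
      have h5 : (∑ a ∈ S, Multiset.replicate (P.roots.count a) a) ≤ P.roots := by
        rw [Multiset.le_iff_count]
        intro b
        rw [Multiset.count_sum']
        simp only [Multiset.count_replicate]
        rw [Finset.sum_ite_eq']
        split_ifs <;> simp
      have := Multiset.card_le_card h5
      simpa using this
    _ ≤ P.natDegree := card_roots' P

lemma aux_deg (F : k[X]) (hF : F.Monic) (m : ℕ) (c x0 : k) (d K M D e : ℕ)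
    (he : e * d = 2 ^ m * (d - 1) + 1) (hM : M ≤ 2 ^ m) (hDN : D ≤ 2 ^ m)
    (p : Fin d × Fin 2 × Fin K → k[X]) (hpD : ∀ x, p x ∈ degreeLT k D) :
    (auxPoly F m c x0 d K M e p).natDegree ≤ 2 ^ m * (K + F.natDegree * (d + 1) + 2) := by
  rw [auxPoly]
  apply natDegree_sum_le_of_forall_le
  rintro ⟨i, j, l⟩ _
  refine natDegree_mul_le.trans ?_
  refine (Nat.add_le_add_right natDegree_mul_le _).trans ?_
  refine (Nat.add_le_add_right (Nat.add_le_add_right natDegree_mul_le _) _).trans ?_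
  rw [hF.natDegree_pow, natDegree_pow (Wp m x0), natDegree_Wp]
  have h1 : (Tp m c ^ (j : ℕ)).natDegree ≤ 2 ^ m := by
    refine natDegree_pow_le.trans ?_
    have := natDegree_Tp_le m c
    have hj : (j : ℕ) ≤ 1 := by omega
    nlinarith
  have h2 : (p (i, j, l)).natDegree ≤ D := by
    have := (mem_degreeLT).1 (hpD (i, j, l))
    exact natDegree_le_of_degree_le this.le
  have h3 : (l : ℕ) * 2 ^ m ≤ K * 2 ^ m := Nat.mul_le_mul_right _ l.2.le
  have h4 : e * (i : ℕ) ≤ 2 ^ m * d := by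
    have : e * (i : ℕ) ≤ e * d := Nat.mul_le_mul_left _ i.2.le
    have hd : 0 < d := i.pos
    obtain ⟨d', rfl⟩ : ∃ d', d = d' + 1 := ⟨d - 1, by omega⟩
    have : 0 < 2 ^ m := by positivity
    simp only [Nat.add_sub_cancel] at he
    nlinarith
  have h5 : (M + e * (i : ℕ)) * F.natDegree ≤ (2 ^ m + 2 ^ m * d) * F.natDegree :=
    Nat.mul_le_mul_right _ (by omega)
  simp only
  nlinarith

end

lemma num_params (n0 d s κ : ℕ) (hd0 : 0 < d) (hκ : κ = 16 * d * (3 * d * s + 2)) (hge : κ ≤ n0) :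
    ∃ D, 2 * d * n0 ≤ n0 ^ 2 ∧ D ≤ n0 ^ 2 ∧
      2 * d * n0 * (D + (n0 + κ) + (2 * d * n0 + d) * s) < 2 * d * (n0 + κ) * D ∧
      d * (2 * (D + d * s) + 1) < n0 ^ 2 := by
  have hκ1 : 32 * d ≤ κ := by
    rw [hκ]
    have : 16 * d * (3 * d * s + 2) = 32 * d + 16 * d * (3 * d * s) := by ring
    omega
  have hn32 : 32 * d ≤ n0 := hκ1.trans hge
  have hn1 : 1 ≤ n0 := by omega
  have hsq : 32 * d * n0 ≤ n0 ^ 2 := by rw [sq]; exact Nat.mul_le_mul_right _ hn32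
  have hsq2 : 32 * d * 1 ≤ 32 * d * n0 := Nat.mul_le_mul_left _ hn1
  obtain ⟨D, hD⟩ : ∃ D, D = n0 ^ 2 / (8 * d) := ⟨_, rfl⟩
  have hD1 : D * (8 * d) ≤ n0 ^ 2 := by rw [hD]; exact Nat.div_mul_le_self _ _
  have hD2 : n0 ^ 2 < (D + 1) * (8 * d) := by
    rw [hD, mul_comm]; exact Nat.lt_mul_div_succ _ (by omega)
  have hD3 : n0 ^ 2 < 16 * d * D := by
    have : (D + 1) * (8 * d) = D * (8 * d) + 8 * d := by ring
    have : 16 * d * D = 2 * (D * (8 * d)) := by ring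
    omega
  have hD4 : D ≤ D * (8 * d) := Nat.le_mul_of_pos_right _ (by omega)
  refine ⟨D, ?_, by omega, ?_, ?_⟩
  · have : 32 * d * n0 = 16 * (2 * d * n0) := by ring
    omega
  · have h1 : n0 * (n0 + κ + (2 * d * n0 + d) * s) < κ * D := by
      have h2 : n0 + κ + (2 * d * n0 + d) * s ≤ n0 * (3 * d * s + 2) := by
        have h3 : d * s ≤ n0 * (d * s) := Nat.le_mul_of_pos_left _ hn1
        have h4 : n0 * (3 * d * s + 2) = 3 * (n0 * (d * s)) + 2 * n0 := by ring
        have h5 : (2 * d * n0 + d) * s = 2 * (n0 * (d * s)) + d * s := by ring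
        omega
      calc n0 * (n0 + κ + (2 * d * n0 + d) * s) ≤ n0 * (n0 * (3 * d * s + 2)) :=
            Nat.mul_le_mul_left _ h2
        _ = n0 ^ 2 * (3 * d * s + 2) := by ring
        _ < 16 * d * D * (3 * d * s + 2) := Nat.mul_lt_mul_of_pos_right hD3 (by omega)
        _ = κ * D := by rw [hκ]; ring
    have h3 : 2 * d * n0 * (D + (n0 + κ) + (2 * d * n0 + d) * s) =
      2 * d * (n0 * D + n0 * (n0 + κ + (2 * d * n0 + d) * s)) := by ring
    have h4 : 2 * d * (n0 + κ) * D = 2 * d * (n0 * D + κ * D) := by ring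
    rw [h3, h4]
    exact Nat.mul_lt_mul_of_pos_left (by omega) (by omega)
  · have h1 : d * (2 * (D + d * s) + 1) = 2 * (D * d) + (2 * (d * (d * s)) + d) := by ring
    have h2 : κ = 48 * (d * (d * s)) + 32 * d := by rw [hκ]; ring
    have h3 : D * (8 * d) = 8 * (D * d) := by ring
    have h4 : n0 ≤ d * n0 := Nat.le_mul_of_pos_left _ hd0
    have h5 : 32 * d * n0 = 32 * (d * n0) := by ring
    omega

/-- the upper bound on a fibre -/
lemma fibre_upper {k : Type} [Field k] [CharP k 2] [Fintype k] (F : k[X]) (hF : F.Monic) (m : ℕ)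
    (hk : Fintype.card k = 2 ^ m) (n0 : ℕ) (hn0 : 2 ^ m = n0 ^ 2)
    (c : k) (hc : c ≠ 0) (d : ℕ) (hodd : Odd d) (hd : d ∣ 2 ^ m - 1)
    (hFp : ∀ p : ℕ, p.Prime → p ∣ d → ∀ u : k, u ≠ 0 → ∀ w : k[X], C u * F ≠ w ^ p)
    (z t : k) (S : Finset k)
    (hS : ∀ a ∈ S, F.eval a ≠ 0 ∧ F.eval a ^ ((2 ^ m - 1) / d) = z ∧ (Tp m c).eval a = t) :
    S.card * (2 * d) ≤ n0 ^ 2 +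
      (2 * d) * (16 * d * (3 * d * F.natDegree + 2) + F.natDegree * (d + 1) + 2) * n0 := by
  obtain ⟨s, hs⟩ : ∃ s, s = F.natDegree := ⟨_, rfl⟩
  obtain ⟨κ, hκ⟩ : ∃ κ, κ = 16 * d * (3 * d * s + 2) := ⟨_, rfl⟩
  rw [← hs, ← hκ]
  have hd0 : 0 < d := hodd.pos
  have hcard : S.card ≤ n0 ^ 2 := by
    rw [← hn0, ← hk]; exact Finset.card_le_univ S
  rcases lt_or_ge n0 κ with hlt | hge
  · have h1 : S.card ≤ κ * n0 := hcard.trans (by rw [sq]; exact Nat.mul_le_mul_right _ hlt.le)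
    have h2 : S.card * (2 * d) ≤ κ * n0 * (2 * d) := Nat.mul_le_mul_right _ h1
    have h3 : (2 * d) * (κ + s * (d + 1) + 2) * n0 = κ * n0 * (2 * d) +
      (2 * d) * (s * (d + 1) + 2) * n0 := by ring
    omega
  rcases S.eq_empty_or_nonempty with h | ⟨x0, hx0⟩
  · subst h; simp
  have hx0F := (hS x0 hx0).1
  have hpos : 0 < 2 ^ m := by positivity
  obtain ⟨q, hq⟩ := hd
  have hqd : (2 ^ m - 1) / d = q := by rw [hq]; exact Nat.mul_div_cancel_left _ hd0
  have hN : 2 ^ m = d * q + 1 := by omega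
  obtain ⟨e, he⟩ : ∃ e, e = q * (d - 1) + 1 := ⟨_, rfl⟩
  have hed : e * d = 2 ^ m * (d - 1) + 1 := by
    obtain ⟨d', rfl⟩ : ∃ d', d = d' + 1 := ⟨d - 1, by omega⟩
    rw [hN, he]; simp only [Nat.add_sub_cancel]; ring
  have hn1 : 1 ≤ n0 := by
    rcases Nat.eq_zero_or_pos n0 with h | h
    · rw [h] at hn0; simp at hn0
    · exact h
  obtain ⟨D, hMN, hDN, hdim, hnv⟩ := num_params n0 d s κ hd0 hκ hge
  rw [← hn0] at hMN hDN hnv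
  rw [hs] at hdim hnv
  obtain ⟨p, hp0, hpD, hp⟩ := exists_aux F hF m c x0 d (n0 + κ) (2 * d * n0) D e (z ^ (d - 1)) t
    hMN hdim
  have hne := aux_ne_zero F hF m hk c x0 hc hx0F d (n0 + κ) (2 * d * n0) D e hodd hed hFp p hp0
    hpD hnv
  have hcount := count_mul_le _ hne (2 * d * n0) S (by
    intro a ha
    refine hp a (by rw [← hk]; exact FiniteField.pow_card a) ?_ (hS a ha).2.2
    have h1 := (hS a ha).2.1
    rw [hqd] at h1
    rw [he, pow_succ, pow_mul, h1, mul_comm])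
  have hdeg := aux_deg F hF m c x0 d (n0 + κ) (2 * d * n0) D e hed hMN hDN p hpD
  have h1 := hcount.trans hdeg
  rw [hn0, ← hs] at h1
  have h2 : S.card * (2 * d) ≤ n0 * (n0 + κ + s * (d + 1) + 2) := by
    have : (S.card * (2 * d)) * n0 ≤ (n0 * (n0 + κ + s * (d + 1) + 2)) * n0 := by
      calc _ = S.card * (2 * d * n0) := by ring
        _ ≤ _ := h1
        _ = _ := by ring
    exact Nat.le_of_mul_le_mul_right this hn1
  have h3 : n0 * (κ + s * (d + 1) + 2) ≤ 2 * d * (n0 * (κ + s * (d + 1) + 2)) :=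
    Nat.le_mul_of_pos_left _ (by omega)
  calc S.card * (2 * d) ≤ n0 * (n0 + κ + s * (d + 1) + 2) := h2
    _ = n0 ^ 2 + n0 * (κ + s * (d + 1) + 2) := by ring
    _ ≤ n0 ^ 2 + 2 * d * (n0 * (κ + s * (d + 1) + 2)) := by omega
    _ = _ := by ring

end Stp

open Polynomial

namespace Stp

section
variable {k : Type} [Field k] [CharP k 2] [Fintype k]

lemma Tp_eval (m : ℕ) (c x : k) : (Tp m c).eval x = ∑ i ∈ Finset.range m, (c * x) ^ (2 ^ i) := by
  simp [Tp, eval_finsetSum]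

lemma Tp_eval_add (m : ℕ) (c x y : k) :
    (Tp m c).eval (x + y) = (Tp m c).eval x + (Tp m c).eval y := by
  simp only [Tp_eval]
  rw [← Finset.sum_add_distrib]
  apply Finset.sum_congr rfl
  intro i _
  rw [mul_add, add_pow_char_pow]

lemma Tp_eval_cases (m : ℕ) (hk : Fintype.card k = 2 ^ m) (c x : k) :
    (Tp m c).eval x = 0 ∨ (Tp m c).eval x = 1 := by
  have h := congrArg (eval x) (Tp_sq m c)
  have h1 : (c * x) ^ (2 ^ m) = c * x := by rw [← hk]; exact FiniteField.pow_card _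
  simp only [eval_add, eval_pow, eval_mul, eval_C, eval_X, h1, CharTwo.add_self_eq_zero] at h
  have h2 : (Tp m c).eval x * ((Tp m c).eval x - 1) = 0 := by
    rw [CharTwo.sub_eq_add]; linear_combination h
  rcases mul_eq_zero.1 h2 with h3 | h3
  · exact Or.inl h3
  · exact Or.inr (sub_eq_zero.1 h3)

lemma exists_Tp_ne (m : ℕ) (hk : Fintype.card k = 2 ^ m) : ∃ x : k, (Tp m 1).eval x ≠ 0 := by
  classical
  have hm : m ≠ 0 := by
    rintro rfl
    have := Fintype.one_lt_card (α := k)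
    simp [hk] at this
  obtain ⟨r, rfl⟩ : ∃ r, m = r + 1 := ⟨m - 1, by omega⟩
  by_contra h
  push Not at h
  have hne : Tp (r + 1) (1 : k) ≠ 0 := by
    intro h0
    have h1 := congrArg (fun p => coeff p 1) h0
    simp only [Tp, C_1, one_mul, finsetSum_coeff, coeff_X_pow, coeff_zero] at h1
    rw [Finset.sum_eq_single 0] at h1
    · simp at h1
    · intro b _ hb
      rw [if_neg]
      intro h2
      have : 2 ^ 1 ≤ 2 ^ b := Nat.pow_le_pow_right (by norm_num) (by omega)
      omega
    · simp
  have hdeg : (Tp (r + 1) (1 : k)).natDegree ≤ 2 ^ r := by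
    rw [Tp]
    apply natDegree_sum_le_of_forall_le
    intro i hi
    simp only [C_1, one_mul, natDegree_X_pow]
    exact Nat.pow_le_pow_right (by norm_num) (by have := Finset.mem_range.1 hi; omega)
  have h1 : Fintype.card k ≤ (Tp (r + 1) (1 : k)).natDegree := by
    have h2 : (Finset.univ : Finset k).card * 1 ≤ (Tp (r + 1) (1 : k)).natDegree := by
      apply count_mul_le _ hne
      intro a _ l hl
      obtain rfl : l = 0 := by omega
      simpa using h a
    simpa using h2
  rw [hk, pow_succ] at h1
  have : 0 < 2 ^ r := by positivity
  omega

open Classical in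
lemma exists_c (m : ℕ) (hk : Fintype.card k = 2 ^ m) (ψ : AddChar k ℂ) (hψ : ψ ≠ 1) :
    ∃ c : k, c ≠ 0 ∧ ∀ x, ψ x = if (Tp m c).eval x = 0 then 1 else -1 := by
  let ψ0 : AddChar k ℂ :=
    { toFun := fun x => if (Tp m 1).eval x = 0 then 1 else -1
      map_zero_eq_one' := by simp [Tp_eval]
      map_add_eq_mul' := by
        intro a b
        rw [Tp_eval_add]
        rcases Tp_eval_cases m hk 1 a with h1 | h1 <;>
        rcases Tp_eval_cases m hk 1 b with h2 | h2 <;>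
        simp [h1, h2, CharTwo.add_self_eq_zero] }
  have h0 : ψ0 ≠ 1 := by
    obtain ⟨x, hx⟩ := exists_Tp_ne (k := k) m hk
    intro h
    have := DFunLike.congr_fun h x
    simp only [ψ0, AddChar.coe_mk, if_neg hx, AddChar.one_apply] at this
    norm_num at this
  have hinj := AddChar.to_mulShift_inj_of_isPrimitive (AddChar.IsPrimitive.of_ne_one h0)
  have hbij : Function.Bijective (ψ0.mulShift) :=
    (Fintype.bijective_iff_injective_and_card _).2 ⟨hinj, AddChar.card_eq.symm⟩
  obtain ⟨c, hc⟩ := hbij.2 ψ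
  refine ⟨c, ?_, ?_⟩
  · rintro rfl
    apply hψ
    rw [← hc]; simp
  · intro x
    rw [← hc, AddChar.mulShift_apply]
    simp only [ψ0, AddChar.coe_mk, Tp_eval, one_mul]

lemma chi_eq (d q : ℕ) (hq : Fintype.card k - 1 = d * q) (hd0 : 0 < d) (χ : MulChar k ℂ)
    (hχ : χ ^ d = 1)
    (a b : k) (ha : a ≠ 0) (hb : b ≠ 0) (h : a ^ q = b ^ q) : χ a = χ b := by
  classical
  have hq0 : 0 < q := by
    rcases Nat.eq_zero_or_pos q with h | h
    · have := Fintype.one_lt_card (α := k); rw [h] at hq; omega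
    · exact h
  obtain ⟨g, hg⟩ := IsCyclic.exists_generator (α := kˣ)
  have hord := orderOf_eq_card_of_forall_mem_zpowers hg
  rw [Nat.card_eq_fintype_card, Fintype.card_units, hq] at hord
  let u := Units.mk0 a ha
  let v := Units.mk0 b hb
  obtain ⟨j, hj⟩ := Subgroup.mem_zpowers_iff.1 (hg (u / v))
  have h1 : (u / v) ^ q = 1 := by
    rw [div_pow, div_eq_one]
    ext; simpa [u, v] using h
  rw [← hj, ← zpow_natCast, ← zpow_mul, ← orderOf_dvd_iff_zpow_eq_one, hord] at h1
  push_cast at h1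
  have h2 : (d : ℤ) ∣ j := Int.dvd_of_mul_dvd_mul_right (by exact_mod_cast hq0.ne') h1
  obtain ⟨i, rfl⟩ := h2
  have h3 : u = (g ^ i) ^ d * v := by
    rw [← zpow_natCast, ← zpow_mul, mul_comm i, hj]; simp
  have h4 : a = ((g ^ i : kˣ) : k) ^ d * b := by
    have := congrArg Units.val h3
    simpa [u, v] using this
  rw [h4, map_mul, map_pow, ← MulChar.pow_apply' χ hd0.ne', hχ, MulChar.one_apply_coe, one_mul]

lemma avg_bound {ι : Type} (I : Finset ι) (n : ι → ℝ) (w : ι → ℂ) (A B : ℝ) (J : ℝ)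
    (hB : 0 ≤ B) (hA : 0 ≤ A) (hJ : (I.card : ℝ) ≤ J)
    (hn : ∀ i ∈ I, n i ≤ A + B) (hw : ∀ i ∈ I, ‖w i‖ ≤ 1) (hw0 : ∑ i ∈ I, w i = 0) (E : ℝ)
    (hsum : J * A - E ≤ ∑ i ∈ I, n i) (hE : 0 ≤ E) :
    ‖∑ i ∈ I, w i * n i‖ ≤ J * (J * B + E) := by
  have h1 : ∀ i ∈ I, |n i - A| ≤ J * B + E := by
    intro i hi
    have hJ1 : (1 : ℝ) ≤ J := by
      have : 1 ≤ I.card := Finset.card_pos.2 ⟨i, hi⟩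
      exact le_trans (by exact_mod_cast this) hJ
    rw [abs_le]
    constructor
    · classical
      rw [← Finset.add_sum_erase _ _ hi] at hsum
      have h2 : ∑ x ∈ I.erase i, n x ≤ (I.erase i).card • (A + B) :=
        Finset.sum_le_card_nsmul _ _ _ (fun x hx => hn x (Finset.mem_of_mem_erase hx))
      rw [Finset.card_erase_of_mem hi, nsmul_eq_mul, Nat.cast_sub (Finset.card_pos.2 ⟨i, hi⟩)] at h2
      push_cast at h2
      have h3 : ((I.card : ℝ) - 1) * (A + B) ≤ (J - 1) * (A + B) :=
        mul_le_mul_of_nonneg_right (by linarith) (by linarith)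
      nlinarith
    · have := hn i hi
      nlinarith
  have h2 : ∑ i ∈ I, w i * n i = ∑ i ∈ I, w i * ((n i - A : ℝ) : ℂ) := by
    push_cast
    simp only [mul_sub, Finset.sum_sub_distrib, ← Finset.sum_mul, hw0, zero_mul, sub_zero]
  rw [h2]
  refine (norm_sum_le _ _).trans ?_
  have h3 : ∀ i ∈ I, ‖w i * ((n i - A : ℝ) : ℂ)‖ ≤ J * B + E := by
    intro i hi
    rw [norm_mul, Complex.norm_real, Real.norm_eq_abs]
    calc _ ≤ 1 * |n i - A| := mul_le_mul_of_nonneg_right (hw i hi) (abs_nonneg _)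
      _ ≤ _ := by rw [one_mul]; exact h1 i hi
  refine (Finset.sum_le_card_nsmul _ _ _ h3).trans ?_
  rw [nsmul_eq_mul]
  apply mul_le_mul_of_nonneg_right hJ
  have : 0 ≤ J := le_trans (Nat.cast_nonneg _) hJ
  positivity

lemma norm_mulChar_le (χ : MulChar k ℂ) (a : k) : ‖χ a‖ ≤ 1 := by
  by_cases ha : a = 0
  · rw [ha, MulChar.map_zero]; simp
  · have h1 : χ a ^ (Fintype.card k - 1) = 1 := by
      rw [← map_pow, FiniteField.pow_card_sub_one_eq_one a ha, map_one]
    have h2 : ‖χ a‖ = 1 := by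
      apply Complex.norm_eq_one_of_pow_eq_one h1
      have := Fintype.one_lt_card (α := k); omega
    rw [h2]

end

theorem stepanov (d s : ℕ) (hodd : Odd d) : ∃ Cst : ℝ, ∀ (k : Type) [Field k] [Fintype k] [CharP k 2]
    (m n0 : ℕ), Fintype.card k = 2 ^ m → 2 ^ m = n0 ^ 2 → d ∣ 2 ^ m - 1 →
    ∀ F : k[X], F.Monic → F.natDegree = s →
    (∀ p : ℕ, p.Prime → p ∣ d → ∀ u : k, u ≠ 0 → ∀ w : k[X], C u * F ≠ w ^ p) →
    ∀ (χ : MulChar k ℂ), χ ^ d = 1 → ∀ (ψ : AddChar k ℂ), (χ ≠ 1 ∨ ψ ≠ 1) →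
    ‖∑ x, χ (F.eval x) * ψ x‖ ≤ Cst * n0 := by
  classical
  have hd0 : 0 < d := hodd.pos
  obtain ⟨B, hB⟩ : ∃ B : ℕ, B = (16 * d * (3 * d * s + 2) + s * (d + 1) + 2) := ⟨_, rfl⟩
  refine ⟨(2 * d) * ((2 * d) * B + s), ?_⟩
  intro k _ _ _ m n0 hk hn0 hd F hF hs hFp χ hχ ψ hne
  obtain ⟨q, hq⟩ := hd
  have hqd : (2 ^ m - 1) / d = q := by rw [hq]; exact Nat.mul_div_cancel_left _ hd0
  have hq' : Fintype.card k - 1 = d * q := by rw [hk]; exact hq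
  have hn1 : 1 ≤ n0 := by
    rcases Nat.eq_zero_or_pos n0 with h | h
    · rw [h] at hn0; simp at hn0
    · exact h
  -- additive part
  obtain ⟨c, Ψ, hc, hΨ, hΨ1, hΨ0⟩ : ∃ (c : k) (Ψ : k → ℂ), c ≠ 0 ∧
      (∀ x, ψ x = Ψ ((Tp m c).eval x)) ∧ (∀ t, ‖Ψ t‖ ≤ 1) ∧ (ψ ≠ 1 → Ψ 0 + Ψ 1 = 0) := by
    by_cases h : ψ = 1
    · exact ⟨1, fun _ => 1, one_ne_zero, fun x => by rw [h]; simp, by simp, fun h' => absurd h h'⟩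
    · obtain ⟨c, hc, hcx⟩ := exists_c m hk ψ h
      refine ⟨c, fun t => if t = 0 then 1 else -1, hc, hcx, ?_, ?_⟩
      · intro t; dsimp only; split_ifs <;> simp
      · intro _; simp
  -- multiplicative part
  let Z : Finset k := (Finset.univ.filter (fun a : k => a ≠ 0)).image (fun a => a ^ q)
  have hZmem : ∀ z, z ∈ Z ↔ ∃ a : k, a ≠ 0 ∧ a ^ q = z := by
    intro z; simp [Z]
  have hZcard : Z.card ≤ d := by
    have h1 : Z ⊆ (nthRoots d (1 : k)).toFinset := by
      intro z hz
      obtain ⟨a, ha, rfl⟩ := (hZmem z).1 hz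
      rw [Multiset.mem_toFinset, mem_nthRoots hd0, ← pow_mul, mul_comm, ← hq']
      exact FiniteField.pow_card_sub_one_eq_one a ha
    exact (Finset.card_le_card h1).trans ((Multiset.toFinset_card_le _).trans (card_nthRoots _ _))
  have hΦex : ∃ Φ : k → ℂ, (∀ a, a ≠ 0 → χ a = Φ (a ^ q)) ∧ (∀ z ∈ Z, ‖Φ z‖ ≤ 1) := by
    have h1 : ∀ z : k, ∃ w : ℂ, ∀ a, a ≠ 0 → a ^ q = z → χ a = w := by
      intro z
      by_cases h : ∃ a : k, a ≠ 0 ∧ a ^ q = z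
      · obtain ⟨b, hb, hbz⟩ := h
        exact ⟨χ b, fun a ha haz => chi_eq d q hq' hd0 χ hχ a b ha hb (haz.trans hbz.symm)⟩
      · exact ⟨0, fun a ha haz => absurd ⟨a, ha, haz⟩ h⟩
    choose Φ hΦ using h1
    refine ⟨Φ, fun a ha => hΦ _ a ha rfl, fun z hz => ?_⟩
    obtain ⟨a, ha, haz⟩ := (hZmem z).1 hz
    rw [← hΦ z a ha haz]
    exact norm_mulChar_le χ a
  obtain ⟨Φ, hΦ, hΦ1⟩ := hΦex
  have hΦ0 : χ ≠ 1 → ∑ z ∈ Z, Φ z = 0 := by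
    intro h
    obtain ⟨b, hb⟩ := MulChar.ne_one_iff.1 h
    have h1 : χ b * ∑ z ∈ Z, Φ z = ∑ z ∈ Z, Φ z := by
      rw [Finset.mul_sum]
      refine Finset.sum_bij' (fun z _ => (b : k) ^ q * z) (fun z _ => ((b⁻¹ : kˣ) : k) ^ q * z)
        ?_ ?_ ?_ ?_ ?_
      · intro z hz
        obtain ⟨a, ha, haz⟩ := (hZmem z).1 hz
        exact (hZmem _).2 ⟨b * a, mul_ne_zero b.ne_zero ha, by rw [mul_pow, haz]⟩
      · intro z hz
        obtain ⟨a, ha, haz⟩ := (hZmem z).1 hz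
        exact (hZmem _).2 ⟨(b⁻¹ : kˣ) * a, mul_ne_zero (b⁻¹).ne_zero ha, by rw [mul_pow, haz]⟩
      · intro z _; rw [← mul_assoc, ← mul_pow, Units.inv_mul, one_pow, one_mul]
      · intro z _; rw [← mul_assoc, ← mul_pow, Units.mul_inv, one_pow, one_mul]
      · intro z hz
        obtain ⟨a, ha, rfl⟩ := (hZmem z).1 hz
        rw [← mul_pow, ← hΦ a ha, ← hΦ _ (mul_ne_zero b.ne_zero ha), map_mul]
    have h2 : (χ b - 1) * ∑ z ∈ Z, Φ z = 0 := by rw [sub_mul, h1, one_mul, sub_self]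
    rcases mul_eq_zero.1 h2 with h3 | h3
    · exact absurd (sub_eq_zero.1 h3) hb
    · exact h3
  let I : Finset (k × k) := Z ×ˢ {0, 1}
  let fib : k × k → Finset k := fun i => Finset.univ.filter
    (fun a => F.eval a ≠ 0 ∧ F.eval a ^ q = i.1 ∧ (Tp m c).eval a = i.2)
  let good : Finset k := Finset.univ.filter (fun a => F.eval a ≠ 0)
  let cls : k → k × k := fun a => (F.eval a ^ q, (Tp m c).eval a)
  have hmaps : ∀ a ∈ good, cls a ∈ I := by
    intro a ha
    have ha' : F.eval a ≠ 0 := by simpa [good] using ha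
    simp only [I, cls, Finset.mem_product, Finset.mem_insert, Finset.mem_singleton]
    exact ⟨(hZmem _).2 ⟨_, ha', rfl⟩, Tp_eval_cases m hk c a⟩
  have hfib : ∀ i, good.filter (fun a => cls a = i) = fib i := by
    intro i
    ext a
    simp [good, fib, cls, Prod.ext_iff]
  have hsumeq : ∑ x, χ (F.eval x) * ψ x = ∑ i ∈ I, (Φ i.1 * Ψ i.2) * (((fib i).card : ℝ) : ℂ) := by
    have h1 : ∑ x, χ (F.eval x) * ψ x = ∑ x ∈ good, χ (F.eval x) * ψ x := by
      symm
      apply Finset.sum_subset (Finset.subset_univ _)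
      intro x _ hx
      have : F.eval x = 0 := by simpa [good] using hx
      rw [this, MulChar.map_zero, zero_mul]
    rw [h1, ← Finset.sum_fiberwise_of_maps_to hmaps]
    apply Finset.sum_congr rfl
    intro i _
    rw [hfib]
    have h2 : ∀ x ∈ fib i, χ (F.eval x) * ψ x = Φ i.1 * Ψ i.2 := by
      intro x hx
      simp only [fib, Finset.mem_filter, Finset.mem_univ, true_and] at hx
      rw [hΦ _ hx.1, hΨ, hx.2.1, hx.2.2]
    rw [Finset.sum_congr rfl h2, Finset.sum_const, nsmul_eq_mul, mul_comm]
    simp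
  have hcardsum : ∑ i ∈ I, ((fib i).card : ℝ) = good.card := by
    have := Finset.card_eq_sum_card_fiberwise hmaps
    rw [this]
    push_cast
    apply Finset.sum_congr rfl
    intro i _
    rw [hfib]
  have hgood : (n0 : ℝ) ^ 2 - s ≤ good.card := by
    have h1 : (Finset.univ.filter (fun a => ¬ F.eval a ≠ 0)).card ≤ s := by
      rw [← hs]
      have h2 : (Finset.univ.filter (fun a => ¬ F.eval a ≠ 0)) ⊆ F.roots.toFinset := by
        intro a ha
        simp only [ne_eq, not_not, Finset.mem_filter, Finset.mem_univ, true_and] at ha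
        rw [Multiset.mem_toFinset, mem_roots hF.ne_zero]
        exact ha
      exact (Finset.card_le_card h2).trans ((Multiset.toFinset_card_le _).trans (card_roots' _))
    have h3 := Finset.card_filter_add_card_filter_not (s := (Finset.univ : Finset k))
      (fun a => F.eval a ≠ 0)
    rw [Finset.card_univ, hk, hn0] at h3
    have h4 : n0 ^ 2 ≤ good.card + s := by simp only [good]; omega
    have : ((n0 ^ 2 : ℕ) : ℝ) ≤ ((good.card + s : ℕ) : ℝ) := by exact_mod_cast h4
    push_cast at this
    linarith
  rw [hsumeq]
  have hdR : (0 : ℝ) < d := by exact_mod_cast hd0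
  have := avg_bound I (fun i => ((fib i).card : ℝ)) (fun i => Φ i.1 * Ψ i.2) ((n0 : ℝ) ^ 2 / (2 * d))
    (B * n0) (2 * d) (by positivity) (by positivity) ?_ ?_ ?_ ?_ s ?_ (by positivity)
  · refine this.trans ?_
    have h1 : (1 : ℝ) ≤ n0 := by exact_mod_cast hn1
    have h2 : (s : ℝ) ≤ s * n0 := le_mul_of_one_le_right (by positivity) h1
    have h3 : 2 * (d : ℝ) * (2 * d * (B * n0) + s) ≤ 2 * d * (2 * d * (B * n0) + s * n0) := by
      apply mul_le_mul_of_nonneg_left _ (by positivity)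
      linarith
    linarith
  · simp only [I, Finset.card_product]
    have : Z.card * ({0, 1} : Finset k).card ≤ d * 2 :=
      Nat.mul_le_mul hZcard (Finset.card_le_two)
    have h2 : ((Z.card * ({0, 1} : Finset k).card : ℕ) : ℝ) ≤ ((d * 2 : ℕ) : ℝ) := by
      exact_mod_cast this
    push_cast at h2 ⊢
    linarith
  · intro i _
    have h1 := fibre_upper F hF m hk n0 hn0 c hc d hodd ⟨q, hq⟩ hFp i.1 i.2 (fib i) (by
      intro a ha
      rw [hqd]
      simpa [fib] using ha)
    rw [hs, ← hB] at h1
    have h2 : (((fib i).card * (2 * d) : ℕ) : ℝ) ≤ ((n0 ^ 2 + 2 * d * B * n0 : ℕ) : ℝ) := by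
      exact_mod_cast h1
    push_cast at h2
    have h3 : (n0 : ℝ) ^ 2 / (2 * d) + B * n0 = (n0 ^ 2 + 2 * d * B * n0) / (2 * d) := by
      field_simp
    rw [h3, le_div_iff₀ (by positivity)]
    exact h2
  · intro i hi
    simp only [I, Finset.mem_product] at hi
    rw [norm_mul]
    calc _ ≤ 1 * ‖Ψ i.2‖ := mul_le_mul_of_nonneg_right (hΦ1 _ hi.1) (norm_nonneg _)
      _ ≤ 1 := by rw [one_mul]; exact hΨ1 _
  · simp only [I, Finset.sum_product, ← Finset.mul_sum]
    rw [← Finset.sum_mul, Finset.sum_pair zero_ne_one]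
    rcases hne with h | h
    · rw [hΦ0 h, zero_mul]
    · rw [hΨ0 h, mul_zero]
  · rw [hcardsum]
    have : 2 * (d : ℝ) * ((n0 : ℝ) ^ 2 / (2 * d)) = (n0 : ℝ) ^ 2 := by field_simp
    rw [this]
    exact hgood

end Stp

namespace Stp
open Polynomial

variable {L : Type} [Field L] [Fintype L]

theorem mon_finite (L : Type) [Field L] [Fintype L] (k : ℕ) :
    {p : L[X] | p.Monic ∧ p.natDegree = k}.Finite := by
  have e := (monicEquivDegreeLT (R := L) k).trans (degreeLTEquiv L k).toEquiv
  exact Set.finite_coe_iff.1 (Finite.of_equiv _ e.symm)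

noncomputable def mon (L : Type) [Field L] [Fintype L] (k : ℕ) : Finset L[X] := (mon_finite L k).toFinset

theorem mem_mon {k : ℕ} {p : L[X]} : p ∈ mon L k ↔ p.Monic ∧ p.natDegree = k := by
  simp [mon]

open Classical in
noncomputable def irr (L : Type) [Field L] [Fintype L] (k : ℕ) : Finset L[X] :=
  ((Finset.range (k+1)).biUnion (mon L)).filter Irreducible

theorem mem_irr {k : ℕ} {p : L[X]} : p ∈ irr L k ↔ p.Monic ∧ Irreducible p ∧ p.natDegree ≤ k := by
  simp [irr, mem_mon]
  constructor
  · rintro ⟨⟨h1, h2⟩, h3⟩; exact ⟨h2, h3, by omega⟩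
  · rintro ⟨h1, h2, h3⟩; exact ⟨⟨by omega, h1⟩, h2⟩

open Classical in
theorem natDegree_eq_sum (h : L[X]) (hm : h.Monic) :
    h.natDegree = ∑ P ∈ irr L h.natDegree, ∑ j ∈ Finset.Icc 1 h.natDegree,
      if P ^ j ∣ h then P.natDegree else 0 := by
  have h0 : h ≠ 0 := hm.ne_zero
  have hmon : ∀ P ∈ UniqueFactorizationMonoid.normalizedFactors h, P.Monic := by
    intro P hP
    have h1 := UniqueFactorizationMonoid.normalize_normalized_factor P hP
    rw [← h1]
    exact monic_normalize (UniqueFactorizationMonoid.irreducible_of_normalized_factor P hP).ne_zero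
  have h1 : (UniqueFactorizationMonoid.normalizedFactors h).prod = h := by
    rw [UniqueFactorizationMonoid.prod_normalizedFactors_eq h0, hm.normalize_eq_self]
  have h2 : h.natDegree = ((UniqueFactorizationMonoid.normalizedFactors h).map natDegree).sum := by
    conv_lhs => rw [← h1]
    exact natDegree_multiset_prod_of_monic _ hmon
  have hcount : ∀ P ∈ irr L h.natDegree, (∑ j ∈ Finset.Icc 1 h.natDegree,
      if P ^ j ∣ h then P.natDegree else 0) =
      (UniqueFactorizationMonoid.normalizedFactors h).count P * P.natDegree := by
    intro P hP
    obtain ⟨hPm, hPi, hPd⟩ := mem_irr.1 hP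
    have hdvd : ∀ j, P ^ j ∣ h ↔ j ≤ (UniqueFactorizationMonoid.normalizedFactors h).count P := by
      intro j
      rw [UniqueFactorizationMonoid.dvd_iff_normalizedFactors_le_normalizedFactors
        (pow_ne_zero _ hPm.ne_zero) h0, UniqueFactorizationMonoid.normalizedFactors_pow,
        UniqueFactorizationMonoid.normalizedFactors_irreducible hPi, hPm.normalize_eq_self,
        Multiset.le_count_iff_replicate_le, Multiset.nsmul_singleton]
    have hle : (UniqueFactorizationMonoid.normalizedFactors h).count P ≤ h.natDegree := by
      have := (hdvd _).2 le_rfl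
      have := natDegree_le_of_dvd this h0
      rw [natDegree_pow] at this
      have := hPi.natDegree_pos
      nlinarith
    rw [← Finset.sum_filter, Finset.sum_const, smul_eq_mul]
    congr 1
    have : (Finset.Icc 1 h.natDegree).filter (fun j => P ^ j ∣ h) =
      Finset.Icc 1 ((UniqueFactorizationMonoid.normalizedFactors h).count P) := by
      ext j
      simp only [Finset.mem_filter, Finset.mem_Icc, hdvd]
      omega
    rw [this]; simp
  rw [Finset.sum_congr rfl hcount]
  conv_lhs => rw [h2]
  rw [Finset.sum_multiset_map_count]
  simp only [smul_eq_mul]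
  apply Finset.sum_subset
  · intro P hP
    rw [Multiset.mem_toFinset] at hP
    rw [mem_irr]
    exact ⟨hmon P hP, UniqueFactorizationMonoid.irreducible_of_normalized_factor P hP,
      natDegree_le_of_dvd (UniqueFactorizationMonoid.dvd_of_mem_normalizedFactors hP) h0⟩
  · intro P _ hP
    rw [Multiset.mem_toFinset] at hP
    rw [Multiset.count_eq_zero_of_notMem hP, zero_mul]

noncomputable def Lco (lam : L[X] → ℂ) (k : ℕ) : ℂ := ∑ h ∈ mon L k, lam h

noncomputable def Sr (lam : L[X] → ℂ) (r : ℕ) : ℂ :=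
  ∑ P ∈ (irr L r).filter (fun P => P.natDegree ∣ r), (P.natDegree : ℂ) * lam P ^ (r / P.natDegree)

theorem Lco_zero (lam : L[X] → ℂ) (h1 : lam 1 = 1) : Lco lam 0 = 1 := by
  have : mon L 0 = {1} := by
    ext p
    rw [mem_mon, Finset.mem_singleton]
    constructor
    · rintro ⟨h, h'⟩; exact h.natDegree_eq_zero.1 h'
    · rintro rfl; exact ⟨monic_one, natDegree_one⟩
  rw [Lco, this, Finset.sum_singleton, h1]

open Classical in
theorem sum_dvd (lam : L[X] → ℂ) (h1 : lam 1 = 1)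
    (hmul : ∀ a b : L[X], a.Monic → b.Monic → lam (a * b) = lam a * lam b)
    (k j : ℕ) (P : L[X]) (hP : P.Monic) :
    ∑ h ∈ mon L k, (if P ^ j ∣ h then lam h else 0) =
      if j * P.natDegree ≤ k then lam P ^ j * Lco lam (k - j * P.natDegree) else 0 := by
  have hpow : ∀ j, lam (P ^ j) = lam P ^ j := by
    intro j
    induction j with
    | zero => simp [h1]
    | succ j ih => rw [pow_succ, hmul _ _ (hP.pow j) hP, ih, pow_succ]
  rw [← Finset.sum_filter]
  split_ifs with hle
  · rw [Lco, Finset.mul_sum]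
    symm
    apply Finset.sum_bij (fun h _ => P ^ j * h)
    · intro h hh
      rw [mem_mon] at hh
      rw [Finset.mem_filter, mem_mon]
      refine ⟨⟨(hP.pow j).mul hh.1, ?_⟩, dvd_mul_right _ _⟩
      rw [(hP.pow j).natDegree_mul hh.1, hP.natDegree_pow, hh.2]
      omega
    · intro a _ b _ hab
      exact mul_left_cancel₀ (hP.pow j).ne_zero hab
    · intro b hb
      rw [Finset.mem_filter, mem_mon] at hb
      obtain ⟨⟨hb1, hb2⟩, c, rfl⟩ := hb
      have hc : c.Monic := (hP.pow j).of_mul_monic_left hb1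
      refine ⟨c, ?_, rfl⟩
      rw [mem_mon]
      refine ⟨hc, ?_⟩
      rw [(hP.pow j).natDegree_mul hc, hP.natDegree_pow] at hb2
      omega
    · intro h hh
      rw [mem_mon] at hh
      rw [hmul _ _ (hP.pow j) hh.1, hpow]
  · rw [Finset.filter_false_of_mem, Finset.sum_empty]
    intro h hh hd
    rw [mem_mon] at hh
    have := natDegree_le_of_dvd hd hh.1.ne_zero
    rw [hP.natDegree_pow] at this
    omega

theorem reindex (d k : ℕ) (hd : 0 < d) (g : ℕ → ℂ) :
    ∑ j ∈ Finset.Icc 1 k, (if j * d ≤ k then g j else 0) =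
    ∑ r ∈ Finset.Icc 1 k, (if d ∣ r then g (r / d) else 0) := by
  rw [← Finset.sum_filter, ← Finset.sum_filter]
  apply Finset.sum_bij (fun j _ => j * d)
  · intro j hj
    simp only [Finset.mem_filter, Finset.mem_Icc] at hj ⊢
    refine ⟨⟨?_, hj.2⟩, dvd_mul_left _ _⟩
    have := Nat.mul_pos (show 0 < j by omega) hd
    omega
  · intro a _ b _ hab
    exact Nat.eq_of_mul_eq_mul_right hd hab
  · intro r hr
    simp only [Finset.mem_filter, Finset.mem_Icc] at hr
    obtain ⟨⟨h1, h2⟩, c, rfl⟩ := hr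
    refine ⟨c, ?_, mul_comm _ _⟩
    simp only [Finset.mem_filter, Finset.mem_Icc]
    have : 0 < c := Nat.pos_of_ne_zero (by rintro rfl; simp at h1)
    refine ⟨⟨this, by nlinarith⟩, by linarith [mul_comm c d]⟩
  · intro j _
    rw [Nat.mul_div_cancel _ hd]

theorem Lrec (lam : L[X] → ℂ) (h1 : lam 1 = 1)
    (hmul : ∀ a b : L[X], a.Monic → b.Monic → lam (a * b) = lam a * lam b) (k : ℕ) :
    (k : ℂ) * Lco lam k = ∑ r ∈ Finset.Icc 1 k, Sr lam r * Lco lam (k - r) := by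
  classical
  have e1 : (k : ℂ) * Lco lam k = ∑ P ∈ irr L k, ∑ j ∈ Finset.Icc 1 k,
      (if j * P.natDegree ≤ k then (P.natDegree : ℂ) * lam P ^ j * Lco lam (k - j * P.natDegree) else 0) := by
    calc (k : ℂ) * Lco lam k = ∑ h ∈ mon L k, ∑ P ∈ irr L k, ∑ j ∈ Finset.Icc 1 k,
            (P.natDegree : ℂ) * (if P ^ j ∣ h then lam h else 0) := by
          rw [Lco, Finset.mul_sum]
          apply Finset.sum_congr rfl
          intro h hh
          rw [mem_mon] at hh
          have := natDegree_eq_sum h hh.1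
          rw [hh.2] at this
          conv_lhs => rw [this]
          push_cast
          rw [Finset.sum_mul]
          apply Finset.sum_congr rfl
          intro P _
          rw [Finset.sum_mul]
          apply Finset.sum_congr rfl
          intro j _
          split_ifs <;> simp
      _ = ∑ P ∈ irr L k, ∑ j ∈ Finset.Icc 1 k, ∑ h ∈ mon L k,
            (P.natDegree : ℂ) * (if P ^ j ∣ h then lam h else 0) := by
          rw [Finset.sum_comm]
          apply Finset.sum_congr rfl
          intro P _
          rw [Finset.sum_comm]
      _ = _ := by
          apply Finset.sum_congr rfl
          intro P hP
          apply Finset.sum_congr rfl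
          intro j _
          rw [← Finset.mul_sum, sum_dvd lam h1 hmul k j P (mem_irr.1 hP).1]
          split_ifs
          · ring
          · simp
  rw [e1]
  have e2 : ∀ P ∈ irr L k, (∑ j ∈ Finset.Icc 1 k,
      (if j * P.natDegree ≤ k then (P.natDegree : ℂ) * lam P ^ j * Lco lam (k - j * P.natDegree) else 0)) =
      ∑ r ∈ Finset.Icc 1 k, (if P.natDegree ∣ r then (P.natDegree : ℂ) * lam P ^ (r / P.natDegree) * Lco lam (k - r) else 0) := by
    intro P hP
    rw [reindex P.natDegree k (mem_irr.1 hP).2.1.natDegree_pos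
      (fun j => (P.natDegree : ℂ) * lam P ^ j * Lco lam (k - j * P.natDegree))]
    apply Finset.sum_congr rfl
    intro r _
    split_ifs with h
    · rw [Nat.div_mul_cancel h]
    · rfl
  rw [Finset.sum_congr rfl e2, Finset.sum_comm]
  apply Finset.sum_congr rfl
  intro r hr
  rw [Finset.mem_Icc] at hr
  rw [Sr, Finset.sum_mul, ← Finset.sum_filter]
  apply Finset.sum_congr
  · ext P
    simp only [Finset.mem_filter, mem_irr]
    constructor
    · rintro ⟨⟨a, b, c⟩, d⟩
      exact ⟨⟨a, b, Nat.le_of_dvd (by omega) d⟩, d⟩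
    · rintro ⟨⟨a, b, c⟩, d⟩
      exact ⟨⟨a, b, by omega⟩, d⟩
  · intro P _; rfl

theorem Lrec' (lam : L[X] → ℂ) (h1 : lam 1 = 1)
    (hmul : ∀ a b : L[X], a.Monic → b.Monic → lam (a * b) = lam a * lam b) (k : ℕ) :
    ((k : ℂ) + 1) * Lco lam (k+1) = ∑ j ∈ Finset.range (k+1), Lco lam j * Sr lam (k - j + 1) := by
  have := Lrec lam h1 hmul (k+1)
  push_cast at this
  rw [this]
  apply Finset.sum_bij' (fun r _ => k + 1 - r) (fun j _ => k + 1 - j)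
  · intro r hr; simp at hr ⊢; omega
  · intro r hr; simp at hr ⊢; omega
  · intro r hr; simp at hr; omega
  · intro r hr; simp at hr; omega
  · intro r hr
    simp at hr
    rw [mul_comm]
    congr 2
    omega

end Stp

namespace Stp
open Polynomial

theorem ana_id (S Lc : ℕ → ℂ) (s : ℕ) (ρ C0 : ℝ) (hρ : 0 < ρ)
    (hrec : ∀ k : ℕ, ((k : ℂ) + 1) * Lc (k+1) = ∑ j ∈ Finset.range (k+1), Lc j * S (k - j + 1))
    (hz : ∀ k, s < k → Lc k = 0) (hS : ∀ r, 1 ≤ r → ‖S r‖ ≤ C0 * ρ ^ r)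
    (p : ℂ[X]) (hp : ∀ k, p.coeff k = Lc k) (T : ℂ) (t : ℝ) (hT : ‖T‖ ≤ t) (ht : ρ * t < 1) :
    ∃ g : ℂ, p.derivative.eval T = p.eval T * g ∧ ‖g‖ ≤ C0 * ρ * (1 - ρ * t)⁻¹ := by
  have h0 : 0 ≤ ρ * t := mul_nonneg hρ.le ((norm_nonneg T).trans hT)
  have hb : ∀ r, ‖S (r+1) * T ^ r‖ ≤ C0 * ρ * (ρ * t) ^ r := by
    intro r
    rw [norm_mul, norm_pow]
    calc ‖S (r+1)‖ * ‖T‖ ^ r ≤ (C0 * ρ ^ (r+1)) * t ^ r := by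
          gcongr
          · exact (norm_nonneg _).trans (hS (r+1) (by omega))
          · exact hS (r+1) (by omega)
      _ = _ := by rw [mul_pow]; ring
  have hgs := (hasSum_geometric_of_lt_one h0 ht).mul_left (C0 * ρ)
  have hg : Summable fun r => ‖S (r+1) * T ^ r‖ :=
    Summable.of_nonneg_of_le (fun _ => norm_nonneg _) hb hgs.summable
  have hsupp : ∀ (c : ℕ → ℂ) (m : ℕ), (∀ k, m ≤ k → c k = 0) → Summable fun k => ‖c k‖ := by
    intro c m hc
    apply summable_of_ne_finset_zero (s := Finset.range m)
    intro b hb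
    simp only [Finset.mem_range, not_lt] at hb
    simp [hc b hb]
  have hf : Summable fun k => ‖Lc k * T ^ k‖ := by
    apply hsupp _ (s+1)
    intro k hk
    rw [hz k (by omega), zero_mul]
  have hdeg : p.natDegree < s + 1 := by
    rw [Nat.lt_succ_iff, natDegree_le_iff_coeff_eq_zero]
    intro k hk; rw [hp, hz k hk]
  have e1 : ∑' k, Lc k * T ^ k = p.eval T := by
    rw [eval_eq_sum_range' hdeg, tsum_eq_sum (s := Finset.range (s+1))]
    · simp [hp]
    · intro b hb
      simp only [Finset.mem_range, not_lt] at hb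
      rw [hz b (by omega), zero_mul]
  have hdeg2 : p.derivative.natDegree < s + 1 :=
    lt_of_le_of_lt (natDegree_derivative_le p) (by omega)
  have e2 : ∑' k : ℕ, ((k:ℂ)+1) * Lc (k+1) * T ^ k = p.derivative.eval T := by
    rw [eval_eq_sum_range' hdeg2, tsum_eq_sum (s := Finset.range (s+1))]
    · apply Finset.sum_congr rfl
      intro k _
      rw [coeff_derivative, hp]; ring
    · intro b hb
      simp only [Finset.mem_range, not_lt] at hb
      rw [hz (b+1) (by omega)]; ring
  refine ⟨∑' r, S (r+1) * T ^ r, ?_, ?_⟩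
  · rw [← e1, tsum_mul_tsum_eq_tsum_sum_range_of_summable_norm hf hg, ← e2]
    apply tsum_congr
    intro k
    rw [hrec, Finset.sum_mul]
    apply Finset.sum_congr rfl
    intro j hj
    have hj' : j ≤ k := by simpa [Nat.lt_succ_iff] using hj
    have : T ^ k = T ^ j * T ^ (k - j) := by rw [← pow_add]; congr 1; omega
    rw [this]; ring
  · exact tsum_of_norm_bounded hgs hb

theorem ana (S Lc : ℕ → ℂ) (s : ℕ) (ρ C0 : ℝ) (hρ : 0 < ρ) (h0 : Lc 0 = 1)
    (hrec : ∀ k : ℕ, ((k : ℂ) + 1) * Lc (k+1) = ∑ j ∈ Finset.range (k+1), Lc j * S (k - j + 1))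
    (hz : ∀ k, s < k → Lc k = 0) (hS : ∀ r, 1 ≤ r → ‖S r‖ ≤ C0 * ρ ^ r) :
    ‖Lc 1‖ ≤ s * ρ := by
  obtain ⟨p, hp⟩ : ∃ p : ℂ[X], ∀ k, p.coeff k = Lc k := by
    refine ⟨∑ k ∈ Finset.range (s+1), C (Lc k) * X ^ k, ?_⟩
    intro k
    simp only [finsetSum_coeff, coeff_C_mul, coeff_X_pow, mul_ite, mul_one, mul_zero]
    rw [Finset.sum_ite_eq]
    split_ifs with h
    · rfl
    · simp only [Finset.mem_range, not_lt] at h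
      rw [hz k (by omega)]
  have hp0 : p.eval 0 = 1 := by rw [← coeff_zero_eq_eval_zero, hp, h0]
  have hne : p ≠ 0 := by rintro rfl; simp at hp0
  have hp1 : p.derivative.eval 0 = Lc 1 := by
    rw [← coeff_zero_eq_eval_zero, coeff_derivative, hp]; simp
  have hroots : ∀ z ∈ p.roots, 1 ≤ ρ * ‖z‖ := by
    intro z hz'
    by_contra hlt
    push Not at hlt
    have hroot : p.IsRoot z := (mem_roots'.1 hz').2
    obtain ⟨t, ht1, ht2⟩ : ∃ t, ‖z‖ < t ∧ ρ * t < 1 := by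
      obtain ⟨t, h1, h2⟩ := exists_between (show ‖z‖ < 1 / ρ by
        rw [lt_div_iff₀ hρ]; linarith)
      refine ⟨t, h1, ?_⟩
      rw [lt_div_iff₀ hρ] at h2; linarith
    have hmu : 0 < p.rootMultiplicity z := (rootMultiplicity_pos hne).2 hroot
    have hder := derivative_rootMultiplicity_of_root hroot
    obtain ⟨m, hm⟩ : ∃ m, p.rootMultiplicity z = m + 1 := ⟨_, (Nat.succ_pred_eq_of_pos hmu).symm⟩
    have hd0 : p.derivative ≠ 0 := by
      intro hd
      have := natDegree_eq_zero_of_derivative_eq_zero hd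
      rw [natDegree_eq_zero] at this
      obtain ⟨c, rfl⟩ := this
      simp at hroot hp0
      rw [hroot] at hp0; simp at hp0
    obtain ⟨u, hu⟩ := pow_rootMultiplicity_dvd p z
    obtain ⟨v, hv, hv2⟩ := exists_eq_pow_rootMultiplicity_mul_and_not_dvd p.derivative hd0 z
    rw [hder, hm] at hv
    rw [hm] at hu
    simp only [Nat.add_sub_cancel] at hv
    rw [dvd_iff_isRoot] at hv2
    apply hv2
    set M : ℝ := C0 * ρ * (1 - ρ * t)⁻¹
    -- ‖v T‖ ≤ ‖T - z‖ ‖u T‖ M near z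
    have key : ∀ᶠ T in nhdsWithin z {z}ᶜ, ‖v.eval T‖ ≤ ‖T - z‖ * ‖u.eval T‖ * M := by
      have hball : ∀ᶠ T in nhdsWithin z {z}ᶜ, ‖T‖ < t :=
        nhdsWithin_le_nhds (continuous_norm.continuousAt.eventually_lt continuousAt_const ht1)
      filter_upwards [hball, self_mem_nhdsWithin] with T hT hTz
      obtain ⟨g, hg1, hg2⟩ := ana_id S Lc s ρ C0 hρ hrec hz hS p hp T t hT.le ht2
      have hTz' : T - z ≠ 0 := sub_ne_zero.2 hTz
      rw [hv, hu] at hg1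
      simp only [eval_mul, eval_pow, eval_sub, eval_X, eval_C] at hg1
      have : v.eval T = (T - z) * u.eval T * g := by
        apply mul_left_cancel₀ (pow_ne_zero m hTz')
        rw [hg1]; ring
      rw [this, norm_mul, norm_mul]
      gcongr
    have l1 : Filter.Tendsto (fun T => ‖v.eval T‖) (nhdsWithin z {z}ᶜ) (nhds ‖v.eval z‖) :=
      (v.continuous.norm.tendsto z).mono_left nhdsWithin_le_nhds
    have l2 : Filter.Tendsto (fun T => ‖T - z‖ * ‖u.eval T‖ * M) (nhdsWithin z {z}ᶜ) (nhds 0) := by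
      have hc : Continuous fun T : ℂ => ‖T - z‖ * ‖u.eval T‖ * M :=
        (((continuous_id.sub continuous_const).norm).mul u.continuous.norm).mul continuous_const
      have := (hc.tendsto z).mono_left (nhdsWithin_le_nhds (s := {z}ᶜ))
      simpa using this
    have := le_of_tendsto_of_tendsto l1 l2 key
    exact norm_le_zero_iff.1 this
  have hsp := (IsAlgClosed.splits p).eval_derivative_eq_eval_mul_sum (x := 0) (by rw [hp0]; exact one_ne_zero)
  rw [hp1, hp0, one_mul] at hsp
  rw [hsp]
  have hcard : (Multiset.card p.roots : ℝ) ≤ s := by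
    have h1 := p.card_roots'
    have : p.natDegree ≤ s := by
      rw [natDegree_le_iff_coeff_eq_zero]
      intro k hk; rw [hp, hz k hk]
    exact_mod_cast h1.trans this
  refine (norm_multiset_sum_le _).trans ?_
  rw [Multiset.map_map]
  have := Multiset.sum_le_card_nsmul (p.roots.map (norm ∘ fun z => 1 / (0 - z))) ρ (by
    intro x hx
    obtain ⟨z, hz1, rfl⟩ := Multiset.mem_map.1 hx
    have hh := hroots z hz1
    have : 0 < ‖z‖ := by
      rcases (norm_nonneg z).eq_or_lt with h | h
      · rw [← h] at hh; norm_num at hh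
      · exact h
    simp only [Function.comp, norm_div, norm_one, zero_sub, norm_neg]
    rw [div_le_iff₀ this]; exact hh)
  refine this.trans ?_
  rw [Multiset.card_map, nsmul_eq_mul]
  gcongr
end Stp

namespace Stp
open Polynomial

noncomputable def Rs {L : Type} [Field L] (F h : L[X]) : L := resultant F h

section
variable {L : Type} [Field L] (Ω : Type) [Field Ω] [IsAlgClosed Ω] [Algebra L Ω]

theorem Rs_left (F : L[X]) (hF : F.Monic) (h : L[X]) :
    algebraMap L Ω (Rs F h) = ((F.aroots Ω).map (fun β => aeval β h)).prod := by
  rw [Rs, ← resultant_map_map]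
  have := resultant_eq_prod_eval (F.map (algebraMap L Ω)) (h.map (algebraMap L Ω)) h.natDegree
    natDegree_map_le (IsAlgClosed.splits _)
  rw [natDegree_map] at this
  rw [this, (hF.map _).leadingCoeff, one_pow, one_mul]
  congr 2
  ext β
  rw [aeval_def, eval_map]

theorem Rs_right [CharP L 2] (F P : L[X]) (hP : P.Monic) :
    algebraMap L Ω (Rs F P) = ((P.aroots Ω).map (fun β => aeval β F)).prod := by
  rw [← Rs_left Ω P hP, Rs, Rs, resultant_comm]
  congr 1
  have : (-1 : L) = 1 := CharTwo.neg_eq 1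
  rw [this, one_pow, one_mul]
end

variable {L : Type} [Field L]

theorem Rs_mul (F : L[X]) (hF : F.Monic) (a b : L[X]) : Rs F (a * b) = Rs F a * Rs F b := by
  apply (algebraMap L (AlgebraicClosure L)).injective
  rw [map_mul, Rs_left _ F hF, Rs_left _ F hF, Rs_left _ F hF, ← Multiset.prod_map_mul]
  congr 2
  ext β
  rw [map_mul]

theorem Rs_one (F : L[X]) (hF : F.Monic) : Rs F 1 = 1 := by
  apply (algebraMap L (AlgebraicClosure L)).injective
  rw [Rs_left _ F hF]; simp

theorem Rs_congr (F : L[X]) (hF : F.Monic) (G : L[X]) (hG : ∀ β : AlgebraicClosure L, aeval β F = 0 → aeval β G = 0) (a b : L[X])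
    (h : G ∣ a - b) : Rs F a = Rs F b := by
  apply (algebraMap L (AlgebraicClosure L)).injective
  rw [Rs_left _ F hF, Rs_left _ F hF]
  congr 1
  apply Multiset.map_congr rfl
  intro β hβ
  obtain ⟨e, he⟩ := h
  have h3 : aeval β G = 0 := hG β (mem_aroots.1 hβ).2
  rw [← sub_eq_zero, ← map_sub, he, map_mul, h3, zero_mul]

theorem Rs_X_sub_C [CharP L 2] (F : L[X]) (x : L) : Rs F (X - C x) = F.eval x := by
  apply (algebraMap L (AlgebraicClosure L)).injective
  rw [Rs_right _ F _ (monic_X_sub_C x), aroots_X_sub_C]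
  simp [aeval_algebraMap_apply]

theorem embed_prod {E Ω : Type} [Field E] [Algebra L E] [FiniteDimensional L E]
    [Algebra.IsSeparable L E] [Field Ω] [IsAlgClosed Ω] [Algebra L Ω] (x : E) (f : Ω → Ω) :
    ∏ σ : E →ₐ[L] Ω, f (σ x) =
      (((minpoly L x).aroots Ω).map f).prod ^ (Module.finrank L E / (minpoly L x).natDegree) := by
  classical
  let K := IntermediateField.adjoin L {x}
  have hx : IsIntegral L x := IsIntegral.of_finite L x
  let pb : PowerBasis L K := IntermediateField.adjoin.powerBasis hx
  have hgen : algebraMap K E pb.gen = x := by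
    simp [pb, K, IntermediateField.adjoin.powerBasis_gen]
  have hmin : minpoly L pb.gen = minpoly L x := by
    rw [← hgen]; exact (minpoly.algebraMap_eq (algebraMap K E).injective _).symm
  have : Algebra.IsSeparable K E := Algebra.isSeparable_tower_top_of_isSeparable L K E
  let : Fintype (K →ₐ[L] Ω) := PowerBasis.AlgHom.fintype pb
  have e1 : ∏ σ : E →ₐ[L] Ω, f (σ x) = (∏ τ : K →ₐ[L] Ω, f (τ pb.gen)) ^ Module.finrank K E := by
    rw [Fintype.prod_equiv algHomEquivSigma (fun σ : E →ₐ[L] Ω => _) fun σ => f (σ.1 pb.gen),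
      ← Finset.univ_sigma_univ, Finset.prod_sigma, ← Finset.prod_pow]
    · refine Finset.prod_congr rfl fun σ _ => ?_
      let : Algebra K Ω := σ.toRingHom.toAlgebra
      simp_rw [Finset.prod_const]
      congr
      exact AlgHom.card K E Ω
    · intro σ
      simp only [algHomEquivSigma, Equiv.coe_fn_mk, AlgHom.domRestrict, AlgHom.comp_apply,
        IsScalarTower.coe_toAlgHom']
      rw [hgen]
  have e2 : ∏ τ : K →ₐ[L] Ω, f (τ pb.gen) = (((minpoly L x).aroots Ω).map f).prod := by
    rw [@Fintype.prod_equiv (K →ₐ[L] Ω) _ _ (PowerBasis.AlgHom.fintype pb) _ _ pb.liftEquiv'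
      (fun σ => f (σ pb.gen)) (fun x => f x) ?_]
    · rw [Finset.prod_mem_multiset _ _ f (by intro x; rfl), hmin, Finset.prod_eq_multiset_prod, Multiset.toFinset_val,
        Multiset.dedup_eq_self.mpr]
      exact nodup_roots (.map (Algebra.IsSeparable.isSeparable L x))
    · intro σ; simp only [PowerBasis.liftEquiv'_apply_coe]
  rw [e1, e2]
  congr 1
  have h1 := Module.finrank_mul_finrank L K E
  have h2 : Module.finrank L K = (minpoly L x).natDegree := by
    exact IntermediateField.adjoin.finrank hx
  rw [← h1, h2, Nat.mul_div_cancel_left _ (minpoly.natDegree_pos hx)]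

theorem norm_Rs {E : Type} [Field E] [Algebra L E] [FiniteDimensional L E]
    [Algebra.IsSeparable L E] [CharP L 2] (F : L[X]) (x : E) :
    Algebra.norm L (aeval x F) = Rs F (minpoly L x) ^ (Module.finrank L E / (minpoly L x).natDegree) := by
  apply (algebraMap L (AlgebraicClosure L)).injective
  rw [Algebra.norm_eq_prod_embeddings, map_pow, Rs_right _ F _ (minpoly.monic (IsIntegral.of_finite L x)),
    ← embed_prod x]
  apply Finset.prod_congr rfl
  intro σ _
  rw [aeval_algHom_apply]

theorem trace_next {E : Type} [Field E] [Algebra L E] [FiniteDimensional L E] [CharP L 2] (x : E) :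
    Algebra.trace L E x = (Module.finrank L E / (minpoly L x).natDegree : ℕ) • (minpoly L x).nextCoeff := by
  have hx : IsIntegral L x := IsIntegral.of_finite L x
  have h1 := Module.finrank_mul_finrank L (IntermediateField.adjoin L {x}) E
  have h2 : Module.finrank L (IntermediateField.adjoin L {x}) = (minpoly L x).natDegree := by
    exact IntermediateField.adjoin.finrank hx
  rw [trace_eq_finrank_mul_minpoly_nextCoeff, ← h1, h2, Nat.mul_div_cancel_left _ (minpoly.natDegree_pos hx),
    CharTwo.neg_eq, nsmul_eq_mul]

end Stp

namespace Stp
open Polynomial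

variable {L : Type} [Field L] [Fintype L] [CharP L 2]

noncomputable def lamF (F : L[X]) (χ : MulChar L ℂ) (ψ : AddChar L ℂ) (h : L[X]) : ℂ :=
  χ (Rs F h) * ψ h.nextCoeff

theorem lamF_one (F : L[X]) (hF : F.Monic) (χ : MulChar L ℂ) (ψ : AddChar L ℂ) : lamF F χ ψ 1 = 1 := by
  simp [lamF, Rs_one F hF, nextCoeff]

theorem lamF_mul (F : L[X]) (hF : F.Monic) (χ : MulChar L ℂ) (ψ : AddChar L ℂ) (a b : L[X])
    (ha : a.Monic) (hb : b.Monic) : lamF F χ ψ (a * b) = lamF F χ ψ a * lamF F χ ψ b := by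
  rw [lamF, lamF, lamF, Rs_mul F hF, ha.nextCoeff_mul hb, map_mul, AddChar.map_add_eq_mul]
  ring

theorem card_minpoly {E : Type} [Field E] [Algebra L E] [Fintype E] [DecidableEq L[X]] (P : L[X]) (hP : P.Monic)
    (hi : Irreducible P) (hd : P.natDegree ∣ Module.finrank L E) :
    (Finset.univ.filter (fun x : E => minpoly L x = P)).card = P.natDegree := by
  classical
  have hfd : FiniteDimensional L E := Module.Finite.of_finite
  have hdvd := (hi.natDegree_dvd_iff_dvd_X_pow_card_pow_sub_X).1 hd
  have hcard : Nat.card L ^ Module.finrank L E = Fintype.card E := by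
    rw [← Module.natCard_eq_pow_finrank, Nat.card_eq_fintype_card]
  rw [hcard] at hdvd
  have hdvd2 := map_dvd (algebraMap L E) hdvd
  have hne : (X ^ Fintype.card E - X : E[X]) ≠ 0 := FiniteField.X_pow_card_sub_X_ne_zero E Fintype.one_lt_card
  have hspl : (P.map (algebraMap L E)).Splits := by
    refine Splits.of_dvd ?_ ?_ (Polynomial.map_dvd (algebraMap L E) hdvd)
    · simp only [Polynomial.map_sub, Polynomial.map_pow, map_X]
      rw [splits_iff_card_roots, FiniteField.roots_X_pow_card_sub_X,
        FiniteField.X_pow_card_sub_X_natDegree_eq _ Fintype.one_lt_card]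
      rfl
    · simpa using hne
  have hsep : P.Separable := PerfectField.separable_of_irreducible hi
  rw [← Polynomial.card_rootSet_eq_natDegree hsep hspl, ← Set.toFinset_card]
  congr 1
  ext x
  simp only [Finset.mem_filter, Finset.mem_univ, true_and, Set.mem_toFinset]
  rw [mem_rootSet]
  constructor
  · rintro rfl
    exact ⟨hi.ne_zero, minpoly.aeval L x⟩
  · rintro ⟨_, h⟩
    exact (minpoly.eq_of_irreducible_of_monic hi h hP).symm

theorem Sr_eq {E : Type} [Field E] [Algebra L E] [Fintype E] (F : L[X]) (χ : MulChar L ℂ)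
    (ψ : AddChar L ℂ) :
    Sr (lamF F χ ψ) (Module.finrank L E) =
      ∑ x : E, χ (Algebra.norm L (aeval x F)) * ψ (Algebra.trace L E x) := by
  classical
  have hfd : FiniteDimensional L E := Module.Finite.of_finite
  have h1 : ∀ x : E, χ (Algebra.norm L (aeval x F)) * ψ (Algebra.trace L E x) =
     lamF F χ ψ (minpoly L x) ^ (Module.finrank L E / (minpoly L x).natDegree) := by
    intro x
    rw [norm_Rs, trace_next, lamF, map_pow, AddChar.map_nsmul_eq_pow, mul_pow]
  simp_rw [h1]
  rw [Sr, ← Finset.sum_fiberwise_of_maps_to (s := Finset.univ) (g := fun x : E => minpoly L x)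
    (t := (irr L (Module.finrank L E)).filter (fun P => P.natDegree ∣ Module.finrank L E))]
  · apply Finset.sum_congr rfl
    intro P hP
    rw [Finset.mem_filter, mem_irr] at hP
    rw [Finset.sum_congr rfl (g := fun _ => lamF F χ ψ P ^ (Module.finrank L E / P.natDegree)),
      Finset.sum_const, card_minpoly P hP.1.1 hP.1.2.1 hP.2, nsmul_eq_mul]
    intro x hx
    rw [(Finset.mem_filter.1 hx).2]
  · intro x _
    have hx : IsIntegral L x := IsIntegral.of_finite L x
    have hd : (minpoly L x).natDegree ∣ Module.finrank L E := minpoly.degree_dvd hx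
    rw [Finset.mem_filter, mem_irr]
    exact ⟨⟨minpoly.monic hx, minpoly.irreducible hx, Nat.le_of_dvd Module.finrank_pos hd⟩, hd⟩

/-- first coefficient -/
theorem Lco_one_eq (F : L[X]) (χ : MulChar L ℂ) (ψ : AddChar L ℂ) :
    Lco (lamF F χ ψ) 1 = ∑ x : L, χ (F.eval x) * ψ x := by
  rw [Lco]
  symm
  apply Finset.sum_bij (fun x _ => X - C x)
  · intro x _
    rw [mem_mon]
    exact ⟨monic_X_sub_C x, natDegree_X_sub_C x⟩
  · intro a _ b _ hab
    simpa using hab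
  · intro p hp
    rw [mem_mon] at hp
    refine ⟨- p.coeff 0, Finset.mem_univ _, ?_⟩
    have := hp.1.eq_X_add_C hp.2
    rw [this]; simp
  · intro x _
    rw [lamF, Rs_X_sub_C, nextCoeff_X_sub_C, CharTwo.neg_eq]

/-- vanishing, additive case -/
theorem van_add (F : L[X]) (hF : F.Monic) (χ : MulChar L ℂ) (ψ : AddChar L ℂ) (hψ : ψ ≠ 1)
    (G : L[X]) (hG : G.Monic) (hFG : ∀ β : AlgebraicClosure L, aeval β F = 0 → aeval β G = 0)
    (k : ℕ) (hk : G.natDegree < k) : Lco (lamF F χ ψ) k = 0 := by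
  obtain ⟨b, hb⟩ : ∃ b, ψ b ≠ 1 := by
    by_contra h
    push Not at h
    exact hψ (by ext x; simpa using h x)
  obtain ⟨D, hD⟩ : ∃ D : L[X], D = C b * X ^ (k - 1 - G.natDegree) * G := ⟨_, rfl⟩
  have hdeg : D.natDegree ≤ k - 1 := by
    rw [hD]
    refine natDegree_mul_le.trans ?_
    have := natDegree_C_mul_X_pow_le b (k - 1 - G.natDegree)
    omega
  have hdeg' : D.degree < k := by
    refine lt_of_le_of_lt degree_le_natDegree ?_
    exact_mod_cast (by omega : D.natDegree < k)
  have hco : D.coeff (k-1) = b := by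
    rw [hD, mul_assoc, coeff_C_mul, mul_comm (X ^ _) G]
    obtain ⟨e, he⟩ : ∃ e, k - 1 = G.natDegree + e := ⟨k - 1 - G.natDegree, by omega⟩
    rw [he, Nat.add_sub_cancel_left, coeff_mul_X_pow, hG.coeff_natDegree, mul_one]
  have hsum : ∀ (D : L[X]), D.degree < k → ∀ h ∈ mon L k, h + D ∈ mon L k := by
    intro D hD h hh
    rw [mem_mon] at hh ⊢
    have : D.degree < h.degree := by rwa [degree_eq_natDegree hh.1.ne_zero, hh.2]
    refine ⟨hh.1.add_of_left this, ?_⟩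
    rw [natDegree_add_eq_left_of_degree_lt this, hh.2]
  have e : ∑ h ∈ mon L k, lamF F χ ψ (h + D) = ∑ h ∈ mon L k, lamF F χ ψ h := by
    apply Finset.sum_bij' (fun h _ => h + D) (fun h _ => h + (-D))
    · exact hsum D hdeg'
    · exact hsum (-D) (by rwa [degree_neg])
    · intro h _; ring
    · intro h _; ring
    · intro h _; rfl
  have e2 : ∑ h ∈ mon L k, lamF F χ ψ (h + D) = ψ b * ∑ h ∈ mon L k, lamF F χ ψ h := by
    rw [Finset.mul_sum]
    apply Finset.sum_congr rfl
    intro h hh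
    have hh' := mem_mon.1 (hsum D hdeg' h hh)
    rw [mem_mon] at hh
    rw [lamF, lamF, Rs_congr F hF G hFG (h + D) h (by rw [hD]; simp)]
    rw [nextCoeff_of_natDegree_pos (by omega), nextCoeff_of_natDegree_pos (by omega), hh.2, hh'.2,
      coeff_add, hco, AddChar.map_add_eq_mul]
    ring
  rw [e] at e2
  have : (1 - ψ b) * ∑ h ∈ mon L k, lamF F χ ψ h = 0 := by linear_combination e2
  rcases mul_eq_zero.1 this with h | h
  · exact absurd (sub_eq_zero.1 h).symm hb
  · exact h

/-- vanishing, multiplicative case -/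
theorem van_mul (F : L[X]) (hF : F.Monic) (χ : MulChar L ℂ)
    (G : L[X]) (hG : G.Monic) (hFG : ∀ β : AlgebraicClosure L, aeval β F = 0 → aeval β G = 0)
    (hGF : G ∣ F) (u : L[X]) (hu0 : χ (Rs F u) ≠ 0) (hu1 : χ (Rs F u) ≠ 1)
    (k : ℕ) (hk : G.natDegree < k) : Lco (lamF F χ 1) k = 0 := by
  have hR : Rs F u ≠ 0 := by
    intro h; apply hu0; rw [h]; exact MulChar.map_zero χ
  have hcop : IsCoprime F u := by
    by_contra h
    exact hR (resultant_eq_zero_iff.2 ⟨Or.inl hF.ne_zero, h⟩)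
  have hcopG : IsCoprime G u := hcop.of_isCoprime_of_dvd_left hGF
  obtain ⟨T, hT⟩ : ∃ T : L[X] → L[X], ∀ h, T h = G * (h /ₘ G) + (u * (h %ₘ G)) %ₘ G := ⟨_, fun _ => rfl⟩
  have hdl : ∀ p : L[X], (p %ₘ G).degree < G.degree := fun p => degree_modByMonic_lt p hG
  have hTu : ∀ h, G ∣ T h - u * h := by
    intro h
    have h1 := modByMonic_add_div h G
    have h2 := modByMonic_add_div (u * (h %ₘ G)) G
    refine ⟨h /ₘ G - (u * (h %ₘ G)) /ₘ G - u * (h /ₘ G), ?_⟩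
    rw [hT]
    linear_combination h2 + u * h1
  have hTm : ∀ h ∈ mon L k, T h ∈ mon L k := by
    intro h hh
    rw [mem_mon] at hh ⊢
    have h1 := modByMonic_add_div h G
    have e : T h = h + ((u * (h %ₘ G)) %ₘ G - h %ₘ G) := by
      rw [hT]; linear_combination h1
    have hd : ((u * (h %ₘ G)) %ₘ G - h %ₘ G).degree < h.degree := by
      refine lt_of_lt_of_le (lt_of_le_of_lt (degree_sub_le _ _) (max_lt (hdl _) (hdl _))) ?_
      rw [degree_eq_natDegree hh.1.ne_zero, degree_eq_natDegree hG.ne_zero, hh.2]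
      exact_mod_cast hk.le
    rw [e]
    refine ⟨hh.1.add_of_left hd, ?_⟩
    rw [natDegree_add_eq_left_of_degree_lt hd, hh.2]
  have hinj : Set.InjOn T (mon L k) := by
    intro a _ b _ hab
    have ha := div_modByMonic_unique (f := T a) (a /ₘ G) ((u * (a %ₘ G)) %ₘ G) hG ⟨by rw [hT]; ring, hdl _⟩
    have hb := div_modByMonic_unique (f := T b) (b /ₘ G) ((u * (b %ₘ G)) %ₘ G) hG ⟨by rw [hT]; ring, hdl _⟩
    have hq : a /ₘ G = b /ₘ G := by rw [← ha.1, ← hb.1, hab]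
    have hr : G ∣ u * (a - b) := by
      have h1 := hTu a
      have h2 := hTu b
      rw [hab] at h1
      have := dvd_sub h2 h1
      convert this using 1; ring
    have hr' : G ∣ a - b := hcopG.dvd_of_dvd_mul_left hr
    have h1 := modByMonic_add_div a G
    have h2 := modByMonic_add_div b G
    have e : a - b = a %ₘ G - b %ₘ G := by
      rw [hq] at h1
      linear_combination h2 - h1
    rw [e] at hr'
    have : a %ₘ G - b %ₘ G = 0 := by
      apply eq_zero_of_dvd_of_degree_lt hr'
      exact lt_of_le_of_lt (degree_sub_le _ _) (max_lt (hdl _) (hdl _))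
    rw [this] at e
    exact sub_eq_zero.1 e
  classical
  have himg : (mon L k).image T = mon L k := by
    classical
    apply Finset.eq_of_subset_of_card_le
    · intro x hx
      obtain ⟨h, hh, rfl⟩ := Finset.mem_image.1 hx
      exact hTm h hh
    · rw [Finset.card_image_of_injOn hinj]
  have e : ∑ h ∈ mon L k, lamF F χ 1 (T h) = ∑ h ∈ mon L k, lamF F χ 1 h := by
    conv_rhs => rw [← himg]
    rw [Finset.sum_image hinj]
  have e2 : ∑ h ∈ mon L k, lamF F χ 1 (T h) = χ (Rs F u) * ∑ h ∈ mon L k, lamF F χ 1 h := by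
    rw [Finset.mul_sum]
    apply Finset.sum_congr rfl
    intro h hh
    rw [lamF, lamF, Rs_congr F hF G hFG (T h) (u * h) (hTu h), Rs_mul F hF, map_mul]
    simp
  rw [e] at e2
  have : (1 - χ (Rs F u)) * ∑ h ∈ mon L k, lamF F χ 1 h = 0 := by linear_combination e2
  rcases mul_eq_zero.1 this with h | h
  · exact absurd (sub_eq_zero.1 h).symm hu1
  · exact h

end Stp

namespace Stp
open Polynomial

noncomputable def normChar {L E : Type} [Field L] [Field E] [Algebra L E] [FiniteDimensional L E]
    (χ : MulChar L ℂ) : MulChar E ℂ :=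
  { toMonoidHom := χ.toMonoidHom.comp (Algebra.norm L)
    map_nonunit' := by
      intro a ha
      have : a = 0 := by simpa using ha
      subst this
      have h := Algebra.norm_zero (R := L) (S := E)
      show χ (Algebra.norm L 0) = 0
      rw [h]; exact MulChar.map_zero χ }

theorem normChar_apply {L E : Type} [Field L] [Field E] [Algebra L E] [FiniteDimensional L E]
    (χ : MulChar L ℂ) (x : E) : normChar χ x = χ (Algebra.norm L x) := rfl

theorem ncond_of {L E : Type} [Field L] [Field E] [Algebra L E] [FiniteDimensional L E] (F : L[X]) (p : ℕ)
    (hp : p.Prime) (hF : ∃ θ : AlgebraicClosure L, ¬ p ∣ rootMultiplicity θ (F.map (algebraMap L (AlgebraicClosure L)))) :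
    ∀ u : E, u ≠ 0 → ∀ w : E[X], C u * F.map (algebraMap L E) ≠ w ^ p := by
  intro u hu w h
  obtain ⟨θ, hθ⟩ := hF
  classical
  let φ : E →ₐ[L] AlgebraicClosure L := IsAlgClosed.lift
  apply hθ
  have h2 := congrArg (Polynomial.map φ.toRingHom) h
  rw [Polynomial.map_mul, map_C, Polynomial.map_pow, Polynomial.map_map] at h2
  have h3 : φ.toRingHom.comp (algebraMap L E) = algebraMap L (AlgebraicClosure L) := φ.comp_algebraMap
  rw [h3] at h2
  have h4 := congrArg roots h2
  have hu' : φ.toRingHom u ≠ 0 := by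
    simpa using hu
  rw [roots_C_mul _ hu', roots_pow] at h4
  rw [← count_roots, h4, Multiset.count_nsmul]
  exact dvd_mul_right _ _

theorem Sr_bound (d : ℕ) (hodd : Odd d) (L : Type) [Field L] [Fintype L] [CharP L 2] (m q0 : ℕ)
    (hc : Fintype.card L = 2 ^ m) (hq : 2 ^ m = q0 ^ 2) (hd : d ∣ 2 ^ m - 1) (F : L[X]) (hF : F.Monic)
    (hcond : ∀ p : ℕ, p.Prime → p ∣ d →
      ∃ θ : AlgebraicClosure L, ¬ p ∣ rootMultiplicity θ (F.map (algebraMap L (AlgebraicClosure L))))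
    (χ : MulChar L ℂ) (hχ : χ ^ d = 1) (ψ : AddChar L ℂ) (hne : χ ≠ 1 ∨ ψ ≠ 1) :
    ∃ C0 : ℝ, ∀ r, 1 ≤ r → ‖Sr (lamF F χ ψ) r‖ ≤ C0 * (q0 : ℝ) ^ r := by
  obtain ⟨Cst, hC⟩ := stepanov d F.natDegree hodd
  refine ⟨Cst, ?_⟩
  intro r hr
  have : NeZero r := ⟨by omega⟩
  have : Fact (Nat.Prime 2) := ⟨Nat.prime_two⟩
  let E := FiniteField.Extension L 2 r
  let : Fintype E := Fintype.ofFinite E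
  have hrk : Module.finrank L E = r := FiniteField.finrank_extension L 2 r
  have hfd : FiniteDimensional L E := inferInstance
  have : CharP E 2 := charP_of_injective_algebraMap (algebraMap L E).injective 2
  have hcE : Fintype.card E = 2 ^ (m * r) := by
    rw [← Nat.card_eq_fintype_card, FiniteField.natCard_extension, Nat.card_eq_fintype_card, hc, pow_mul]
  have key := hC E (m * r) (q0 ^ r) hcE (by rw [pow_mul, hq, ← pow_mul, ← pow_mul, mul_comm])
    (hd.trans (by rw [pow_mul]; simpa using Nat.sub_dvd_pow_sub_pow (2 ^ m) 1 r))
    (F.map (algebraMap L E)) (hF.map _) (natDegree_map _)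
    (fun p hp hpd => ncond_of F p hp (hcond p hp hpd))
    (normChar χ) (by
      ext x
      have h1 : (χ ^ d) (Algebra.norm L (x : E)) = 1 := by
        rw [hχ]; exact MulChar.one_apply_coe (((x.isUnit.map (Algebra.norm L))).unit)
      have hun : IsUnit (Algebra.norm L (x : E)) := x.isUnit.map _
      rw [MulChar.pow_apply_coe, normChar_apply, MulChar.one_apply_coe]
      have := MulChar.pow_apply_coe χ d hun.unit
      rw [IsUnit.unit_spec] at this
      rw [← this, h1])
    (ψ.compAddMonoidHom (Algebra.trace L E).toAddMonoidHom) (by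
      rcases hne with h | h
      · left
        intro hh
        apply h
        ext a
        obtain ⟨x, hx⟩ := FiniteField.norm_surjective L E (a : L)
        have : normChar χ x = (1 : MulChar E ℂ) x := by rw [hh]
        rw [normChar_apply, hx] at this
        rw [this, MulChar.one_apply_coe]
        have hx0 : x ≠ 0 := by
          rintro rfl
          rw [Algebra.norm_zero] at hx
          exact a.ne_zero hx.symm
        exact MulChar.one_apply_coe (Units.mk0 x hx0)
      · right
        intro hh
        apply h
        ext a
        obtain ⟨x, hx⟩ := Algebra.trace_surjective L E a
        have := DFunLike.congr_fun hh x
        rw [← hx]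
        simpa using this)
  have e := Sr_eq (E := E) F χ ψ
  rw [hrk] at e
  rw [e]
  refine le_trans (le_of_eq ?_) (key.trans (le_of_eq ?_))
  · congr 1
    apply Finset.sum_congr rfl
    intro x _
    rw [eval_map_algebraMap]
    rfl
  · push_cast; ring

theorem exists_u (d : ℕ) (hodd : Odd d) (L : Type) [Field L] [Fintype L] [CharP L 2] (m q0 : ℕ)
    (hc : Fintype.card L = 2 ^ m) (hq : 2 ^ m = q0 ^ 2) (hd : d ∣ 2 ^ m - 1) (F : L[X]) (hF : F.Monic)
    (hcond : ∀ p : ℕ, p.Prime → p ∣ d →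
      ∃ θ : AlgebraicClosure L, ¬ p ∣ rootMultiplicity θ (F.map (algebraMap L (AlgebraicClosure L))))
    (χ : MulChar L ℂ) (hχ : χ ^ d = 1) (hne : χ ≠ 1) :
    ∃ u, χ (Rs F u) ≠ 0 ∧ χ (Rs F u) ≠ 1 := by
  by_contra hcon
  push Not at hcon
  obtain ⟨C0, hC0⟩ := Sr_bound d hodd L m q0 hc hq hd F hF hcond χ hχ 1 (Or.inl hne)
  have hlow : ∀ r, 1 ≤ r → ((q0:ℝ)^r)^2 - F.natDegree ≤ ‖Sr (lamF F χ 1) r‖ := by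
    intro r hr
    have : NeZero r := ⟨by omega⟩
    have : Fact (Nat.Prime 2) := ⟨Nat.prime_two⟩
    classical
    let E := FiniteField.Extension L 2 r
    let : Fintype E := Fintype.ofFinite E
    have hrk : Module.finrank L E = r := FiniteField.finrank_extension L 2 r
    have hfd : FiniteDimensional L E := inferInstance
    have hcE : Fintype.card E = (q0 ^ r) ^ 2 := by
      rw [← Nat.card_eq_fintype_card, FiniteField.natCard_extension, Nat.card_eq_fintype_card, hc, hq]
      rw [← pow_mul, ← pow_mul, mul_comm]
    have e := Sr_eq (E := E) F χ 1
    rw [hrk] at e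
    rw [e]
    have hterm : ∀ x : E, χ (Algebra.norm L (aeval x F)) * (1 : AddChar L ℂ) (Algebra.trace L E x) =
        (((if aeval x F = 0 then 0 else 1 : ℕ) : ℝ) : ℂ) := by
      intro x
      have h1 : χ (Algebra.norm L (aeval x F)) ≠ 0 → χ (Algebra.norm L (aeval x F)) = 1 := by
        rw [norm_Rs, map_pow]
        intro h
        rw [hcon _ (fun h0 => ?_), one_pow]
        · apply h
          rw [h0, zero_pow]
          have hd : (minpoly L x).natDegree ∣ Module.finrank L E := minpoly.degree_dvd (IsIntegral.of_finite L x)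
          exact (Nat.div_pos (Nat.le_of_dvd Module.finrank_pos hd) (minpoly.natDegree_pos (IsIntegral.of_finite L x))).ne'
      split_ifs with h
      · rw [h, Algebra.norm_zero, MulChar.map_zero]; simp
      · rw [h1]
        · simp
        · have hun : IsUnit (Algebra.norm L (aeval x F)) := (Ne.isUnit h).map _
          rw [← hun.unit_spec]
          exact ((χ.toUnitHom hun.unit).isUnit).ne_zero
    rw [Finset.sum_congr rfl (fun x _ => hterm x)]
    rw [← Complex.ofReal_sum, Complex.norm_real, ← Nat.cast_sum]
    refine le_trans ?_ (le_abs_self _)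
    have hcnt : Fintype.card E ≤ (∑ x : E, (if aeval x F = 0 then 0 else 1)) + F.natDegree := by
      have h1 : (∑ x : E, (if aeval x F = 0 then 0 else 1)) = (Finset.univ.filter (fun x : E => ¬ aeval x F = 0)).card := by
        rw [Finset.card_filter]
        apply Finset.sum_congr rfl
        intro x _
        split_ifs <;> simp_all
      have h2 : (Finset.univ.filter (fun x : E => aeval x F = 0)).card ≤ F.natDegree := by
        have : (Finset.univ.filter (fun x : E => aeval x F = 0)) ⊆ (F.aroots E).toFinset := by
          intro x hx
          rw [Multiset.mem_toFinset, mem_aroots]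
          exact ⟨hF.ne_zero, (Finset.mem_filter.1 hx).2⟩
        refine (Finset.card_le_card this).trans ((Multiset.toFinset_card_le _).trans ?_)
        exact (card_roots' _).trans natDegree_map_le
      rw [h1, ← Finset.card_univ, ← Finset.card_filter_add_card_filter_not (s := Finset.univ) (fun x : E => aeval x F = 0)]
      omega
    rw [hcE] at hcnt
    rw [sub_le_iff_le_add]
    exact_mod_cast hcnt
  have hq2 : (2:ℝ) ≤ q0 := by
    have h1 : 1 < Fintype.card L := Fintype.one_lt_card
    rw [hc, hq] at h1
    have : 2 ≤ q0 := by
      by_contra h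
      have : q0 ≤ 1 := by omega
      have := Nat.pow_le_pow_left this 2
      omega
    exact_mod_cast this
  -- choose r with q0^r > |C0| + natDegree + 1
  obtain ⟨r, hr⟩ := pow_unbounded_of_one_lt (|C0| + F.natDegree + 1) (show (1:ℝ) < q0 by linarith)
  have hr1 : (q0:ℝ)^r ≤ (q0:ℝ)^(r+1) := pow_le_pow_right₀ (by linarith) (by omega)
  have h1 := hlow (r+1) (by omega)
  have h2 := hC0 (r+1) (by omega)
  obtain ⟨y, hy⟩ : ∃ y, y = (q0:ℝ)^(r+1) := ⟨_, rfl⟩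
  rw [← hy] at h1 h2 hr1
  have h3 : C0 * y ≤ |C0| * y := by
    apply mul_le_mul_of_nonneg_right (le_abs_self _)
    have := abs_nonneg C0
    have : (0:ℝ) ≤ F.natDegree := Nat.cast_nonneg _
    linarith
  have h0 := abs_nonneg C0
  have h0' : (0:ℝ) ≤ F.natDegree := Nat.cast_nonneg _
  nlinarith

theorem weil (d : ℕ) (hodd : Odd d) (L : Type) [Field L] [Fintype L] [CharP L 2] (m q0 : ℕ)
    (hc : Fintype.card L = 2 ^ m) (hq : 2 ^ m = q0 ^ 2) (hd : d ∣ 2 ^ m - 1) (F : L[X]) (hF : F.Monic)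
    (hcond : ∀ p : ℕ, p.Prime → p ∣ d →
      ∃ θ : AlgebraicClosure L, ¬ p ∣ rootMultiplicity θ (F.map (algebraMap L (AlgebraicClosure L))))
    (χ : MulChar L ℂ) (hχ : χ ^ d = 1) (ψ : AddChar L ℂ) (hne : χ ≠ 1 ∨ ψ ≠ 1)
    (G : L[X]) (hG0 : G ≠ 0) (hFG : ∀ β : AlgebraicClosure L, aeval β F = 0 → aeval β G = 0) :
    ‖∑ x, χ (F.eval x) * ψ x‖ ≤ G.natDegree * (q0 : ℝ) := by
  classical
  obtain ⟨C0, hC0⟩ := Sr_bound d hodd L m q0 hc hq hd F hF hcond χ hχ ψ hne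
  obtain ⟨H, hHdef⟩ : ∃ H, H = normalize (EuclideanDomain.gcd F G) := ⟨_, rfl⟩
  have hg0 : EuclideanDomain.gcd F G ≠ 0 := by
    intro h
    exact hG0 (EuclideanDomain.gcd_eq_zero_iff.1 h).2
  have hHm : H.Monic := by rw [hHdef]; exact monic_normalize hg0
  have hass : Associated H (EuclideanDomain.gcd F G) := by rw [hHdef]; exact normalize_associated _
  have hHF : H ∣ F := hass.dvd.trans (EuclideanDomain.gcd_dvd_left _ _)
  have hHG : H ∣ G := hass.dvd.trans (EuclideanDomain.gcd_dvd_right _ _)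
  have hFH : ∀ β : AlgebraicClosure L, aeval β F = 0 → aeval β H = 0 := by
    intro β hβ
    have hg : aeval β (EuclideanDomain.gcd F G) = 0 := by
      rw [EuclideanDomain.gcd_eq_gcd_ab F G, map_add, map_mul, map_mul, hβ, hFG β hβ]; ring
    obtain ⟨c, hc⟩ := hass.symm.dvd
    rw [hc, map_mul, hg, zero_mul]
  have hq1 : (0:ℝ) < q0 := by
    have h1 : 0 < 2 ^ m := by positivity
    rw [hq] at h1
    have : 0 < q0 := Nat.pos_of_ne_zero (by rintro rfl; simp at h1)
    exact_mod_cast this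
  have hvan : ∀ k, H.natDegree < k → Lco (lamF F χ ψ) k = 0 := by
    intro k hk
    by_cases hψ : ψ = 1
    · have hχ1 : χ ≠ 1 := by
        rcases hne with h | h
        · exact h
        · exact absurd hψ h
      obtain ⟨u, hu0, hu1⟩ := exists_u d hodd L m q0 hc hq hd F hF hcond χ hχ hχ1
      rw [hψ]
      exact van_mul F hF χ H hHm hFH hHF u hu0 hu1 k hk
    · exact van_add F hF χ ψ hψ H hHm hFH k hk
  have := ana (Sr (lamF F χ ψ)) (Lco (lamF F χ ψ)) H.natDegree q0 C0 hq1
    (Lco_zero _ (lamF_one F hF χ ψ)) (Lrec' _ (lamF_one F hF χ ψ) (lamF_mul F hF χ ψ)) hvan hC0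
  rw [Lco_one_eq] at this
  refine this.trans ?_
  gcongr
  exact natDegree_le_of_dvd hHG hG0

end Stp

namespace Stp
open Polynomial

theorem exists_gen (L : Type) [Field L] [Fintype L] :
    ∃ ω : MulChar L ℂ, ω ^ (Fintype.card L - 1) = 1 ∧ ∀ χ : MulChar L ℂ, ∃ i : ℕ, χ = ω ^ i := by
  classical
  have hN : Fintype.card L - 1 ≠ 0 := by have := Fintype.one_lt_card (α := L); omega
  obtain ⟨ω, hω⟩ := MulChar.exists_mulChar_orderOf L (dvd_refl (Fintype.card L - 1))
    (Complex.isPrimitiveRoot_exp _ hN)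
  refine ⟨ω, by rw [← hω]; exact pow_orderOf_eq_one ω, ?_⟩
  have hcard : Nat.card (MulChar L ℂ) = Fintype.card L - 1 := by
    rw [MulChar.card_eq_card_units_of_hasEnoughRootsOfUnity L ℂ, Nat.card_units, Nat.card_eq_fintype_card]
  have hfin : Finite (MulChar L ℂ) := Nat.finite_of_card_ne_zero (by rw [hcard]; exact hN)
  intro χ
  have htop : Subgroup.zpowers ω = ⊤ := by
    apply Subgroup.eq_top_of_card_eq
    rw [Nat.card_zpowers, hω, hcard]
  have : χ ∈ Subgroup.zpowers ω := by rw [htop]; trivial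
  rw [mem_zpowers_iff_mem_range_orderOf] at this
  obtain ⟨i, _, hi⟩ := Finset.mem_image.1 this
  exact ⟨i, hi.symm⟩

section
variable {L : Type} [Field L] [Fintype L]

theorem mult_g (f1 f2 g : L[X]) (k : ℕ) (h0 : f1 * f2 ≠ 0) (hcop : IsCoprime f1 f2) (hi : Irreducible g)
    (hgX : g ≠ X) (hgm : g.Monic) (h1 : g ^ k ∣ f1 * f2) (h2 : ¬ g ^ (k+1) ∣ f1 * f2) :
    ∃ θ : AlgebraicClosure L, θ ≠ 0 ∧
      ((rootMultiplicity θ (f1.map (algebraMap L (AlgebraicClosure L))) = k ∧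
        rootMultiplicity θ (f2.map (algebraMap L (AlgebraicClosure L))) = 0) ∨
       (rootMultiplicity θ (f1.map (algebraMap L (AlgebraicClosure L))) = 0 ∧
        rootMultiplicity θ (f2.map (algebraMap L (AlgebraicClosure L))) = k)) := by
  classical
  obtain ⟨θ, hθ⟩ := IsAlgClosed.exists_aeval_eq_zero (AlgebraicClosure L) g
    (by have := hi.degree_pos; exact this.ne')
  have hmin : g = minpoly L θ := minpoly.eq_of_irreducible_of_monic hi hθ hgm
  have hθ0 : θ ≠ 0 := by
    rintro rfl
    rw [minpoly.zero] at hmin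
    exact hgX hmin
  refine ⟨θ, hθ0, ?_⟩
  obtain ⟨h, hh⟩ := h1
  have hgh : ¬ g ∣ h := by
    rintro ⟨c, rfl⟩
    apply h2
    rw [hh]
    exact ⟨c, by ring⟩
  have hθh : aeval θ h ≠ 0 := by
    intro hz
    exact hgh (hmin ▸ minpoly.dvd L θ hz)
  set A := algebraMap L (AlgebraicClosure L)
  have hAne : ∀ p : L[X], p ≠ 0 → p.map A ≠ 0 := fun p hp => by
    rwa [Ne, Polynomial.map_eq_zero]
  have hf1 : f1 ≠ 0 := left_ne_zero_of_mul h0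
  have hf2 : f2 ≠ 0 := right_ne_zero_of_mul h0
  have hsep : g.Separable := PerfectField.separable_of_irreducible hi
  have hg1 : rootMultiplicity θ (g.map A) = 1 := by
    apply le_antisymm (rootMultiplicity_le_one_of_separable (hsep.map) θ)
    rw [Nat.one_le_iff_ne_zero, ← Nat.pos_iff_ne_zero, rootMultiplicity_pos (hAne g hi.ne_zero)]
    rw [IsRoot, eval_map_algebraMap, hθ]
  have hh0 : rootMultiplicity θ (h.map A) = 0 := by
    apply rootMultiplicity_eq_zero
    rwa [IsRoot, eval_map_algebraMap]
  have htot : rootMultiplicity θ (f1.map A) + rootMultiplicity θ (f2.map A) = k := by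
    have e := congrArg (fun p => (p.map A).roots.count θ) hh
    simp only [Polynomial.map_mul, Polynomial.map_pow] at e
    have hne : g ^ k * h ≠ 0 := by rw [← hh]; exact h0
    rw [roots_mul (by rw [← Polynomial.map_mul]; exact hAne _ h0),
      roots_mul (by rw [← Polynomial.map_pow, ← Polynomial.map_mul]; exact hAne _ hne),
      roots_pow, Multiset.count_add, Multiset.count_add, Multiset.count_nsmul, count_roots, count_roots,
      count_roots, count_roots, hg1, hh0] at e
    omega
  have hcz : rootMultiplicity θ (f1.map A) = 0 ∨ rootMultiplicity θ (f2.map A) = 0 := by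
    by_contra hcon
    push Not at hcon
    obtain ⟨c1, c2⟩ := hcon
    have r1 := (rootMultiplicity_pos (hAne _ hf1)).1 (Nat.pos_of_ne_zero c1)
    have r2 := (rootMultiplicity_pos (hAne _ hf2)).1 (Nat.pos_of_ne_zero c2)
    rw [IsRoot, eval_map_algebraMap] at r1 r2
    obtain ⟨a, b, hab⟩ := hcop
    have := congrArg (aeval θ) hab
    simp [r1, r2] at this
  omega

theorem mult_F (f1 f2 : L[X]) (h1 : f1 ≠ 0) (h2 : f2 ≠ 0) (a b c : ℕ) (θ : AlgebraicClosure L) (u : L) (hu : u ≠ 0) :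
    rootMultiplicity θ ((X ^ a * f1 ^ b * f2 ^ c * C u).map (algebraMap L (AlgebraicClosure L))) =
      a * (rootMultiplicity θ (X : (AlgebraicClosure L)[X])) + b * rootMultiplicity θ (f1.map (algebraMap L (AlgebraicClosure L)))
       + c * rootMultiplicity θ (f2.map (algebraMap L (AlgebraicClosure L))) := by
  classical
  set A := algebraMap L (AlgebraicClosure L)
  have h1' : f1.map A ≠ 0 := by rwa [Ne, Polynomial.map_eq_zero]
  have h2' : f2.map A ≠ 0 := by rwa [Ne, Polynomial.map_eq_zero]
  have hu' : A u ≠ 0 := by simpa [A] using hu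
  rw [mul_comm _ (C u)]
  simp only [Polynomial.map_mul, Polynomial.map_pow, map_X, map_C]
  have hX : (X : (AlgebraicClosure L)[X]) ≠ 0 := X_ne_zero
  rw [← count_roots, roots_C_mul _ hu', roots_mul (mul_ne_zero (mul_ne_zero (pow_ne_zero _ hX) (pow_ne_zero _ h1')) (pow_ne_zero _ h2')),
    roots_mul (mul_ne_zero (pow_ne_zero _ hX) (pow_ne_zero _ h1')), roots_pow, roots_pow, roots_pow]
  simp only [Multiset.count_add, Multiset.count_nsmul, count_roots]
end

theorem nat_red (i j N : ℕ) (hN : 0 < N) : ∃ g d a b : ℕ, 0 < d ∧ g * d = N ∧ 0 < a ∧ 0 < b ∧ b < 2 * d ∧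
    (∀ p : ℕ, p.Prime → p ∣ d → p ∣ b → ¬ p ∣ a) ∧ (∃ s, g * a = i + N * s) ∧ (∃ s t, g * b + N * s = j + N * t) := by
  obtain ⟨g, hg⟩ : ∃ g, g = Nat.gcd (Nat.gcd i j) N := ⟨_, rfl⟩
  have hgN : g ∣ N := by rw [hg]; exact Nat.gcd_dvd_right _ _
  have hgi : g ∣ i := by rw [hg]; exact (Nat.gcd_dvd_left _ _).trans (Nat.gcd_dvd_left _ _)
  have hgj : g ∣ j := by rw [hg]; exact (Nat.gcd_dvd_left _ _).trans (Nat.gcd_dvd_right _ _)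
  have hg0 : 0 < g := Nat.pos_of_dvd_of_pos hgN hN
  obtain ⟨d, hd⟩ := hgN
  obtain ⟨a, ha⟩ := hgi
  obtain ⟨b, hb⟩ := hgj
  have hd0 : 0 < d := Nat.pos_of_ne_zero (by rintro rfl; omega)
  refine ⟨g, d, a + d, b % d + d, hd0, hd.symm, by omega, by omega, ?_, ?_, ?_, ?_⟩
  · have := Nat.mod_lt b hd0; omega
  · intro p hp hpd hpb hpa
    have hpa' : p ∣ a := (Nat.dvd_add_left hpd).1 hpa
    have hpb' : p ∣ b := by
      have h1 : p ∣ b % d := (Nat.dvd_add_left hpd).1 hpb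
      exact (Nat.dvd_mod_iff hpd).1 h1
    have : g * p ∣ g := by
      conv_rhs => rw [hg]
      refine Nat.dvd_gcd (Nat.dvd_gcd ?_ ?_) ?_
      · rw [ha]; exact Nat.mul_dvd_mul_left g hpa'
      · rw [hb]; exact Nat.mul_dvd_mul_left g hpb'
      · rw [hd]; exact Nat.mul_dvd_mul_left g hpd
    have := Nat.le_of_dvd hg0 this
    have := hp.two_le
    nlinarith
  · exact ⟨1, by rw [ha, hd]; ring⟩
  · refine ⟨b / d, 1, ?_⟩
    have := Nat.mod_add_div b d
    rw [hb, hd]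
    calc g * (b % d + d) + g * d * (b / d) = g * (b % d + d * (b / d)) + g * d := by ring
      _ = _ := by rw [this]; ring

theorem pair_bound (L : Type) [Field L] [Fintype L] [CharP L 2] (m q0 : ℕ) (hm : 0 < m)
    (hc : Fintype.card L = 2 ^ m) (hq : 2 ^ m = q0 ^ 2) (f1 f2 g : L[X]) (k : ℕ) (h0 : f1 * f2 ≠ 0)
    (hcop : IsCoprime f1 f2) (hi : Irreducible g)
    (hgX : g ≠ X) (hgm : g.Monic) (h1 : g ^ k ∣ f1 * f2) (h2 : ¬ g ^ (k+1) ∣ f1 * f2)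
    (hk : Nat.gcd k (Fintype.card L - 1) = 1) (hdeg : f1.natDegree + f2.natDegree ≤ 5)
    (χ1 χ2 : MulChar L ℂ) (ψ : AddChar L ℂ) (hne : χ1 ≠ 1 ∨ χ2 ≠ 1 ∨ ψ ≠ 1) :
    ‖∑ x, χ1 x * χ2 (f1.eval x / f2.eval x) * ψ x‖ ≤ 6 * (q0 : ℝ) := by
  classical
  have hf1 : f1 ≠ 0 := left_ne_zero_of_mul h0
  have hf2 : f2 ≠ 0 := right_ne_zero_of_mul h0
  obtain ⟨ω, hω, hgen⟩ := exists_gen L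
  obtain ⟨i, hi1⟩ := hgen χ1
  obtain ⟨j, hj1⟩ := hgen χ2
  have hN : 0 < Fintype.card L - 1 := by have := Fintype.one_lt_card (α := L); omega
  obtain ⟨N, hNdef⟩ : ∃ N, N = Fintype.card L - 1 := ⟨_, rfl⟩
  rw [← hNdef] at hN hω hk
  obtain ⟨e, d, a, b, hd0, hed, ha, hb, hb2, hpr, ⟨s, hs⟩, ⟨s', t', hs'⟩⟩ := nat_red i j N hN
  obtain ⟨χ, hχ⟩ : ∃ χ, χ = ω ^ e := ⟨_, rfl⟩
  have hχd : χ ^ d = 1 := by rw [hχ, ← pow_mul, hed, hω]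
  have hχa : χ ^ a = χ1 := by rw [hχ, ← pow_mul, hs, pow_add, pow_mul, hω, one_pow, mul_one, hi1]
  have hχb : χ ^ b = χ2 := by
    have : ω ^ (e * b + N * s') = ω ^ (j + N * t') := by rw [hs']
    rw [pow_add, pow_add, pow_mul ω N, pow_mul ω N, hω, one_pow, one_pow, mul_one, mul_one] at this
    rw [hχ, ← pow_mul, this, hj1]
  have hdN : d ∣ 2 ^ m - 1 := by rw [← hc, ← hNdef, ← hed]; exact dvd_mul_left _ _
  have hodd : Odd d := by
    have : Odd (2 ^ m - 1) := by
      apply Nat.Even.sub_odd Nat.one_le_two_pow _ odd_one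
      exact (even_two.pow_of_ne_zero hm.ne')
    exact Odd.of_dvd_nat this hdN
  obtain ⟨F0, hF0⟩ : ∃ F0, F0 = X ^ a * f1 ^ b * f2 ^ (2 * d - b) := ⟨_, rfl⟩
  have hF00 : F0 ≠ 0 := by
    rw [hF0]
    exact mul_ne_zero (mul_ne_zero (pow_ne_zero _ X_ne_zero) (pow_ne_zero _ hf1)) (pow_ne_zero _ hf2)
  obtain ⟨l, hl⟩ : ∃ l, l = F0.leadingCoeff⁻¹ := ⟨_, rfl⟩
  have hl0 : l ≠ 0 := by rw [hl]; exact inv_ne_zero (leadingCoeff_ne_zero.2 hF00)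
  have hFm : (F0 * C l).Monic := by rw [hl]; exact monic_mul_leadingCoeff_inv hF00
  have hW := weil d hodd L m q0 hc hq hdN (F0 * C l) hFm (by
      intro p hp hpd
      have hpN : p ∣ N := hpd.trans (by rw [← hed]; exact dvd_mul_left _ _)
      by_cases hpb : p ∣ b
      · refine ⟨0, ?_⟩
        rw [hF0, mult_F f1 f2 hf1 hf2 _ _ _ _ _ hl0]
        have hX : rootMultiplicity 0 (X : (AlgebraicClosure L)[X]) = 1 := by
          have := rootMultiplicity_X_sub_C_self (x := (0 : AlgebraicClosure L))
          simpa using this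
        rw [hX, mul_one]
        intro h
        have hc' : p ∣ 2 * d - b := Nat.dvd_sub (hpd.mul_left 2) hpb
        rw [add_assoc] at h
        exact hpr p hp hpd hpb ((Nat.dvd_add_left (dvd_add (hpb.mul_right _) (hc'.mul_right _))).1 h)
      · obtain ⟨θ, hθ0, hθ⟩ := mult_g f1 f2 g k h0 hcop hi hgX hgm h1 h2
        refine ⟨θ, ?_⟩
        rw [hF0, mult_F f1 f2 hf1 hf2 _ _ _ _ _ hl0]
        have hX : rootMultiplicity θ (X : (AlgebraicClosure L)[X]) = 0 := by
          apply rootMultiplicity_eq_zero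
          rw [IsRoot, eval_X]; exact hθ0
        have hpk : ¬ p ∣ k := by
          intro h
          have := Nat.dvd_gcd h hpN
          rw [hk] at this
          exact hp.one_lt.ne' (Nat.dvd_one.1 this)
        rw [hX]
        rcases hθ with ⟨e1, e2⟩ | ⟨e1, e2⟩
        · rw [e1, e2]
          simp only [mul_zero, zero_add, add_zero]
          intro h
          rcases hp.dvd_mul.1 h with h | h
          · exact hpb h
          · exact hpk h
        · rw [e1, e2]
          simp only [mul_zero, zero_add]
          intro h
          rcases hp.dvd_mul.1 h with h | h
          · apply hpb
            have h3 : p ∣ (2 * d - b) + b := by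
              rw [Nat.sub_add_cancel hb2.le]; exact hpd.mul_left 2
            exact (Nat.dvd_add_right h).1 h3
          · exact hpk h)
    χ hχd ψ (by
      by_cases hψ : ψ = 1
      · left
        rintro h
        rw [h, one_pow] at hχa hχb
        rcases hne with h | h | h
        · exact h hχa.symm
        · exact h hχb.symm
        · exact h hψ
      · right; exact hψ)
    (X * f1 * f2) (mul_ne_zero (mul_ne_zero X_ne_zero hf1) hf2) (by
      intro β hβ
      rw [hF0] at hβ
      simp only [map_mul, map_pow, aeval_X, aeval_C, mul_eq_zero, pow_eq_zero_iff ha.ne', pow_eq_zero_iff hb.ne',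
        pow_eq_zero_iff (show 2 * d - b ≠ 0 by omega)] at hβ ⊢
      rcases hβ with h | h
      · exact h
      · simp [hl0] at h)
  have hterm : ∀ x, χ ((F0 * C l).eval x) * ψ x = χ l * (χ1 x * χ2 (f1.eval x / f2.eval x) * ψ x) := by
    intro x
    rw [hF0]
    simp only [eval_mul, eval_pow, eval_X, eval_C, map_mul, map_pow]
    by_cases hx : x = 0
    · rw [hx, MulChar.map_zero, MulChar.map_zero, zero_pow ha.ne']; ring
    by_cases hx1 : f1.eval x = 0
    · rw [hx1, zero_div, MulChar.map_zero, MulChar.map_zero, zero_pow hb.ne']; ring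
    by_cases hx2 : f2.eval x = 0
    · rw [hx2, div_zero, MulChar.map_zero, MulChar.map_zero, zero_pow (show 2 * d - b ≠ 0 by omega)]; ring
    have P : ∀ (n : ℕ) (y : L), y ≠ 0 → (χ ^ n) y = χ y ^ n := by
      intro n y hy
      exact MulChar.pow_apply_coe χ n (Units.mk0 y hy)
    have hc2 : χ (f2.eval x) ^ (2 * d - b) * χ2 (f2.eval x) = 1 := by
      rw [← hχb, P b _ hx2, ← pow_add, Nat.sub_add_cancel hb2.le, mul_comm 2 d, pow_mul, ← P d _ hx2, hχd]
      have : (1 : MulChar L ℂ) (f2.eval x) = 1 := MulChar.one_apply_coe (Units.mk0 _ hx2)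
      rw [this, one_pow]
    have h5 : χ2 (f1.eval x / f2.eval x) = χ2 (f1.eval x) * χ (f2.eval x) ^ (2 * d - b) := by
      have : χ2 (f1.eval x / f2.eval x) * χ2 (f2.eval x) = χ2 (f1.eval x) := by
        rw [← map_mul, div_mul_cancel₀ _ hx2]
      rw [← this, mul_assoc, mul_comm (χ2 (f2.eval x)), hc2, mul_one]
    rw [h5]
    conv_rhs => rw [← hχa, ← hχb, P a x hx, P b _ hx1]
    ring
  rw [Finset.sum_congr rfl (fun x _ => hterm x), ← Finset.mul_sum, norm_mul] at hW
  have hl1 : ‖χ l‖ = 1 := by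
    have h3 : χ l ^ d = 1 := by
      have := MulChar.pow_apply_coe χ d (Units.mk0 l hl0)
      rw [Units.val_mk0, hχd] at this
      rw [← this]
      exact MulChar.one_apply_coe (Units.mk0 l hl0)
    exact Complex.norm_eq_one_of_pow_eq_one h3 hd0.ne'
  rw [hl1, one_mul] at hW
  refine hW.trans ?_
  have hdg : (X * f1 * f2).natDegree ≤ 6 := by
    refine natDegree_mul_le.trans ?_
    have := natDegree_mul_le (p := (X : L[X])) (q := f1)
    rw [natDegree_X] at this
    omega
  gcongr
  exact_mod_cast hdg

end Stp

namespace Stp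

open Classical in
theorem char_avg {Γ : Type} [CommGroup Γ] [Fintype Γ] (H : Subgroup Γ) (ev : Γ →* ℂ) :
    ∑ γ ∈ Finset.univ.filter (fun γ => γ ∈ H), ev γ =
      if (∀ γ ∈ H, ev γ = 1) then (Nat.card H : ℂ) else 0 := by
  have hcard : (Finset.univ.filter (fun γ => γ ∈ H)).card = Nat.card H := by
    rw [Nat.card_eq_fintype_card, Fintype.card_subtype]
  split_ifs with h
  · rw [Finset.sum_congr rfl (fun γ hγ => h γ (Finset.mem_filter.1 hγ).2)]
    simp [hcard]
  · push Not at h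
    obtain ⟨g, hg, hg1⟩ := h
    have : ∑ γ ∈ Finset.univ.filter (fun γ => γ ∈ H), ev γ =
        ev g * ∑ γ ∈ Finset.univ.filter (fun γ => γ ∈ H), ev γ := by
      rw [Finset.mul_sum]
      symm
      refine Finset.sum_bij (fun γ _ => g * γ) ?_ ?_ ?_ ?_
      · intro a ha
        simp only [Finset.mem_filter, Finset.mem_univ, true_and] at ha ⊢
        exact H.mul_mem hg ha
      · intro a _ b _ hab
        exact mul_left_cancel hab
      · intro b hb
        simp only [Finset.mem_filter, Finset.mem_univ, true_and] at hb
        refine ⟨g⁻¹ * b, ?_, by simp⟩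
        simp only [Finset.mem_filter, Finset.mem_univ, true_and]
        exact H.mul_mem (H.inv_mem hg) hb
      · intro a _
        rw [map_mul]
    have h2 : (1 - ev g) * ∑ γ ∈ Finset.univ.filter (fun γ => γ ∈ H), ev γ = 0 := by
      rw [sub_mul, one_mul, ← this, sub_self]
    rcases mul_eq_zero.1 h2 with h3 | h3
    · exact absurd (sub_eq_zero.1 h3).symm hg1
    · exact h3

/-- the normalised non-trivial character average -/
noncomputable def rr {Γ : Type} [CommGroup Γ] (H : Subgroup Γ) (ev : Γ →* ℂ) : ℝ :=
  open Classical in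
  if (∀ γ ∈ H, ev γ = 1) then 1 else - (1 / ((Nat.card H : ℝ) - 1))

open Classical in
theorem rr_eq {Γ : Type} [CommGroup Γ] [Fintype Γ] (H : Subgroup Γ) (ev : Γ →* ℂ)
    (h2 : 2 ≤ Nat.card H) :
    (rr H ev : ℂ) = (1 / ((Nat.card H : ℂ) - 1)) *
      ∑ γ ∈ Finset.univ.filter (fun γ => γ ∈ H ∧ γ ≠ 1), ev γ := by
  have h0 : ((Nat.card H : ℂ) - 1) ≠ 0 := by
    rw [sub_ne_zero]
    exact_mod_cast (by omega : Nat.card H ≠ 1)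
  have h1 : ∑ γ ∈ Finset.univ.filter (fun γ => γ ∈ H ∧ γ ≠ 1), ev γ =
      ∑ γ ∈ Finset.univ.filter (fun γ => γ ∈ H), ev γ - 1 := by
    have : (Finset.univ.filter (fun γ => γ ∈ H ∧ γ ≠ 1)) =
        (Finset.univ.filter (fun γ => γ ∈ H)).erase 1 := by
      ext γ; simp [and_comm]
    rw [this, eq_sub_iff_add_eq]
    have h3 := Finset.sum_erase_add (Finset.univ.filter (fun γ => γ ∈ H)) (fun γ => ev γ)
      (a := 1) (by simp [H.one_mem])
    simpa using h3
  rw [h1, char_avg, rr]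
  split_ifs with h
  · push_cast
    field_simp
  · push_cast
    ring

theorem abs_sum_prod {Γ X ι : Type} [CommGroup Γ] [Fintype Γ] [Fintype ι]
    (U : Finset X) (ev : X → Γ →* ℂ) (H : ι → Subgroup Γ)
    (indep : ∀ γ : ι → Γ, (∀ i, γ i ∈ H i) → ∏ i, γ i = 1 → ∀ i, γ i = 1)
    (C : ℝ) (hC : ∀ γ : Γ, γ ≠ 1 → ‖∑ x ∈ U, ev x γ‖ ≤ C)
    (h2 : ∀ i, 2 ≤ Nat.card (H i)) (T : Finset ι) (hT : T.Nonempty) :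
    |∑ x ∈ U, ∏ i ∈ T, rr (H i) (ev x)| ≤ C := by
  classical
  let S : ι → Finset Γ := fun i =>
    if i ∈ T then Finset.univ.filter (fun γ => γ ∈ H i ∧ γ ≠ 1) else {1}
  let c : ι → ℂ := fun i => if i ∈ T then 1 / ((Nat.card (H i) : ℂ) - 1) else 1
  have hS : ∀ i, ((S i).card : ℝ) * ‖c i‖ = 1 := by
    intro i
    by_cases hi : i ∈ T
    · simp only [S, c, hi, if_true]
      have : (Finset.univ.filter (fun γ => γ ∈ H i ∧ γ ≠ 1)) =
        (Finset.univ.filter (fun γ => γ ∈ H i)).erase 1 := by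
        ext γ; simp [and_comm]
      have hcard : (Finset.univ.filter (fun γ => γ ∈ H i)).card = Nat.card (H i) := by
        rw [Nat.card_eq_fintype_card, Fintype.card_subtype]
      rw [this, Finset.card_erase_of_mem (by simp [(H i).one_mem]), hcard]
      have h3 := h2 i
      have e1 : ((Nat.card (H i) : ℂ) - 1) = ((Nat.card (H i) - 1 : ℕ) : ℂ) := by
        rw [Nat.cast_sub (by omega)]; simp
      rw [e1, norm_div, Complex.norm_natCast, norm_one]
      have : ((Nat.card (H i) - 1 : ℕ) : ℝ) ≠ 0 := by
        exact_mod_cast (by omega : Nat.card (H i) - 1 ≠ 0)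
      field_simp
    · simp [S, c, hi]
  have hterm : ∀ x, ((∏ i ∈ T, rr (H i) (ev x) : ℝ) : ℂ) =
      (∏ i, c i) * ∑ γ ∈ Fintype.piFinset S, ev x (∏ i, γ i) := by
    intro x
    have : ∀ γ : ι → Γ, ev x (∏ i, γ i) = ∏ i, ev x (γ i) := fun γ => map_prod _ _ _
    simp only [this]
    rw [← Finset.prod_univ_sum, ← Finset.prod_mul_distrib, Complex.ofReal_prod,
      ← Finset.prod_subset (Finset.subset_univ T)]
    · refine Finset.prod_congr rfl fun i hi => ?_
      rw [rr_eq _ _ (h2 i)]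
      simp only [S, c, hi, if_true]
    · intro i _ hi
      simp [S, c, hi]
  have hE : ((∑ x ∈ U, ∏ i ∈ T, rr (H i) (ev x) : ℝ) : ℂ) =
      (∏ i, c i) * ∑ γ ∈ Fintype.piFinset S, ∑ x ∈ U, ev x (∏ i, γ i) := by
    rw [Complex.ofReal_sum, Finset.sum_congr rfl (fun x _ => hterm x), ← Finset.mul_sum,
      Finset.sum_comm]
  have hn : |∑ x ∈ U, ∏ i ∈ T, rr (H i) (ev x)| =
    ‖((∑ x ∈ U, ∏ i ∈ T, rr (H i) (ev x) : ℝ) : ℂ)‖ := by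
    rw [Complex.norm_real, Real.norm_eq_abs]
  rw [hn, hE, norm_mul]
  have hb : ‖∑ γ ∈ Fintype.piFinset S, ∑ x ∈ U, ev x (∏ i, γ i)‖ ≤
      (Fintype.piFinset S).card * C := by
    refine (norm_sum_le _ _).trans ?_
    rw [← nsmul_eq_mul]
    refine Finset.sum_le_card_nsmul _ _ _ fun γ hγ => hC _ ?_
    intro h1
    rw [Fintype.mem_piFinset] at hγ
    obtain ⟨i, hi⟩ := hT
    have hm : ∀ i, γ i ∈ H i := by
      intro j
      have := hγ j
      by_cases hj : j ∈ T
      · simp only [S, hj, if_true, Finset.mem_filter] at this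
        exact this.2.1
      · simp only [S, hj, if_false, Finset.mem_singleton] at this
        rw [this]; exact (H j).one_mem
    have h3 := indep γ hm h1 i
    have := hγ i
    simp only [S, hi, if_true, Finset.mem_filter] at this
    exact this.2.2 h3
  refine (mul_le_mul_of_nonneg_left hb (norm_nonneg _)).trans (le_of_eq ?_)
  rw [Fintype.card_piFinset, Nat.cast_prod, norm_prod, ← mul_assoc, ← Finset.prod_mul_distrib]
  rw [Finset.prod_congr rfl (fun i _ => (mul_comm _ _).trans (hS i))]
  simp

theorem sieve {Γ X ι : Type} [CommGroup Γ] [Fintype Γ] [Fintype ι] [DecidableEq ι]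
    (U : Finset X) (ev : X → Γ →* ℂ) (H : ι → Subgroup Γ)
    (indep : ∀ γ : ι → Γ, (∀ i, γ i ∈ H i) → ∏ i, γ i = 1 → ∀ i, γ i = 1)
    (C : ℝ) (hC0 : 0 ≤ C) (hC : ∀ γ : Γ, γ ≠ 1 → ‖∑ x ∈ U, ev x γ‖ ≤ C)
    (N : ι → ℕ) (hN2 : ∀ i, 2 ≤ N i) (hN : ∀ i, N i ≤ Nat.card (H i))
    (A B : Finset ι) (hAB : ∀ i, i ∈ A ∨ i ∈ B) (hd : Disjoint A B) (δ : ℝ)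
    (hδ : δ ≤ 1 - ∑ i ∈ B, 1 / (N i : ℝ)) (hδ0 : 0 < δ)
    (a t u : ℕ) (ht : 1 ≤ t) (hAa : A.card ≤ a) (hBt : B.card ≤ t) (hUu : u ≤ U.card)
    (hmain' : C * 2 ^ a * (2 * δ + t - 1) < δ * (u + C)) :
    ∃ x ∈ U, ∀ i, ∃ γ ∈ H i, ev x γ ≠ 1 := by
  classical
  have hmain : C * 2 ^ A.card * (2 * δ + t - 1) < δ * (U.card + C) := by
    have h1 : (1 : ℝ) ≤ t := by exact_mod_cast ht
    have h2 : (u : ℝ) ≤ U.card := by exact_mod_cast hUu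
    refine lt_of_le_of_lt ?_ (hmain'.trans_le ?_)
    · have : (0:ℝ) ≤ 2 * δ + t - 1 := by linarith
      gcongr
      norm_num
    · gcongr
  clear hmain' hUu u
  by_contra hno
  push Not at hno
  have h2 : ∀ i, 2 ≤ Nat.card (H i) := fun i => (hN2 i).trans (hN i)
  have hE := abs_sum_prod U ev H indep C hC h2
  -- theta
  obtain ⟨θ, hθ⟩ : ∃ θ : ι → ℝ, ∀ i, θ i = 1 - 1 / (Nat.card (H i) : ℝ) := ⟨_, fun _ => rfl⟩
  have hθpos : ∀ i, 0 < θ i := by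
    intro i
    rw [hθ, sub_pos, div_lt_one (by have := h2 i; positivity)]
    exact_mod_cast h2 i
  have hθle : ∀ i, 1 - 1 / (N i : ℝ) ≤ θ i := by
    intro i
    rw [hθ]
    have : 1 / (Nat.card (H i) : ℝ) ≤ 1 / (N i : ℝ) := by
      have := hN i
      have := hN2 i
      gcongr
    linarith
  have hg : ∀ i x, (if (∀ γ ∈ H i, ev x γ = 1) then (0 : ℝ) else 1) =
      θ i * (1 - rr (H i) (ev x)) := by
    intro i x
    have h3 := h2 i
    have h4 : (Nat.card (H i) : ℝ) ≠ 0 := by exact_mod_cast (by omega : Nat.card (H i) ≠ 0)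
    have h5 : (Nat.card (H i) : ℝ) - 1 ≠ 0 := by
      rw [sub_ne_zero]; exact_mod_cast (by omega : Nat.card (H i) ≠ 1)
    rw [hθ, rr]
    split_ifs with h
    · simp
    · field_simp
      ring
  obtain ⟨M, hM⟩ : ∃ M : ℝ, M = ∑ x ∈ U, ∏ j ∈ A, (1 - rr (H j) (ev x)) := ⟨_, rfl⟩
  obtain ⟨D, hD⟩ : ∃ D : ι → ℝ, ∀ i, D i =
    ∑ x ∈ U, rr (H i) (ev x) * ∏ j ∈ A, (1 - rr (H j) (ev x)) := ⟨_, fun _ => rfl⟩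
  have hexp : ∀ x, ∏ j ∈ A, (1 - rr (H j) (ev x)) =
      ∑ T ∈ A.powerset, (-1) ^ T.card * ∏ j ∈ T, rr (H j) (ev x) := by
    intro x
    have := Finset.prod_add (fun j => - rr (H j) (ev x)) (fun _ => (1 : ℝ)) A
    simp only [neg_add_eq_sub, Finset.prod_const_one, mul_one] at this
    rw [this]
    refine Finset.sum_congr rfl fun T _ => ?_
    rw [Finset.prod_neg]
  have hMb : (U.card : ℝ) - C * (2 ^ A.card - 1) ≤ M := by
    have h3 : M = U.card + ∑ T ∈ A.powerset.erase ∅,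
        (-1) ^ T.card * ∑ x ∈ U, ∏ j ∈ T, rr (H j) (ev x) := by
      rw [hM, Finset.sum_congr rfl (fun x _ => hexp x), Finset.sum_comm]
      simp only [← Finset.mul_sum]
      rw [← Finset.add_sum_erase _ _ (Finset.empty_mem_powerset A)]
      simp
    have h4 : |∑ T ∈ A.powerset.erase ∅,
        (-1 : ℝ) ^ T.card * ∑ x ∈ U, ∏ j ∈ T, rr (H j) (ev x)| ≤ (A.powerset.erase ∅).card * C := by
      refine (Finset.abs_sum_le_sum_abs _ _).trans ?_
      rw [← nsmul_eq_mul]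
      refine Finset.sum_le_card_nsmul _ _ _ fun T hT => ?_
      rw [abs_mul, abs_pow, abs_neg, abs_one, one_pow, one_mul]
      exact hE T (Finset.nonempty_iff_ne_empty.2 (Finset.ne_of_mem_erase hT))
    rw [Finset.card_erase_of_mem (Finset.empty_mem_powerset A), Finset.card_powerset,
      Nat.cast_sub Nat.one_le_two_pow] at h4
    push_cast at h4
    have := (abs_le.1 h4).1
    rw [h3]
    linarith
  have hDb : ∀ i ∈ B, D i ≤ C * 2 ^ A.card := by
    intro i hi
    have hiA : i ∉ A := fun h => Finset.disjoint_left.1 hd h hi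
    have h3 : D i = ∑ T ∈ A.powerset,
        (-1) ^ T.card * ∑ x ∈ U, ∏ j ∈ insert i T, rr (H j) (ev x) := by
      rw [hD]
      have : ∀ x ∈ U, rr (H i) (ev x) * ∏ j ∈ A, (1 - rr (H j) (ev x)) =
          ∑ T ∈ A.powerset, (-1) ^ T.card * ∏ j ∈ insert i T, rr (H j) (ev x) := by
        intro x _
        rw [hexp, Finset.mul_sum]
        refine Finset.sum_congr rfl fun T hT => ?_
        rw [Finset.prod_insert (fun h => hiA (Finset.mem_powerset.1 hT h))]
        ring
      rw [Finset.sum_congr rfl this, Finset.sum_comm]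
      simp only [← Finset.mul_sum]
    have h4 : |D i| ≤ A.powerset.card * C := by
      rw [h3]
      refine (Finset.abs_sum_le_sum_abs _ _).trans ?_
      rw [← nsmul_eq_mul]
      refine Finset.sum_le_card_nsmul _ _ _ fun T hT => ?_
      rw [abs_mul, abs_pow, abs_neg, abs_one, one_pow, one_mul]
      exact hE _ (Finset.insert_nonempty _ _)
    rw [Finset.card_powerset] at h4
    push_cast at h4
    have := le_abs_self (D i)
    linarith
  -- pointwise
  have hpt : ∀ x ∈ U, ∑ i ∈ B, θ i * (1 - rr (H i) (ev x)) * ∏ j ∈ A, (1 - rr (H j) (ev x)) ≤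
      (B.card - 1) * ∏ j ∈ A, (1 - rr (H j) (ev x)) := by
    intro x hx
    obtain ⟨i, hi⟩ := hno x hx
    rw [← Finset.sum_mul]
    have hri : 1 - rr (H i) (ev x) = 0 := by
      rw [rr, if_pos hi, sub_self]
    have hnn : ∀ j, 0 ≤ 1 - rr (H j) (ev x) := by
      intro j
      have := hg j x
      have h3 : 0 ≤ θ j * (1 - rr (H j) (ev x)) := by rw [← this]; split_ifs <;> norm_num
      exact nonneg_of_mul_nonneg_right h3 (hθpos j)
    rcases hAB i with hA | hB
    · rw [Finset.prod_eq_zero hA hri]; simp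
    · refine mul_le_mul_of_nonneg_right ?_ (Finset.prod_nonneg fun j _ => hnn j)
      rw [← Finset.add_sum_erase _ _ hB, hri, mul_zero, zero_add]
      have : ∀ j ∈ B.erase i, θ j * (1 - rr (H j) (ev x)) ≤ 1 := by
        intro j _
        rw [← hg]; split_ifs <;> norm_num
      refine (Finset.sum_le_card_nsmul _ _ _ this).trans ?_
      rw [Finset.card_erase_of_mem hB, nsmul_eq_mul, mul_one,
        Nat.cast_sub (Finset.card_pos.2 ⟨i, hB⟩)]
      simp
  have hsum : ∑ i ∈ B, θ i * (M - D i) ≤ (B.card - 1) * M := by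
    have := Finset.sum_le_sum hpt
    rw [← Finset.mul_sum, ← hM, Finset.sum_comm] at this
    refine le_trans (le_of_eq ?_) this
    refine Finset.sum_congr rfl fun i _ => ?_
    rw [hM, hD, ← Finset.sum_sub_distrib, Finset.mul_sum]
    refine Finset.sum_congr rfl fun x _ => ?_
    ring
  have hs2 : ∑ i ∈ B, θ i * (M - C * 2 ^ A.card) ≤ (B.card - 1) * M := by
    refine le_trans (Finset.sum_le_sum fun i hi => ?_) hsum
    have := hDb i hi
    have := hθpos i
    gcongr
  rw [← Finset.sum_mul] at hs2
  obtain ⟨S, hS⟩ : ∃ S : ℝ, S = ∑ i ∈ B, θ i := ⟨_, rfl⟩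
  rw [← hS] at hs2
  have hSl : (B.card : ℝ) - 1 + δ ≤ S := by
    have h3 : ∑ i ∈ B, (1 - 1 / (N i : ℝ)) ≤ S := by
      rw [hS]; exact Finset.sum_le_sum fun i _ => hθle i
    rw [Finset.sum_sub_distrib] at h3
    simp only [Finset.sum_const, nsmul_eq_mul, mul_one] at h3
    linarith
  have hSu : S ≤ B.card := by
    rw [hS]
    have : ∀ i ∈ B, θ i ≤ 1 := by
      intro i _
      rw [hθ]
      have : 0 ≤ 1 / (Nat.card (H i) : ℝ) := by positivity
      linarith
    have := Finset.sum_le_card_nsmul _ _ _ this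
    simpa using this
  obtain ⟨W, hW⟩ : ∃ W : ℝ, W = 2 ^ A.card := ⟨_, rfl⟩
  have hW1 : 1 ≤ W := by rw [hW]; exact one_le_pow₀ (by norm_num)
  rw [← hW] at hs2 hMb hmain
  obtain ⟨u, hu⟩ : ∃ u : ℝ, u = U.card := ⟨_, rfl⟩
  rw [← hu] at hMb hmain
  have hu0 : 0 ≤ u := by rw [hu]; positivity
  have ht1 : (1 : ℝ) ≤ t := by exact_mod_cast ht
  have hbt : (B.card : ℝ) ≤ t := by exact_mod_cast hBt
  obtain ⟨b, hbb⟩ : ∃ b : ℝ, b = B.card := ⟨_, rfl⟩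
  rw [← hbb] at hs2 hSl hSu hbt
  obtain ⟨d, hd'⟩ : ∃ d : ℝ, d = S - (b - 1) := ⟨_, rfl⟩
  have hdδ : δ ≤ d := by linarith
  have h3 : d * M ≤ (d + b - 1) * (C * W) := by rw [hd']; linarith
  have h4 : d * (u - C * (W - 1)) ≤ (d + b - 1) * (C * W) := by
    refine le_trans ?_ h3
    have : 0 ≤ d := by linarith
    gcongr
  have hCW : 0 ≤ C * W := by positivity
  have h5 : (t - 1) * (C * W) < δ * (u + C - 2 * (C * W)) := by nlinarith
  have h6 : 0 < u + C - 2 * (C * W) := by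
    by_contra hneg
    push Not at hneg
    have : 0 ≤ ((t:ℝ) - 1) * (C * W) := mul_nonneg (by linarith) hCW
    nlinarith
  have h7 : δ * (u + C - 2 * (C * W)) ≤ d * (u + C - 2 * (C * W)) := by gcongr
  have h8 : b * (C * W) ≤ t * (C * W) := by gcongr
  nlinarith
end Stp

namespace Stp
open Polynomial

noncomputable def frobL (K L : Type) [Field K] [Fintype K] [Field L] [Algebra K L] : L →ₗ[K] L :=
  (FiniteField.frobeniusAlgHom K L).toLinearMap

theorem frobL_pow_apply (K L : Type) [Field K] [Fintype K] [Field L] [Algebra K L] (i : ℕ) (x : L) :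
    (frobL K L ^ i) x = x ^ Fintype.card K ^ i := by
  induction i with
  | zero => simp
  | succ i ih =>
    rw [pow_succ', Module.End.mul_apply, ih, pow_succ, pow_mul]
    rfl

def annG {K L : Type} [Field K] [Field L] [Algebra K L] (V : Submodule K L) :
    Subgroup (AddChar L ℂ) where
  carrier := {ψ | ∀ v ∈ V, ψ v = 1}
  mul_mem' := by
    intro a b ha hb v hv
    rw [AddChar.mul_apply, ha v hv, hb v hv, one_mul]
  one_mem' := by
    intro v _
    rw [AddChar.one_apply]
  inv_mem' := by
    intro a ha v hv
    rw [AddChar.inv_apply]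
    exact ha _ (V.neg_mem hv)

theorem card_annG {K L : Type} [Field K] [Field L] [Fintype L] [Algebra K L] (V : Submodule K L) :
    Nat.card (L ⧸ V) ≤ Nat.card (annG V) := by
  classical
  haveI : Fintype (L ⧸ V) := Fintype.ofFinite _
  rw [Nat.card_eq_fintype_card, ← AddChar.card_eq, ← Nat.card_eq_fintype_card]
  refine Nat.card_le_card_of_injective
    (fun ψ => ⟨ψ.compAddMonoidHom (V.mkQ.toAddMonoidHom), ?_⟩) ?_
  · intro v hv
    have : V.mkQ v = 0 := by simpa using hv
    rw [AddChar.compAddMonoidHom_apply]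
    have h2 : V.mkQ.toAddMonoidHom v = 0 := this
    rw [h2, AddChar.map_zero_eq_one]
  · intro a b hab
    have h1 := Subtype.ext_iff.1 hab
    ext y
    obtain ⟨x, rfl⟩ := V.mkQ_surjective y
    have := congrArg (fun ψ : AddChar L ℂ => ψ x) h1
    exact this

variable {K L : Type} [Field K] [Fintype K] [Field L] [Fintype L] [Algebra K L]

theorem card_quot (P c : K[X]) (hP : Irreducible P) (h : P * c = X ^ Module.finrank K L - 1) :
    Fintype.card K ^ P.natDegree ≤ Nat.card (L ⧸ LinearMap.ker (aeval (frobL K L) c)) := by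
  classical
  have hmin : minpoly K (frobL K L) = X ^ Module.finrank K L - 1 :=
    FiniteField.minpoly_frobeniusAlgHom K L
  have hfr : 0 < Module.finrank K L := Module.finrank_pos
  have hne : (X ^ Module.finrank K L - 1 : K[X]) ≠ 0 := X_pow_sub_C_ne_zero hfr 1
  have hc : aeval (frobL K L) c ≠ 0 := by
    intro h0
    have h1 := minpoly.dvd K _ h0
    rw [hmin, ← h] at h1
    have hc0 : c ≠ 0 := by rintro rfl; rw [mul_zero] at h; exact hne h.symm
    have := natDegree_le_of_dvd h1 hc0
    rw [natDegree_mul hP.ne_zero hc0] at this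
    have := hP.natDegree_pos
    omega
  obtain ⟨x, hx⟩ : ∃ x, aeval (frobL K L) c x ≠ 0 := by
    by_contra hcon
    push Not at hcon
    exact hc (LinearMap.ext hcon)
  have hk : aeval (frobL K L) P (aeval (frobL K L) c x) = 0 := by
    rw [← Module.End.mul_apply, ← map_mul, h, ← hmin, minpoly.aeval]
    rfl
  have hcard : Nat.card (degreeLT K P.natDegree) = Fintype.card K ^ P.natDegree := by
    rw [Nat.card_congr (degreeLTEquiv K P.natDegree).toEquiv, Nat.card_fun]
    simp
  rw [← hcard]
  refine Nat.card_le_card_of_injective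
    (fun u => Submodule.Quotient.mk (aeval (frobL K L) (u : K[X]) x)) ?_
  intro u v huv
  have h1 := (Submodule.Quotient.eq _).1 huv
  rw [LinearMap.mem_ker, ← LinearMap.sub_apply, ← map_sub, ← Module.End.mul_apply, ← map_mul,
    mul_comm, map_mul, Module.End.mul_apply] at h1
  by_contra hne2
  have hw : ((u : K[X]) - v) ≠ 0 := fun h => hne2 (Subtype.ext (sub_eq_zero.1 h))
  have hwd : ((u : K[X]) - v) ∈ degreeLT K P.natDegree := Submodule.sub_mem _ u.2 v.2
  rw [mem_degreeLT] at hwd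
  have hcop : IsCoprime P ((u : K[X]) - v) := by
    rw [hP.coprime_iff_not_dvd]
    intro hd
    have := degree_le_of_dvd hd hw
    rw [degree_eq_natDegree hP.ne_zero] at this
    exact absurd hwd (not_lt.2 this)
  obtain ⟨a, b, hab⟩ := hcop
  have h3 : aeval (frobL K L) (a * P + b * ((u : K[X]) - (v : K[X]))) (aeval (frobL K L) c x) = 0 := by
    rw [map_add, LinearMap.add_apply, map_mul, map_mul, Module.End.mul_apply, Module.End.mul_apply,
      hk, h1]
    simp
  rw [hab] at h3
  simp at h3
  exact hx h3

theorem normal_of (n : ℕ) (hn : n = Module.finrank K L) (α : L)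
    (hα : ∀ P c : K[X], P.Monic → Irreducible P → P * c = X ^ n - 1 → aeval (frobL K L) c α ≠ 0) :
    IsNormalElem K n α := by
  classical
  have hmin : minpoly K (frobL K L) = X ^ Module.finrank K L - 1 :=
    FiniteField.minpoly_frobeniusAlgHom K L
  have hn0 : 0 < n := by rw [hn]; exact Module.finrank_pos
  have hne : (X ^ n - 1 : K[X]) ≠ 0 := X_pow_sub_C_ne_zero hn0 1
  have hdeg : (X ^ n - 1 : K[X]).natDegree = n := natDegree_X_pow_sub_C (r := (1:K))
  have hkill : aeval (frobL K L) (X ^ n - 1 : K[X]) α = 0 := by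
    rw [hn, ← hmin, minpoly.aeval]; rfl
  -- any annihilating polynomial of degree < n vanishes
  have key : ∀ u : K[X], u.degree < n → aeval (frobL K L) u α = 0 → u = 0 := by
    intro u hud hu
    by_contra hu0
    obtain ⟨d, hd⟩ : ∃ d, d = EuclideanDomain.gcd u (X ^ n - 1 : K[X]) := ⟨_, rfl⟩
    have hdk : aeval (frobL K L) d α = 0 := by
      rw [hd, EuclideanDomain.gcd_eq_gcd_ab, map_add, LinearMap.add_apply, mul_comm u,
        mul_comm (X ^ n - 1 : K[X]), map_mul, map_mul, Module.End.mul_apply, Module.End.mul_apply,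
        hu, hkill]
      simp
    have hdu : d ∣ u := hd ▸ EuclideanDomain.gcd_dvd_left _ _
    obtain ⟨e, he⟩ : d ∣ (X ^ n - 1 : K[X]) := hd ▸ EuclideanDomain.gcd_dvd_right _ _
    have hd0 : d ≠ 0 := by rintro rfl; rw [zero_mul] at he; exact hne he
    have he0 : e ≠ 0 := by rintro rfl; rw [mul_zero] at he; exact hne he
    have hdn : d.natDegree < n := by
      have h1 := degree_le_of_dvd hdu hu0
      have h2 := lt_of_le_of_lt h1 hud
      rw [degree_eq_natDegree hd0] at h2
      exact_mod_cast h2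
    have hen : e.degree ≠ 0 := by
      intro h0
      have h3 : e.natDegree = 0 := natDegree_eq_of_degree_eq_some h0
      have h4 := congrArg natDegree he
      rw [natDegree_mul hd0 he0, hdeg] at h4
      omega
    obtain ⟨P, hPm, hPi, r, hr⟩ := exists_monic_irreducible_factor e
      (fun hu => hen (degree_eq_zero_of_isUnit hu))
    refine hα P (d * r) hPm hPi (by rw [he, hr]; ring) ?_
    rw [mul_comm, map_mul, Module.End.mul_apply, hdk, map_zero]
  have hli : LinearIndependent K (fun i : Fin n => α ^ Fintype.card K ^ (i : ℕ)) := by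
    rw [Fintype.linearIndependent_iff]
    intro g hg i
    have h1 : (∑ i : Fin n, C (g i) * X ^ (i : ℕ) : K[X]) = 0 := by
      refine key _ ?_ ?_
      · refine lt_of_le_of_lt (degree_sum_le _ _) ?_
        rw [Finset.sup_lt_iff (by exact_mod_cast WithBot.bot_lt_coe n)]
        intro j _
        refine lt_of_le_of_lt (degree_C_mul_X_pow_le _ _) ?_
        exact_mod_cast j.2
      · rw [map_sum, LinearMap.sum_apply, ← hg]
        refine Finset.sum_congr rfl fun j _ => ?_
        rw [map_mul, Module.End.mul_apply, aeval_X_pow, frobL_pow_apply, aeval_C]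
        rfl
    have h2 := congrArg (fun p => coeff p (i : ℕ)) h1
    simp only [finsetSum_coeff, coeff_C_mul, coeff_X_pow, coeff_zero] at h2
    rw [Finset.sum_eq_single i] at h2
    · simpa using h2
    · intro b _ hb
      rw [if_neg, mul_zero]
      intro h; exact hb (Fin.ext h.symm)
    · simp
  refine ⟨hli, ?_⟩
  haveI : Nonempty (Fin n) := ⟨⟨0, hn0⟩⟩
  exact hli.span_eq_top_of_card_eq_finrank (by simp [hn])

theorem indep_add {ι : Type} [Fintype ι] (n : ℕ) (hn : n = Module.finrank K L) (P c : ι → K[X])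
    (hPc : ∀ i, P i * c i = X ^ n - 1) (hcop : ∀ i j, i ≠ j → IsCoprime (P i) (P j))
    (ψ : ι → AddChar L ℂ) (hψ : ∀ i, ψ i ∈ annG (LinearMap.ker (aeval (frobL K L) (c i))))
    (h1 : ∏ i, ψ i = 1) (i : ι) : ψ i = 1 := by
  classical
  have hmin : minpoly K (frobL K L) = X ^ Module.finrank K L - 1 :=
    FiniteField.minpoly_frobeniusAlgHom K L
  have hr : ∀ j (y : L), ψ j (aeval (frobL K L) (P j) y) = 1 := by
    intro j y
    refine hψ j _ ?_
    rw [LinearMap.mem_ker, ← Module.End.mul_apply, ← map_mul, mul_comm, hPc, hn, ← hmin,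
      minpoly.aeval]
    rfl
  have hc2 : IsCoprime (∏ j ∈ Finset.univ.erase i, P j) (P i) := by
    refine IsCoprime.prod_left fun j hj => hcop j i (Finset.ne_of_mem_erase hj)
  obtain ⟨a, b, hab⟩ := hc2
  ext y
  have hy : y = aeval (frobL K L) (∏ j ∈ Finset.univ.erase i, P j) (aeval (frobL K L) a y) +
      aeval (frobL K L) (P i) (aeval (frobL K L) b y) := by
    rw [← Module.End.mul_apply, ← Module.End.mul_apply, ← map_mul, ← map_mul,
      ← LinearMap.add_apply, ← map_add, mul_comm _ a, mul_comm _ b, hab]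
    simp
  obtain ⟨z, hz⟩ : ∃ z, z = aeval (frobL K L) (∏ j ∈ Finset.univ.erase i, P j)
    (aeval (frobL K L) a y) := ⟨_, rfl⟩
  rw [hy, AddChar.map_add_eq_mul, hr, mul_one, AddChar.one_apply, ← hz]
  have h2 : (∏ j, ψ j) z = 1 := by rw [h1, AddChar.one_apply]
  rw [AddChar.prod_apply, ← Finset.mul_prod_erase _ _ (Finset.mem_univ i)] at h2
  rw [Finset.prod_eq_one, mul_one] at h2
  · exact h2
  · intro j hj
    rw [hz, ← Finset.mul_prod_erase _ _ hj, map_mul, Module.End.mul_apply]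
    exact hr j _

end Stp

namespace Stp
open Polynomial

theorem indep_pow {G ι : Type} [CommGroup G] [Fintype ι] (p : ι → ℕ)
    (hcop : ∀ i j, i ≠ j → Nat.Coprime (p i) (p j)) (χ : ι → G) (hχ : ∀ i, χ i ^ p i = 1)
    (h1 : ∏ i, χ i = 1) (i : ι) : χ i = 1 := by
  classical
  have h2 : χ i ^ (∏ j ∈ Finset.univ.erase i, p j) = 1 := by
    have h3 : (∏ j, χ j) ^ (∏ j ∈ Finset.univ.erase i, p j) = 1 := by rw [h1, one_pow]
    rw [← Finset.prod_pow, ← Finset.mul_prod_erase _ _ (Finset.mem_univ i)] at h3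
    rw [Finset.prod_eq_one (s := Finset.univ.erase i) (f := fun x => χ x ^ _), mul_one] at h3
    · exact h3
    · intro j hj
      rw [← Finset.mul_prod_erase _ _ hj, pow_mul, hχ, one_pow]
  have hc : Nat.Coprime (∏ j ∈ Finset.univ.erase i, p j) (p i) :=
    Nat.Coprime.prod_left fun j hj => hcop j i (Finset.ne_of_mem_erase hj)
  rw [← orderOf_eq_one_iff, ← Nat.dvd_one, ← hc]
  exact Nat.dvd_gcd (orderOf_dvd_of_pow_eq_one h2) (orderOf_dvd_of_pow_eq_one (hχ i))

def powG (G : Type) [CommGroup G] (p : ℕ) : Subgroup G := (powMonoidHom p : G →* G).ker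

theorem mem_powG {G : Type} [CommGroup G] (p : ℕ) (x : G) : x ∈ powG G p ↔ x ^ p = 1 := Iff.rfl

theorem card_powG (L : Type) [Field L] [Fintype L] (p : ℕ) (hp : p ∣ Fintype.card L - 1) :
    p ≤ Nat.card (powG (MulChar L ℂ) p) := by
  classical
  haveI : Finite (MulChar L ℂ) := inferInstance
  have hN : Fintype.card L - 1 ≠ 0 := by have := Fintype.one_lt_card (α := L); omega
  have hp0 : p ≠ 0 := by rintro rfl; exact hN (Nat.eq_zero_of_zero_dvd hp)
  obtain ⟨ω, hω⟩ := MulChar.exists_mulChar_orderOf L hp (Complex.isPrimitiveRoot_exp _ hp0)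
  have h1 : Subgroup.zpowers ω ≤ powG (MulChar L ℂ) p := by
    rw [Subgroup.zpowers_le, mem_powG, ← hω, pow_orderOf_eq_one]
  have h2 := Nat.le_of_dvd Nat.card_pos (Subgroup.card_dvd_of_le h1)
  rwa [Nat.card_zpowers, hω] at h2

open Classical in
theorem sum_three {α β : Type} (S : Finset α) (T : Finset β)
    (c1 c2 : α → Prop) (cp : β → Prop)
    (w1 w2 : α → ℝ) (w3 : β → ℝ) :
    ∑ i ∈ (Finset.univ : Finset (S ⊕ (S ⊕ T))).filter (fun i : S ⊕ (S ⊕ T) =>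
        Sum.elim (fun p : S => c1 p) (Sum.elim (fun p : S => c2 p) (fun P : T => cp P)) i),
      Sum.elim (fun p : S => w1 p) (Sum.elim (fun p : S => w2 p) (fun P : T => w3 P)) i =
    ∑ p ∈ S.filter c1, w1 p + (∑ p ∈ S.filter c2, w2 p + ∑ P ∈ T.filter cp, w3 P) := by
  have e : ∀ i : S ⊕ (S ⊕ T), (if Sum.elim (fun p : S => c1 p) (Sum.elim (fun p : S => c2 p)
      (fun P : T => cp P)) i then Sum.elim (fun p : S => w1 p) (Sum.elim (fun p : S => w2 p)
      (fun P : T => w3 P)) i else 0) = Sum.elim (fun p : S => if c1 p then w1 p else 0)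
      (Sum.elim (fun p : S => if c2 p then w2 p else 0) (fun P : T => if cp P then w3 P else 0)) i := by
    rintro (p | p | p)
    · by_cases h : c1 p <;> simp [h]
    · by_cases h : c2 p <;> simp [h]
    · by_cases h : cp p <;> simp [h]
  rw [Finset.sum_filter, Finset.sum_congr rfl (fun i _ => e i), Fintype.sum_sum_type,
    Fintype.sum_sum_type]
  simp only [Sum.elim_inl, Sum.elim_inr]
  rw [Finset.sum_filter, Finset.sum_filter, Finset.sum_filter]
  rw [← Finset.sum_coe_sort S, ← Finset.sum_coe_sort S, ← Finset.sum_coe_sort T]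

open Classical in
theorem card_three {α β : Type} (S : Finset α) (T : Finset β)
    (c1 c2 : α → Prop) (cp : β → Prop) :
    ((Finset.univ : Finset (S ⊕ (S ⊕ T))).filter (fun i : S ⊕ (S ⊕ T) =>
        Sum.elim (fun p : S => c1 p) (Sum.elim (fun p : S => c2 p) (fun P : T => cp P)) i)).card =
    (S.filter c1).card + ((S.filter c2).card + (T.filter cp).card) := by
  have h := sum_three S T c1 c2 cp (fun _ => 1) (fun _ => 1) (fun _ => 1)
  have e : ∀ i : S ⊕ (S ⊕ T), Sum.elim (fun p : S => (1:ℝ)) (Sum.elim (fun p : S => (1:ℝ))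
    (fun P : T => (1:ℝ))) i = 1 := by
    rintro (a | a | a) <;> rfl
  simp only [e] at h
  simp only [Finset.sum_const, nsmul_eq_mul, mul_one] at h
  exact_mod_cast h

open Classical in
/-- monic irreducible factors of `X^n-1` -/
noncomputable def PP (K : Type) [Field K] (n : ℕ) : Finset K[X] :=
  (UniqueFactorizationMonoid.normalizedFactors (X ^ n - 1 : K[X])).toFinset

theorem mem_PP {K : Type} [Field K] {n : ℕ} (hn : 0 < n) {P : K[X]} :
    P ∈ PP K n ↔ P.Monic ∧ Irreducible P ∧ P ∣ X ^ n - 1 := by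
  classical
  have hne : (X ^ n - 1 : K[X]) ≠ 0 := X_pow_sub_C_ne_zero hn 1
  rw [PP, Multiset.mem_toFinset, Polynomial.mem_normalizedFactors_iff hne]
  tauto


noncomputable def evX {L : Type} [Field L] (x z : L) (hx : x ≠ 0) (hz : z ≠ 0) :
    (MulChar L ℂ × MulChar L ℂ × AddChar L ℂ) →* ℂ where
  toFun γ := γ.1 x * γ.2.1 z * γ.2.2 x
  map_one' := by
    have h1 : (1 : MulChar L ℂ) x = 1 := MulChar.one_apply (Ne.isUnit hx)
    have h2 : (1 : MulChar L ℂ) z = 1 := MulChar.one_apply (Ne.isUnit hz)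
    simp [h1, h2]
  map_mul' := by
    intro a b
    simp only [Prod.fst_mul, Prod.snd_mul, MulChar.mul_apply, AddChar.mul_apply]
    ring

theorem not_pow {L : Type} [Field L] (x : L) (hx : x ≠ 0) (p : ℕ) (hp : p ≠ 0) (χ : MulChar L ℂ)
    (hχ : χ ^ p = 1) (h : χ x ≠ 1) : ¬ ∃ y, y ^ p = x := by
  rintro ⟨y, rfl⟩
  apply h
  rw [map_pow, ← MulChar.pow_apply' _ hp, hχ]
  exact MulChar.one_apply (Ne.isUnit (fun h0 => hx (by rw [h0, zero_pow hp])))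

open Classical in
theorem crit (K L : Type) [Field K] [Fintype K] [Field L] [Fintype L] [Algebra K L] (n : ℕ)
    (hn : 0 < n) (hK : Fintype.card K = 4) (hL : Fintype.card L = 4 ^ n)
    (f1 f2 g : L[X]) (k : ℕ) (h0 : f1 * f2 ≠ 0) (hcop : IsCoprime f1 f2)
    (hi : Irreducible g) (hgX : g ≠ X) (hgm : g.Monic) (h1 : g ^ k ∣ f1 * f2)
    (h2 : ¬ g ^ (k + 1) ∣ f1 * f2) (hk : Nat.gcd k (Fintype.card L - 1) = 1)
    (hdeg : f1.natDegree + f2.natDegree ≤ 5)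
    (c1 c2 : ℕ → Prop) (cp : K[X] → Prop) (a t : ℕ) (δ : ℝ) (ht : 1 ≤ t) (hδ0 : 0 < δ)
    (ha : ((4 ^ n - 1).primeFactors.filter c1).card + (((4 ^ n - 1).primeFactors.filter c2).card +
      ((PP K n).filter cp).card) ≤ a)
    (hb : ((4 ^ n - 1).primeFactors.filter (fun p => ¬ c1 p)).card +
      (((4 ^ n - 1).primeFactors.filter (fun p => ¬ c2 p)).card +
      ((PP K n).filter (fun P => ¬ cp P)).card) ≤ t)
    (hδ : δ ≤ 1 - (∑ p ∈ (4 ^ n - 1).primeFactors.filter (fun p : ℕ => ¬ c1 p), 1 / ((p : ℕ) : ℝ) +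
      (∑ p ∈ (4 ^ n - 1).primeFactors.filter (fun p : ℕ => ¬ c2 p), 1 / ((p : ℕ) : ℝ) +
      ∑ P ∈ (PP K n).filter (fun P => ¬ cp P), 1 / (4 : ℝ) ^ P.natDegree)))
    (hmain : 6 * 2 ^ n * 2 ^ a * (2 * δ + t - 1) < δ * (4 ^ n - 6 + 6 * 2 ^ n)) :
    ∃ α : L, α ≠ 0 ∧ f1.eval α ≠ 0 ∧ f2.eval α ≠ 0 ∧
      (∀ p ∈ (4 ^ n - 1).primeFactors, (¬ ∃ y, y ^ p = α) ∧
        ¬ ∃ y, y ^ p = f1.eval α / f2.eval α) ∧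
      (∀ P c : K[X], P.Monic → Irreducible P → P * c = X ^ n - 1 →
        aeval (frobL K L) c α ≠ 0) := by
  have hfin : n = Module.finrank K L := by
    have := Module.card_eq_pow_finrank (K := K) (V := L)
    rw [hK, hL] at this
    exact Nat.pow_right_injective (le_refl 2) (Nat.pow_left_injective two_ne_zero (by
      simp only [← pow_mul, mul_comm _ 2]
      rw [pow_mul, pow_mul]; exact this))
  have hL2 : Fintype.card L = 2 ^ (2 * n) := by rw [hL, pow_mul]; norm_num
  haveI hchar : CharP L 2 := by
    refine charP_of_card_eq_prime_pow (R := L) (p := 2) (f := 2 * n) hL2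
  obtain ⟨S, hS⟩ : ∃ S, S = (4 ^ n - 1).primeFactors := ⟨_, rfl⟩
  obtain ⟨T, hT⟩ : ∃ T, T = PP K n := ⟨_, rfl⟩
  rw [← hS, ← hT] at ha hb hδ
  rw [← hS]
  have hTm : ∀ P : T, (P : K[X]).Monic ∧ Irreducible (P : K[X]) ∧ (P : K[X]) ∣ X ^ n - 1 := by
    intro P
    exact (mem_PP hn).1 (hT ▸ P.2)
  choose c hc using fun P : T => (hTm P).2.2
  let XX := {x : L // x ≠ 0 ∧ f1.eval x ≠ 0 ∧ f2.eval x ≠ 0}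
  haveI : Fintype (MulChar L ℂ × MulChar L ℂ × AddChar L ℂ) := Fintype.ofFinite _
  let ev : XX → (MulChar L ℂ × MulChar L ℂ × AddChar L ℂ) →* ℂ := fun x => evX x.1 (f1.eval x.1 / f2.eval x.1) x.2.1
    (div_ne_zero x.2.2.1 x.2.2.2)
  let H : (S ⊕ (S ⊕ T)) → Subgroup (MulChar L ℂ × MulChar L ℂ × AddChar L ℂ) := fun i => match i with
    | Sum.inl p => (powG (MulChar L ℂ) p).prod (Subgroup.prod ⊥ ⊥)
    | Sum.inr (Sum.inl p) => Subgroup.prod ⊥ ((powG (MulChar L ℂ) p).prod ⊥)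
    | Sum.inr (Sum.inr P) => Subgroup.prod ⊥ (Subgroup.prod ⊥
        (annG (LinearMap.ker (aeval (frobL K L) (c P)))))
  have hSp : ∀ p : S, (p : ℕ).Prime ∧ (p : ℕ) ∣ 4 ^ n - 1 := by
    intro p
    have := p.2
    simp only [hS, Nat.mem_primeFactors] at this
    exact ⟨this.1, this.2.1⟩
  have hScop : ∀ i j : S, i ≠ j → Nat.Coprime i j := by
    intro i j hij
    exact (Nat.coprime_primes (hSp i).1 (hSp j).1).2 (fun h => hij (Subtype.ext h))
  have hTcop : ∀ i j : T, i ≠ j → IsCoprime (i : K[X]) (j : K[X]) := by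
    intro i j hij
    rw [(hTm i).2.1.coprime_iff_not_dvd]
    intro hd
    have := (hTm i).2.1.associated_of_dvd (hTm j).2.1 hd
    exact hij (Subtype.ext (eq_of_monic_of_associated (hTm i).1 (hTm j).1 this))
  have indep : ∀ γ : (S ⊕ (S ⊕ T)) → (MulChar L ℂ × MulChar L ℂ × AddChar L ℂ), (∀ i, γ i ∈ H i) → ∏ i, γ i = 1 → ∀ i, γ i = 1 := by
    intro γ hγ hp
    rw [Fintype.prod_sum_type, Fintype.prod_sum_type] at hp
    have m1 : ∀ p : S, (γ (Sum.inl p)).1 ∈ powG (MulChar L ℂ) p ∧ (γ (Sum.inl p)).2.1 = 1 ∧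
        (γ (Sum.inl p)).2.2 = 1 := by
      intro p
      have := hγ (Sum.inl p)
      exact ⟨this.1, Subgroup.mem_bot.1 this.2.1, Subgroup.mem_bot.1 this.2.2⟩
    have m2 : ∀ p : S, (γ (Sum.inr (Sum.inl p))).1 = 1 ∧
        (γ (Sum.inr (Sum.inl p))).2.1 ∈ powG (MulChar L ℂ) p ∧
        (γ (Sum.inr (Sum.inl p))).2.2 = 1 := by
      intro p
      have := hγ (Sum.inr (Sum.inl p))
      exact ⟨Subgroup.mem_bot.1 this.1, this.2.1, Subgroup.mem_bot.1 this.2.2⟩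
    have m3 : ∀ p : T, (γ (Sum.inr (Sum.inr p))).1 = 1 ∧ (γ (Sum.inr (Sum.inr p))).2.1 = 1 ∧
        (γ (Sum.inr (Sum.inr p))).2.2 ∈ annG (LinearMap.ker (aeval (frobL K L) (c p))) := by
      intro p
      have := hγ (Sum.inr (Sum.inr p))
      exact ⟨Subgroup.mem_bot.1 this.1, Subgroup.mem_bot.1 this.2.1, this.2.2⟩
    have q1 := congrArg Prod.fst hp
    have q2 := congrArg (fun z => z.2.1) hp
    have q3 := congrArg (fun z => z.2.2) hp
    simp only [Prod.fst_mul, Prod.snd_mul, Prod.fst_prod, Prod.snd_prod, Prod.fst_one,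
      Prod.snd_one] at q1 q2 q3
    simp only [(m2 _).1, (m3 _).1, Finset.prod_const_one, mul_one] at q1
    simp only [(m1 _).2.1, (m3 _).2.1, Finset.prod_const_one, mul_one, one_mul] at q2
    simp only [(m1 _).2.2, (m2 _).2.2, Finset.prod_const_one, one_mul] at q3
    have r1 := indep_pow (fun p : S => (p : ℕ)) hScop _ (fun p => (m1 p).1) q1
    have r2 := indep_pow (fun p : S => (p : ℕ)) hScop _ (fun p => (m2 p).2.1) q2
    have r3 := indep_add n hfin (fun P : T => (P : K[X])) c (fun P => (hc P).symm) hTcop _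
      (fun P => (m3 P).2.2) q3
    rintro (p | p | p)
    · exact Prod.ext (r1 p) (Prod.ext (m1 p).2.1 (m1 p).2.2)
    · exact Prod.ext (m2 p).1 (Prod.ext (r2 p) (m2 p).2.2)
    · exact Prod.ext (m3 p).1 (Prod.ext (m3 p).2.1 (r3 p))
  have hC : ∀ γ : (MulChar L ℂ × MulChar L ℂ × AddChar L ℂ), γ ≠ 1 → ‖∑ x ∈ (Finset.univ : Finset XX), ev x γ‖ ≤ 6 * 2 ^ n := by
    intro γ hγ
    have hb := pair_bound L (2 * n) (2 ^ n) (by omega) hL2 (by rw [← pow_mul, mul_comm])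
      f1 f2 g k h0 hcop hi hgX hgm h1 h2 hk hdeg γ.1 γ.2.1 γ.2.2 (by
        by_contra hcon
        push Not at hcon
        exact hγ (Prod.ext hcon.1 (Prod.ext hcon.2.1 hcon.2.2)))
    push_cast at hb
    refine le_trans (le_of_eq ?_) hb
    congr 1
    rw [← Finset.sum_subset (Finset.subset_univ
      (Finset.univ.filter (fun x : L => x ≠ 0 ∧ f1.eval x ≠ 0 ∧ f2.eval x ≠ 0)))]
    · symm
      refine Finset.sum_subtype _ (by simp) _
    · intro x _ hx
      simp only [Finset.mem_filter, Finset.mem_univ, true_and] at hx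
      by_cases e1 : x = 0
      · rw [e1, MulChar.map_zero]; simp
      · have : f1.eval x / f2.eval x = 0 := by
          rw [div_eq_zero_iff]; tauto
        rw [this, MulChar.map_zero]; simp
  have hX6 : 4 ^ n - 6 ≤ (Finset.univ : Finset XX).card := by
    have e0 : (X * (f1 * f2)) ≠ 0 := mul_ne_zero X_ne_zero h0
    have e1 : (Finset.univ : Finset XX).card =
        (Finset.univ.filter (fun x : L => x ≠ 0 ∧ f1.eval x ≠ 0 ∧ f2.eval x ≠ 0)).card := by
      rw [Finset.card_univ, Fintype.card_subtype]
    have e2 : (Finset.univ : Finset L) \ (X * (f1 * f2)).roots.toFinset ⊆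
        (Finset.univ.filter (fun x : L => x ≠ 0 ∧ f1.eval x ≠ 0 ∧ f2.eval x ≠ 0)) := by
      intro x hx
      rw [Finset.mem_sdiff, Multiset.mem_toFinset, mem_roots e0] at hx
      have := hx.2
      simp only [IsRoot.def, eval_mul, eval_X, mul_eq_zero, not_or] at this
      simp [this]
    rw [e1]
    refine le_trans ?_ (Finset.card_le_card e2)
    have e3 := Finset.le_card_sdiff (X * (f1 * f2)).roots.toFinset (Finset.univ : Finset L)
    rw [Finset.card_univ, hL] at e3
    refine le_trans ?_ e3
    have e4 := Multiset.toFinset_card_le (X * (f1 * f2)).roots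
    have e5 := card_roots' (X * (f1 * f2))
    have e6 := natDegree_mul_le (p := (X : L[X])) (q := f1 * f2)
    have e7 := natDegree_mul_le (p := f1) (q := f2)
    rw [natDegree_X] at e6
    omega
  let N : (S ⊕ (S ⊕ T)) → ℕ := Sum.elim (fun p => (p : ℕ)) (Sum.elim (fun p => (p : ℕ))
    (fun P => 4 ^ (P : K[X]).natDegree))
  have hcardprod : ∀ (p : S), (p : ℕ) ≤ Nat.card (powG (MulChar L ℂ) p) := fun p =>
    card_powG L p (by rw [hL]; exact (hSp p).2)
  have hN : ∀ i, N i ≤ Nat.card (H i) := by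
    rintro (p | p | P)
    · simp only [N, H, Sum.elim_inl]
      rw [Nat.card_congr (Subgroup.prodEquiv _ _).toEquiv, Nat.card_prod,
        Nat.card_congr (Subgroup.prodEquiv _ _).toEquiv, Nat.card_prod]
      simpa using hcardprod p
    · simp only [N, H, Sum.elim_inl, Sum.elim_inr]
      rw [Nat.card_congr (Subgroup.prodEquiv _ _).toEquiv, Nat.card_prod,
        Nat.card_congr (Subgroup.prodEquiv _ _).toEquiv, Nat.card_prod]
      simpa using hcardprod p
    · simp only [N, H, Sum.elim_inr]
      rw [Nat.card_congr (Subgroup.prodEquiv _ _).toEquiv, Nat.card_prod,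
        Nat.card_congr (Subgroup.prodEquiv _ _).toEquiv, Nat.card_prod]
      have e1 := card_quot (L := L) (P : K[X]) (c P) (hTm P).2.1 (by rw [← hfin]; exact (hc P).symm)
      rw [hK] at e1
      have e2 := e1.trans (card_annG _)
      simpa using e2
  have hN2 : ∀ i, 2 ≤ N i := by
    rintro (p | p | P)
    · exact (hSp p).1.two_le
    · exact (hSp p).1.two_le
    · simp only [N, Sum.elim_inr]
      have := (hTm P).2.1.natDegree_pos
      calc 2 ≤ 4 ^ 1 := by norm_num
        _ ≤ _ := Nat.pow_le_pow_right (by norm_num) this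
  have hn6 : 6 ≤ 4 ^ n ∨ n = 1 := by
    rcases Nat.lt_or_ge 1 n with h | h
    · left
      calc 6 ≤ 4 ^ 2 := by norm_num
        _ ≤ 4 ^ n := Nat.pow_le_pow_right (by norm_num) h
    · right; omega
  have hu : ((4:ℝ) ^ n - 6) ≤ ((4 ^ n - 6 : ℕ) : ℝ) := by
    have := Nat.le_sub_iff_add_le (n := 4 ^ n - 6) (m := 6) (k := 4 ^ n)
    have h3 : 4 ^ n ≤ 4 ^ n - 6 + 6 := by omega
    have h4 : ((4 ^ n : ℕ) : ℝ) ≤ ((4 ^ n - 6 + 6 : ℕ) : ℝ) := by exact_mod_cast h3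
    push_cast at h4 ⊢
    linarith
  let q : (S ⊕ (S ⊕ T)) → Prop := fun i =>
    Sum.elim (fun p : S => c1 p) (Sum.elim (fun p : S => c2 p) (fun P : T => cp P)) i
  let q' : (S ⊕ (S ⊕ T)) → Prop := fun i =>
    Sum.elim (fun p : S => ¬ c1 p) (Sum.elim (fun p : S => ¬ c2 p) (fun P : T => ¬ cp P)) i
  have hqq : ∀ i, q' i ↔ ¬ q i := by
    rintro (p | p | P) <;> rfl
  obtain ⟨x, _, hx⟩ := sieve (Finset.univ : Finset XX) ev H indep (6 * 2 ^ n) (by positivity) hC N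
    hN2 hN (Finset.univ.filter q) (Finset.univ.filter q')
    (by intro i; simp only [Finset.mem_filter, Finset.mem_univ, true_and, hqq]; tauto)
    (by
      rw [Finset.disjoint_left]
      intro i; simp only [Finset.mem_filter, Finset.mem_univ, true_and, hqq]; tauto)
    δ (by
      refine hδ.trans (le_of_eq ?_)
      congr 1
      have e := sum_three S T (fun p => ¬ c1 p) (fun p => ¬ c2 p) (fun p => ¬ cp p)
        (fun p => 1 / (p : ℝ)) (fun p => 1 / (p : ℝ)) (fun P => 1 / (4:ℝ) ^ P.natDegree)
      refine Eq.trans (b := ∑ i ∈ Finset.univ.filter q', Sum.elim (fun p : S => 1 / ((p : ℕ) : ℝ))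
        (Sum.elim (fun p : S => 1 / ((p : ℕ) : ℝ))
        (fun P : T => 1 / (4:ℝ) ^ (P : K[X]).natDegree)) i) ?_ ?_
      · convert e.symm
      refine Finset.sum_congr rfl fun i _ => ?_
      rcases i with (p | p | P) <;> simp [N]) hδ0 a t (4 ^ n - 6) ht
    (by refine le_trans (le_of_eq ?_) ha; exact card_three S T c1 c2 cp)
    (by refine le_trans (le_of_eq ?_) hb; convert card_three S T (fun p => ¬ c1 p) (fun p => ¬ c2 p) (fun p => ¬ cp p))
    hX6 (hmain.trans_le (by gcongr))
  refine ⟨x.1, x.2.1, x.2.2.1, x.2.2.2, ?_, ?_⟩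
  · intro p hp
    have hp0 : p ≠ 0 := (hSp ⟨p, hp⟩).1.ne_zero
    constructor
    · obtain ⟨γ, hγ, hγ1⟩ := hx (Sum.inl ⟨p, hp⟩)
      have m : γ.1 ∈ powG (MulChar L ℂ) p ∧ γ.2.1 = 1 ∧ γ.2.2 = 1 := by
        exact ⟨hγ.1, Subgroup.mem_bot.1 hγ.2.1, Subgroup.mem_bot.1 hγ.2.2⟩
      refine not_pow x.1 x.2.1 p hp0 γ.1 m.1 ?_
      intro h
      apply hγ1
      change γ.1 x.1 * γ.2.1 _ * γ.2.2 x.1 = 1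
      rw [h, m.2.1, m.2.2, MulChar.one_apply (Ne.isUnit (div_ne_zero x.2.2.1 x.2.2.2))]
      simp
    · obtain ⟨γ, hγ, hγ1⟩ := hx (Sum.inr (Sum.inl ⟨p, hp⟩))
      have m : γ.1 = 1 ∧ γ.2.1 ∈ powG (MulChar L ℂ) p ∧ γ.2.2 = 1 := by
        exact ⟨Subgroup.mem_bot.1 hγ.1, hγ.2.1, Subgroup.mem_bot.1 hγ.2.2⟩
      refine not_pow _ (div_ne_zero x.2.2.1 x.2.2.2) p hp0 γ.2.1 m.2.1 ?_
      intro h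
      apply hγ1
      change γ.1 x.1 * γ.2.1 _ * γ.2.2 x.1 = 1
      rw [h, m.1, m.2.2, MulChar.one_apply (Ne.isUnit x.2.1)]
      simp
  · intro P c' hPm hPi hPc h
    have hP : P ∈ T := by rw [hT, mem_PP hn]; exact ⟨hPm, hPi, ⟨c', hPc.symm⟩⟩
    have hcc : c ⟨P, hP⟩ = c' := by
      have e := hc ⟨P, hP⟩
      rw [← hPc] at e
      exact (mul_left_cancel₀ hPi.ne_zero e).symm
    obtain ⟨γ, hγ, hγ1⟩ := hx (Sum.inr (Sum.inr ⟨P, hP⟩))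
    have m : γ.1 = 1 ∧ γ.2.1 = 1 ∧
        γ.2.2 ∈ annG (LinearMap.ker (aeval (frobL K L) (c ⟨P, hP⟩))) := by
      exact ⟨Subgroup.mem_bot.1 hγ.1, Subgroup.mem_bot.1 hγ.2.1, hγ.2.2⟩
    apply hγ1
    change γ.1 x.1 * γ.2.1 _ * γ.2.2 x.1 = 1
    have e := m.2.2 x.1 (by rw [LinearMap.mem_ker, hcc]; exact h)
    rw [m.1, m.2.1, e, MulChar.one_apply (Ne.isUnit x.2.1),
      MulChar.one_apply (Ne.isUnit (div_ne_zero x.2.2.1 x.2.2.2))]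
    simp

theorem prim_of {L : Type} [Field L] [Fintype L] (x : L) (hx : x ≠ 0)
    (h : ∀ p ∈ (Fintype.card L - 1).primeFactors, ¬ ∃ y, y ^ p = x) : IsPrimitiveElem x := by
  classical
  have hN : Fintype.card L - 1 ≠ 0 := by have := Fintype.one_lt_card (α := L); omega
  refine orderOf_eq_of_pow_and_pow_div_prime (Nat.pos_of_ne_zero hN)
    (FiniteField.pow_card_sub_one_eq_one x hx) ?_
  intro p hp hpd hpow
  apply h p (Nat.mem_primeFactors.2 ⟨hp, hpd, hN⟩)
  obtain ⟨g, hg⟩ := IsCyclic.exists_generator (α := Lˣ)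
  obtain ⟨j, hj⟩ := (Subgroup.mem_zpowers_iff.1 (hg (Units.mk0 x hx)))
  have hord : orderOf g = Fintype.card L - 1 := by
    rw [orderOf_eq_card_of_forall_mem_zpowers hg, Nat.card_eq_fintype_card, Fintype.card_units]
  have h3 : g ^ (j * ((Fintype.card L - 1) / p : ℕ)) = 1 := by
    rw [zpow_mul, hj, zpow_natCast]
    ext
    simpa using hpow
  have h4 := orderOf_dvd_iff_zpow_eq_one.2 h3
  rw [hord] at h4
  obtain ⟨m, hm⟩ := hpd
  have hm0 : m ≠ 0 := by rintro rfl; exact hN hm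
  rw [hm, Nat.mul_div_cancel_left _ hp.pos] at h4
  push_cast at h4
  obtain ⟨r, hr⟩ := Int.dvd_of_mul_dvd_mul_right (by exact_mod_cast hm0) h4
  refine ⟨((g ^ r : Lˣ) : L), ?_⟩
  have : (g ^ r) ^ p = Units.mk0 x hx := by
    rw [← hj, hr, mul_comm, zpow_mul, zpow_natCast]
  have := congrArg (fun u : Lˣ => (u : L)) this
  simpa using this

end Stp

namespace Stp
open Polynomial

variable {K : Type} [Field K] [Fintype K]

theorem PP_dvd_gcd {n : ℕ} (hn : 0 < n) (j : ℕ) {P : K[X]} (hP : P ∈ PP K n)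
    (hd : P.natDegree ∣ j) : P ∣ X ^ (Nat.gcd n (Fintype.card K ^ j - 1)) - 1 := by
  classical
  obtain ⟨hm, hi, hdvd⟩ := (mem_PP hn).1 hP
  haveI : Fact (Irreducible P) := ⟨hi⟩
  have h0 : P ≠ 0 := hi.ne_zero
  let pb := AdjoinRoot.powerBasis h0
  haveI : Module.Finite K (AdjoinRoot P) := pb.finite
  haveI : Finite (AdjoinRoot P) := Module.finite_of_finite K
  haveI : Fintype (AdjoinRoot P) := Fintype.ofFinite _
  have hcard : Fintype.card (AdjoinRoot P) = Fintype.card K ^ P.natDegree := by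
    rw [Module.card_eq_pow_finrank (K := K), pb.finrank, AdjoinRoot.powerBasis_dim]
  have key : ∀ m : ℕ, P ∣ X ^ m - 1 ↔ (AdjoinRoot.root P) ^ m = 1 := by
    intro m
    rw [← AdjoinRoot.mk_eq_zero, map_sub, map_pow, AdjoinRoot.mk_X, map_one, sub_eq_zero]
  rw [key] at hdvd ⊢
  have hx0 : AdjoinRoot.root P ≠ 0 := by
    intro h
    rw [h, zero_pow hn.ne'] at hdvd
    exact zero_ne_one hdvd
  have h2 : (AdjoinRoot.root P) ^ (Fintype.card K ^ P.natDegree - 1) = 1 := by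
    rw [← hcard]; exact FiniteField.pow_card_sub_one_eq_one _ hx0
  have h3 : (AdjoinRoot.root P) ^ (Fintype.card K ^ j - 1) = 1 := by
    obtain ⟨r, rfl⟩ := hd
    obtain ⟨c, hc⟩ := Nat.sub_dvd_pow_sub_pow (Fintype.card K ^ P.natDegree) 1 r
    rw [one_pow, ← pow_mul] at hc
    rw [hc, pow_mul, h2, one_pow]
  exact pow_gcd_eq_one.2 ⟨hdvd, h3⟩

theorem PP_sum_deg {n : ℕ} (hn : 0 < n) (s : Finset K[X]) (hs : s ⊆ PP K n) (m : ℕ) (hm : 0 < m)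
    (h : ∀ P ∈ s, P ∣ X ^ m - 1) : ∑ P ∈ s, P.natDegree ≤ m := by
  classical
  have hne : (X ^ m - 1 : K[X]) ≠ 0 := X_pow_sub_C_ne_zero hm 1
  have hdeg : (X ^ m - 1 : K[X]).natDegree = m := natDegree_X_pow_sub_C (r := (1:K))
  have hdv : ∏ P ∈ s, P ∣ X ^ m - 1 := by
    refine Finset.prod_dvd_of_coprime ?_ h
    intro P hP Q hQ hPQ
    have p1 := (mem_PP hn).1 (hs hP)
    have p2 := (mem_PP hn).1 (hs hQ)
    change IsCoprime P Q
    rw [p1.2.1.coprime_iff_not_dvd]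
    intro hd
    exact hPQ (eq_of_monic_of_associated p1.1 p2.1 (p1.2.1.associated_of_dvd p2.2.1 hd))
  have := natDegree_le_of_dvd hdv hne
  rwa [hdeg, natDegree_prod _ _ (fun P hP => ((mem_PP hn).1 (hs hP)).2.1.ne_zero)] at this

theorem PP_odd [CharP K 2] {n s m : ℕ} (hn : 0 < n) (h : n = m * 2 ^ s) {P : K[X]}
    (hP : P ∈ PP K n) : P ∣ X ^ m - 1 := by
  obtain ⟨_, hi, hdvd⟩ := (mem_PP hn).1 hP
  have : (X ^ n - 1 : K[X]) = (X ^ m - 1) ^ (2 ^ s) := by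
    rw [sub_pow_char_pow, one_pow, ← pow_mul, h]
  rw [this] at hdvd
  exact hi.prime.dvd_of_dvd_pow hdvd

open Classical in
theorem PP_lin {n : ℕ} (hn : 0 < n) (hK : Fintype.card K = 4) :
    ((PP K n).filter (fun P => P.natDegree = 1)).card = Nat.gcd n 3 := by
  apply le_antisymm
  · have h1 := PP_sum_deg hn ((PP K n).filter (fun P => P.natDegree = 1))
      (Finset.filter_subset _ _) (Nat.gcd n 3) (Nat.gcd_pos_of_pos_left _ hn) (by
        intro P hP
        rw [Finset.mem_filter] at hP
        have := PP_dvd_gcd hn 1 hP.1 (by rw [hP.2])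
        rwa [hK] at this)
    rw [Finset.sum_congr rfl (fun P hP => (Finset.mem_filter.1 hP).2)] at h1
    simpa using h1
  · have hmem : ∀ a : K, a ^ n = 1 → (X - C a) ∈ (PP K n).filter (fun P => P.natDegree = 1) := by
      intro a ha
      rw [Finset.mem_filter, mem_PP hn]
      refine ⟨⟨monic_X_sub_C a, irreducible_X_sub_C a, ?_⟩, natDegree_X_sub_C a⟩
      rw [dvd_iff_isRoot]
      simp [ha]
    have himg : ((Finset.univ.filter (fun a : K => a ^ n = 1)).image (fun a => X - C a)) ⊆
        (PP K n).filter (fun P => P.natDegree = 1) := by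
      intro P hP
      obtain ⟨a, ha, rfl⟩ := Finset.mem_image.1 hP
      exact hmem a (Finset.mem_filter.1 ha).2
    have h2 := Finset.card_le_card himg
    rw [Finset.card_image_of_injective _ (fun a b h => by
      have := sub_right_injective h
      exact C_injective this)] at h2
    refine le_trans ?_ h2
    rcases (Nat.coprime_or_dvd_of_prime Nat.prime_three n) with h3 | h3
    · have e : Nat.gcd n 3 = 1 := by rw [Nat.gcd_comm]; exact h3
      rw [e, Nat.one_le_iff_ne_zero, Finset.card_ne_zero]
      exact ⟨1, by simp⟩
    · rw [Nat.gcd_eq_right h3]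
      have e : (Finset.univ.erase (0 : K)) ⊆ Finset.univ.filter (fun a : K => a ^ n = 1) := by
        intro a ha
        rw [Finset.mem_filter]
        refine ⟨Finset.mem_univ _, ?_⟩
        obtain ⟨r, rfl⟩ := h3
        have := FiniteField.pow_card_sub_one_eq_one a (Finset.ne_of_mem_erase ha)
        rw [hK] at this
        rw [pow_mul]
        norm_num at this
        rw [this, one_pow]
      have := Finset.card_le_card e
      rw [Finset.card_erase_of_mem (Finset.mem_univ _), Finset.card_univ, hK] at this
      exact this

open Classical in
/-- all the numerical information on the degrees that we need -/
theorem PP_data {n s m : ℕ} (hn : 0 < n) (hK : Fintype.card K = 4) (h : n = m * 2 ^ s) :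
    ∃ x2 x3 x4 : ℕ, Nat.gcd n 3 + 2 * x2 ≤ Nat.gcd n 15 ∧ Nat.gcd n 3 + 3 * x3 ≤ Nat.gcd n 63 ∧
      Nat.gcd n 3 + 2 * x2 + 3 * x3 + 4 * x4 ≤ m ∧
      (PP K n).card = Nat.gcd n 3 + x2 + x3 + x4 ∧
      ((PP K n).filter (fun P => P.natDegree = 1)).card = Nat.gcd n 3 ∧
      ((PP K n).filter (fun P => ¬ P.natDegree = 1)).card = x2 + x3 + x4 ∧
      ∑ P ∈ (PP K n).filter (fun P => ¬ P.natDegree = 1), 1 / (4:ℝ) ^ P.natDegree ≤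
        x2 / 16 + x3 / 64 + x4 / 256 := by
  haveI : CharP K 2 := charP_of_card_eq_prime_pow (R := K) (p := 2) (f := 2) (by rw [hK]; norm_num)
  have hm : 0 < m := by
    rcases Nat.eq_zero_or_pos m with h0 | h0
    · rw [h0] at h; omega
    · exact h0
  obtain ⟨Z, hZ⟩ : ∃ Z, Z = PP K n := ⟨_, rfl⟩
  have e1 := PP_lin hn hK
  have hpos : ∀ P ∈ Z, 0 < P.natDegree := fun P hP => by
    rw [hZ] at hP; exact ((mem_PP hn).1 hP).2.1.natDegree_pos
  obtain ⟨F, hF⟩ : ∃ F : ℕ → Finset K[X], ∀ i, F i = Z.filter (fun P => P.natDegree = i) :=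
    ⟨_, fun _ => rfl⟩
  obtain ⟨F4, hF4⟩ : ∃ F : Finset K[X], F = Z.filter (fun P => 4 ≤ P.natDegree) :=
    ⟨_, rfl⟩
  have hFs : ∀ i, ∑ P ∈ F i, P.natDegree = i * (F i).card := by
    intro i
    rw [hF, Finset.sum_congr rfl (fun P hP => (Finset.mem_filter.1 hP).2), Finset.sum_const,
      smul_eq_mul, mul_comm]
  have hFsub : ∀ i, F i ⊆ PP K n := by intro i; rw [hF, hZ]; exact Finset.filter_subset _ _
  have hdisj : ∀ i j, i ≠ j → Disjoint (F i) (F j) := by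
    intro i j hij
    rw [Finset.disjoint_left]
    intro P hP hQ
    rw [hF, Finset.mem_filter] at hP hQ
    exact hij (hP.2.symm.trans hQ.2)
  have hdisj4 : ∀ i, i < 4 → Disjoint (F i) F4 := by
    intro i hi
    rw [Finset.disjoint_left]
    intro P hP hQ
    rw [hF, Finset.mem_filter] at hP
    rw [hF4, Finset.mem_filter] at hQ
    omega
  have h4s : 4 * F4.card ≤ ∑ P ∈ F4, P.natDegree := by
    rw [mul_comm, ← smul_eq_mul]
    refine Finset.card_nsmul_le_sum _ _ _ fun P hP => ?_
    rw [hF4, Finset.mem_filter] at hP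
    exact hP.2
  have hne1 : Z.filter (fun P => ¬ P.natDegree = 1) = F 2 ∪ (F 3 ∪ F4) := by
    ext P
    simp only [hF, hF4, Finset.mem_filter, Finset.mem_union]
    constructor
    · rintro ⟨h1, h2⟩
      have := hpos P h1
      have : P.natDegree = 2 ∨ P.natDegree = 3 ∨ 4 ≤ P.natDegree := by omega
      tauto
    · rintro (⟨h1, h2⟩ | ⟨h1, h2⟩ | ⟨h1, h2⟩)
      · exact ⟨h1, by omega⟩
      · exact ⟨h1, by omega⟩
      · exact ⟨h1, by omega⟩
  have hZ' : Z = F 1 ∪ (F 2 ∪ (F 3 ∪ F4)) := by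
    rw [← hne1, hF, Finset.filter_union_filter_not_eq]
  have d34 : Disjoint (F 3) F4 := hdisj4 3 (by norm_num)
  have d2 : Disjoint (F 2) (F 3 ∪ F4) := by
    rw [Finset.disjoint_union_right]; exact ⟨hdisj 2 3 (by norm_num), hdisj4 2 (by norm_num)⟩
  have d1 : Disjoint (F 1) (F 2 ∪ (F 3 ∪ F4)) := by
    rw [Finset.disjoint_union_right, Finset.disjoint_union_right]
    exact ⟨hdisj 1 2 (by norm_num), hdisj 1 3 (by norm_num), hdisj4 1 (by norm_num)⟩
  have c1 : (F 1).card = Nat.gcd n 3 := by rw [hF, hZ]; exact e1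
  have two : ∀ i j, i ≠ 1 → j = i → ∑ P ∈ F 1 ∪ F i, P.natDegree ≤
      Nat.gcd n (4 ^ j - 1) := by
    intro i j hi hj
    refine PP_sum_deg hn _ (Finset.union_subset (hFsub 1) (hFsub i)) _
      (Nat.gcd_pos_of_pos_left _ hn) ?_
    intro P hP
    rw [← hK]
    rcases Finset.mem_union.1 hP with hP | hP
    · refine PP_dvd_gcd hn j (hFsub _ hP) ?_
      rw [hF, Finset.mem_filter] at hP
      rw [hP.2]; exact one_dvd _
    · refine PP_dvd_gcd hn j (hFsub _ hP) ?_
      rw [hF, Finset.mem_filter] at hP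
      rw [hP.2, hj]
  have t2 := two 2 2 (by norm_num) rfl
  have t3 := two 3 3 (by norm_num) rfl
  rw [Finset.sum_union (hdisj 1 2 (by norm_num)), hFs, hFs, c1] at t2
  rw [Finset.sum_union (hdisj 1 3 (by norm_num)), hFs, hFs, c1] at t3
  norm_num at t2 t3
  have tall := PP_sum_deg hn (PP K n) (Finset.Subset.refl _) m hm (fun P hP => PP_odd hn h hP)
  rw [← hZ, hZ', Finset.sum_union d1, Finset.sum_union d2, Finset.sum_union d34, hFs, hFs, hFs,
    c1] at tall
  refine ⟨(F 2).card, (F 3).card, F4.card, t2, t3, by omega, ?_, e1, ?_, ?_⟩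
  · rw [← hZ, hZ', Finset.card_union_of_disjoint d1, Finset.card_union_of_disjoint d2,
      Finset.card_union_of_disjoint d34, c1]
    ring
  · rw [← hZ, hne1, Finset.card_union_of_disjoint d2,
      Finset.card_union_of_disjoint d34]
    ring
  · rw [← hZ, hne1, Finset.sum_union d2, Finset.sum_union d34]
    have s2 : ∑ P ∈ F 2, 1 / (4:ℝ) ^ P.natDegree = (F 2).card / 16 := by
      have hc : ∀ P ∈ F 2, 1 / (4:ℝ) ^ P.natDegree = 1 / 16 := by
        intro P hP
        rw [hF, Finset.mem_filter] at hP
        rw [hP.2]; norm_num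
      rw [Finset.sum_congr rfl hc, Finset.sum_const, nsmul_eq_mul]
      ring
    have s3 : ∑ P ∈ F 3, 1 / (4:ℝ) ^ P.natDegree = (F 3).card / 64 := by
      have hc : ∀ P ∈ F 3, 1 / (4:ℝ) ^ P.natDegree = 1 / 64 := by
        intro P hP
        rw [hF, Finset.mem_filter] at hP
        rw [hP.2]; norm_num
      rw [Finset.sum_congr rfl hc, Finset.sum_const, nsmul_eq_mul]
      ring
    have s4 : ∑ P ∈ F4, 1 / (4:ℝ) ^ P.natDegree ≤ F4.card / 256 := by
      have : ∀ P ∈ F4, 1 / (4:ℝ) ^ P.natDegree ≤ 1 / 256 := by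
        intro P hP
        rw [hF4, Finset.mem_filter] at hP
        have : (4:ℝ) ^ 4 ≤ 4 ^ P.natDegree := pow_le_pow_right₀ (by norm_num) hP.2
        norm_num at this
        exact one_div_le_one_div_of_le (by norm_num) this
      have := Finset.sum_le_card_nsmul _ _ _ this
      rw [nsmul_eq_mul] at this
      linarith
    rw [s2, s3]
    linarith
end Stp

namespace Stp
open Polynomial

open Classical in
/-- The numerical hypotheses of the sieve criterion. -/
def NumOK (n : ℕ) : Prop :=
  ∀ (K : Type) [Field K] [Fintype K], Fintype.card K = 4 →
    ∃ (c1 c2 : ℕ → Prop) (cp : K[X] → Prop) (a t : ℕ) (δ : ℝ), 1 ≤ t ∧ 0 < δ ∧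
      ((4 ^ n - 1).primeFactors.filter c1).card + (((4 ^ n - 1).primeFactors.filter c2).card +
        ((PP K n).filter cp).card) ≤ a ∧
      ((4 ^ n - 1).primeFactors.filter (fun p => ¬ c1 p)).card +
        (((4 ^ n - 1).primeFactors.filter (fun p => ¬ c2 p)).card +
        ((PP K n).filter (fun P => ¬ cp P)).card) ≤ t ∧
      δ ≤ 1 - (∑ p ∈ (4 ^ n - 1).primeFactors.filter (fun p : ℕ => ¬ c1 p), 1 / ((p : ℕ) : ℝ) +
        (∑ p ∈ (4 ^ n - 1).primeFactors.filter (fun p : ℕ => ¬ c2 p), 1 / ((p : ℕ) : ℝ) +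
        ∑ P ∈ (PP K n).filter (fun P => ¬ cp P), 1 / (4 : ℝ) ^ P.natDegree)) ∧
      6 * 2 ^ n * 2 ^ a * (2 * δ + t - 1) < δ * (4 ^ n - 6 + 6 * 2 ^ n)

/-- The odd primes below 256. -/
def PR : List ℕ := [3, 5, 7, 11, 13, 17, 19, 23, 29, 31, 37, 41, 43, 47, 53, 59, 61, 67, 71, 73, 79, 83, 89,
    97, 101, 103, 107, 109, 113, 127, 131, 137, 139, 149, 151, 157, 163, 167, 173, 179, 181,
    191, 193, 197, 199, 211, 223, 227, 229, 233, 239, 241, 251]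

theorem mem_PR : ∀ p < 256, p ∈ PR ∨ p = 2 ∨ p < 2 ∨ ¬ p.Prime := by
  have h : ∀ p < 256, p ∈ PR ∨ p = 2 ∨ p < 2 ∨ ∃ d < 16, 2 ≤ d ∧ d < p ∧ p % d = 0 := by
    decide +kernel
  intro p hp
  rcases h p hp with h | h | h | ⟨d, -, h1, h2, h3⟩
  · exact Or.inl h
  · exact Or.inr (Or.inl h)
  · exact Or.inr (Or.inr (Or.inl h))
  · refine Or.inr (Or.inr (Or.inr fun hq => ?_))
    rcases (Nat.dvd_prime hq).1 (Nat.dvd_of_mod_eq_zero h3) with h | h <;> omega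

def smallL (N : ℕ) : List ℕ := PR.filter (fun p => N % p == 0)
def coreA (l : List ℕ) (b : ℕ) : ℕ := (l.filter (fun p => decide (p < b))).length
def sieT (l : List ℕ) (b : ℕ) : ℕ := (l.filter (fun p => decide (b ≤ p))).length
def sieS (l : List ℕ) (b : ℕ) : ℕ :=
  ((l.filter (fun p => decide (b ≤ p))).map (fun p => 1000000 / p + 1)).sum
def bigT (N : ℕ) (l : List ℕ) : ℕ := Nat.log2 (N / Nat.gcd N (l.prod ^ 8)) / 8

theorem odd_four_pow (n : ℕ) (hn : 0 < n) {p : ℕ} (hp : p ∈ (4 ^ n - 1).primeFactors) : p ≠ 2 := by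
  rintro rfl
  have h1 := Nat.dvd_of_mem_primeFactors hp
  have h2 : 2 ∣ 4 ^ n := dvd_pow (by norm_num) hn.ne'
  have h3 : 0 < 4 ^ n := by positivity
  have := (Nat.dvd_sub h2 h1)
  omega

theorem mem_small {n : ℕ} (hn : 0 < n) {p : ℕ} (hp : p ∈ (4 ^ n - 1).primeFactors) (h : p < 256) :
    p ∈ smallL (4 ^ n - 1) := by
  have hpp := Nat.prime_of_mem_primeFactors hp
  unfold smallL
  rw [List.mem_filter]
  refine ⟨?_, ?_⟩
  · rcases mem_PR p h with h | h | h | h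
    · exact h
    · exact absurd h (odd_four_pow n hn hp)
    · exact absurd hpp.two_le (by omega)
    · exact absurd hpp h
  · simpa using Nat.mod_eq_zero_of_dvd (Nat.dvd_of_mem_primeFactors hp)

theorem big_count {n : ℕ} (hn : 0 < n) :
    ((4 ^ n - 1).primeFactors.filter (fun p => 256 ≤ p)).card ≤
      bigT (4 ^ n - 1) (smallL (4 ^ n - 1)) := by
  obtain ⟨N, hN⟩ : ∃ N, N = 4 ^ n - 1 := ⟨_, rfl⟩
  have hN0 : N ≠ 0 := by
    have : 4 ^ 1 ≤ 4 ^ n := Nat.pow_le_pow_right (by norm_num) hn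
    omega
  rw [← hN]
  obtain ⟨Q, hQ⟩ : ∃ Q, Q = N.primeFactors.filter (fun p => 256 ≤ p) := ⟨_, rfl⟩
  rw [← hQ]
  unfold bigT
  obtain ⟨G, hG⟩ : ∃ G, G = Nat.gcd N ((smallL N).prod ^ 8) := ⟨_, rfl⟩
  rw [← hG]
  have hsm : ∀ p ∈ smallL N, p < 256 ∧ 2 ≤ p := by
    have : ∀ p ∈ PR, p < 256 ∧ 2 ≤ p := by decide +kernel
    intro p hp
    exact this p (List.mem_of_mem_filter hp)
  have hcop : Nat.Coprime (∏ p ∈ Q, p) G := by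
    refine Nat.Coprime.coprime_dvd_right (hG ▸ Nat.gcd_dvd_right _ _) ?_
    refine Nat.Coprime.pow_right _ (Nat.Coprime.prod_left fun p hp => ?_)
    rw [hQ, Finset.mem_filter] at hp
    have hpp := Nat.prime_of_mem_primeFactors hp.1
    rw [Nat.Prime.coprime_iff_not_dvd hpp]
    intro hd
    obtain ⟨r, hr, hd⟩ := (Nat.Prime.prime hpp).dvd_prod_iff.1 hd
    obtain ⟨h1, h2⟩ := hsm r hr
    have := Nat.le_of_dvd (by omega) hd
    omega
  have hGN : G ∣ N := hG ▸ Nat.gcd_dvd_left _ _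
  have hdN : (∏ p ∈ Q, p) ∣ N :=
    (Finset.prod_dvd_prod_of_subset _ _ _ (hQ ▸ Finset.filter_subset _ _)).trans
      (Nat.prod_primeFactors_dvd N)
  have hdR : (∏ p ∈ Q, p) ∣ N / G := by
    rw [← Nat.mul_div_cancel' hGN] at hdN
    exact hcop.dvd_of_dvd_mul_left hdN
  have hR0 : N / G ≠ 0 := by
    have := Nat.div_pos (Nat.le_of_dvd (Nat.pos_of_ne_zero hN0) hGN)
      (Nat.pos_of_dvd_of_pos hGN (Nat.pos_of_ne_zero hN0))
    omega
  have h1 : 256 ^ Q.card ≤ ∏ p ∈ Q, p := by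
    refine Finset.pow_card_le_prod _ _ _ fun p hp => ?_
    rw [hQ, Finset.mem_filter] at hp
    exact hp.2
  have h2 := Nat.le_of_dvd (Nat.pos_of_ne_zero hR0) hdR
  have h3 : N / G < 2 ^ (Nat.log2 (N / G) + 1) := Nat.lt_log2_self
  have h4 : 2 ^ (8 * Q.card) < 2 ^ (Nat.log2 (N / G) + 1) := by
    rw [pow_mul]; norm_num; omega
  have := (Nat.pow_lt_pow_iff_right (by norm_num)).1 h4
  omega

theorem split_core {n : ℕ} (hn : 0 < n) {b : ℕ} (hb : b ≤ 256) :
    ((4 ^ n - 1).primeFactors.filter (fun p => p < b)).card ≤ coreA (smallL (4 ^ n - 1)) b := by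
  unfold coreA
  refine le_trans (Finset.card_le_card ?_) (List.toFinset_card_le _)
  intro p hp
  rw [Finset.mem_filter] at hp
  rw [List.mem_toFinset, List.mem_filter]
  exact ⟨mem_small hn hp.1 (by omega), by simpa using hp.2⟩

theorem split_sub {n : ℕ} (hn : 0 < n) {b : ℕ} :
    (4 ^ n - 1).primeFactors.filter (fun p => ¬ p < b) ⊆
      ((smallL (4 ^ n - 1)).filter (fun p => decide (b ≤ p))).toFinset ∪
      (4 ^ n - 1).primeFactors.filter (fun p => 256 ≤ p) := by
  intro p hp
  rw [Finset.mem_filter] at hp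
  rw [Finset.mem_union, List.mem_toFinset, List.mem_filter, Finset.mem_filter]
  by_cases h : 256 ≤ p
  · exact Or.inr ⟨hp.1, h⟩
  · exact Or.inl ⟨mem_small hn hp.1 (by omega), by simpa using hp.2⟩

theorem split_sie {n : ℕ} (hn : 0 < n) {b : ℕ} :
    ((4 ^ n - 1).primeFactors.filter (fun p => ¬ p < b)).card ≤
      sieT (smallL (4 ^ n - 1)) b + bigT (4 ^ n - 1) (smallL (4 ^ n - 1)) := by
  refine (Finset.card_le_card (split_sub hn)).trans ((Finset.card_union_le _ _).trans ?_)
  exact Nat.add_le_add (List.toFinset_card_le _) (big_count hn)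

theorem list_sum_le (l : List ℕ) :
    ∑ p ∈ l.toFinset, 1 / ((p : ℕ) : ℝ) ≤
      ((l.map (fun p => 1000000 / p + 1)).sum : ℕ) / 1000000 := by
  induction l with
  | nil => simp
  | cons p l ih =>
    have h1 : 1 / (p : ℝ) ≤ ((1000000 / p + 1 : ℕ) : ℝ) / 1000000 := by
      rcases Nat.eq_zero_or_pos p with h | h
      · subst h; norm_num
      · have hp : (0:ℝ) < p := by exact_mod_cast h
        rw [div_le_div_iff₀ hp (by norm_num)]
        have := Nat.lt_mul_div_succ 1000000 h
        have h2 : ((1000000 : ℕ):ℝ) < ((p * (1000000 / p + 1) : ℕ) : ℝ) := by exact_mod_cast this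
        push_cast at h2 ⊢
        linarith
    rw [List.toFinset_cons, List.map_cons, List.sum_cons]
    have h2 : ∑ q ∈ insert p l.toFinset, 1 / ((q : ℕ) : ℝ) ≤
        1 / (p : ℝ) + ∑ q ∈ l.toFinset, 1 / ((q : ℕ) : ℝ) := by
      by_cases hp : p ∈ l.toFinset
      · rw [Finset.insert_eq_of_mem hp]
        have : 0 ≤ 1 / (p:ℝ) := by positivity
        linarith
      · rw [Finset.sum_insert hp]
    rw [Nat.cast_add, add_div]
    linarith

theorem split_sum {n : ℕ} (hn : 0 < n) {b : ℕ} :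
    ∑ p ∈ (4 ^ n - 1).primeFactors.filter (fun p : ℕ => ¬ p < b), 1 / ((p : ℕ) : ℝ) ≤
      (sieS (smallL (4 ^ n - 1)) b +
        (bigT (4 ^ n - 1) (smallL (4 ^ n - 1)) * 3907 : ℕ) : ℝ) / 1000000 := by
  refine (Finset.sum_le_sum_of_subset_of_nonneg (split_sub hn)
    (fun p _ _ => by positivity)).trans ?_
  obtain ⟨A, hA⟩ : ∃ A, A = ((smallL (4 ^ n - 1)).filter (fun p => decide (b ≤ p))).toFinset :=
    ⟨_, rfl⟩
  obtain ⟨B, hB⟩ : ∃ B, B = (4 ^ n - 1).primeFactors.filter (fun p => 256 ≤ p) := ⟨_, rfl⟩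
  have h1 : ∑ p ∈ A ∪ B, 1 / ((p : ℕ) : ℝ) ≤
      ∑ p ∈ A, 1 / ((p : ℕ) : ℝ) + ∑ p ∈ B, 1 / ((p : ℕ) : ℝ) := by
    rw [← Finset.sum_union_inter]
    have : 0 ≤ ∑ p ∈ A ∩ B, 1 / ((p : ℕ) : ℝ) := Finset.sum_nonneg fun p _ => by positivity
    linarith
  have h2 : ∑ p ∈ A, 1 / ((p : ℕ) : ℝ) ≤ (sieS (smallL (4 ^ n - 1)) b : ℝ) / 1000000 := by
    rw [hA]; exact list_sum_le _
  have h3 : ∑ p ∈ B, 1 / ((p : ℕ) : ℝ) ≤ B.card * (3907 / 1000000) := by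
    rw [← nsmul_eq_mul]
    refine Finset.sum_le_card_nsmul _ _ _ fun p hp => ?_
    rw [hB, Finset.mem_filter] at hp
    have : (256:ℝ) ≤ p := by exact_mod_cast hp.2
    calc 1 / (p:ℝ) ≤ 1 / 256 := one_div_le_one_div_of_le (by norm_num) this
      _ ≤ _ := by norm_num
  have h4 : (B.card : ℝ) ≤ bigT (4 ^ n - 1) (smallL (4 ^ n - 1)) := by
    rw [hB]; exact_mod_cast big_count hn
  rw [← hA, ← hB]
  push_cast
  rw [add_div]
  linarith

theorem PP_card_le {K : Type} [Field K] [Fintype K] {n : ℕ} (hn : 0 < n) (hK : Fintype.card K = 4) :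
    4 * (PP K n).card ≤ n / Nat.gcd n 4096 + 3 * Nat.gcd n 3 + 2 * ((Nat.gcd n 15 - Nat.gcd n 3) / 2)
      + (Nat.gcd n 63 - Nat.gcd n 3) / 3 := by
  obtain ⟨s, -, hs⟩ := (Nat.dvd_prime_pow Nat.prime_two).1
    (show Nat.gcd n 4096 ∣ 2 ^ 12 from Nat.gcd_dvd_right n 4096)
  have h : n = n / Nat.gcd n 4096 * 2 ^ s := by
    rw [← hs]; exact (Nat.div_mul_cancel (Nat.gcd_dvd_left _ _)).symm
  obtain ⟨x2, x3, x4, h2, h3, h4, h5, -, -, -⟩ := PP_data hn hK h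
  rw [h5]
  omega

end Stp

namespace Stp
open Polynomial

open Classical in
/-- Criterion with all polynomial factors in the core. -/
theorem numOK_of {n : ℕ} (b A T w : ℕ) (s : ℝ)
    (hA : ((4 ^ n - 1).primeFactors.filter (fun p => p < b)).card ≤ A)
    (hT : ((4 ^ n - 1).primeFactors.filter (fun p => ¬ p < b)).card ≤ T)
    (hs : ∑ p ∈ (4 ^ n - 1).primeFactors.filter (fun p : ℕ => ¬ p < b), 1 / ((p : ℕ) : ℝ) ≤ s)
    (hw : ∀ (K : Type) [Field K] [Fintype K], Fintype.card K = 4 → (PP K n).card ≤ w)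
    (hs1 : 2 * s < 1) (hT0 : 1 ≤ 2 * T)
    (hm : 6 * 2 ^ n * 2 ^ (2 * A + w) * (2 * (1 - 2 * s) + ((2 * T : ℕ) : ℝ) - 1) <
      (1 - 2 * s) * (4 ^ n - 6 + 6 * 2 ^ n)) : NumOK n := by
  intro K _ _ hK
  refine ⟨fun p => p < b, fun p => p < b, fun _ => True, 2 * A + w, 2 * T, 1 - 2 * s, hT0,
    by linarith, ?_, ?_, ?_, hm⟩
  · calc _ ≤ A + (A + w) := Nat.add_le_add (le_of_eq_of_le (by congr!) hA)
          (Nat.add_le_add (le_of_eq_of_le (by congr!) hA) (le_of_eq_of_le (by congr!)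
            ((Finset.card_filter_le (PP K n) (fun _ => True)).trans (hw K hK))))
      _ ≤ _ := by omega
  · calc _ ≤ T + (T + 0) := Nat.add_le_add (le_of_eq_of_le (by congr!) hT)
          (Nat.add_le_add (le_of_eq_of_le (by congr!) hT) (by simp))
      _ ≤ _ := by omega
  · calc _ ≤ 1 - (s + (s + 0)) := by linarith
      _ ≤ _ := sub_le_sub_left (add_le_add (le_of_eq_of_le (by congr!) hs)
          (add_le_add (le_of_eq_of_le (by congr!) hs) (by simp))) _

def chkS (N : ℕ) (l : List ℕ) (b : ℕ) : ℕ := sieS l b + bigT N l * 3907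
def chkT (N : ℕ) (l : List ℕ) (b : ℕ) : ℕ := sieT l b + bigT N l
def chkW (n : ℕ) : ℕ := (n / Nat.gcd n 4096 + 3 * Nat.gcd n 3 +
  2 * ((Nat.gcd n 15 - Nat.gcd n 3) / 2) + (Nat.gcd n 63 - Nat.gcd n 3) / 3) / 4
def chkM (n a t d : ℕ) : Bool :=
  decide (6 * 2 ^ n * 2 ^ a * (2 * d + 1000000 * (t - 1)) + 6 * d < d * (4 ^ n + 6 * 2 ^ n))
def chkL (n N : ℕ) (l : List ℕ) : Bool :=
  decide (2 * chkS N l 12 < 1000000) && decide (1 ≤ chkT N l 12) &&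
    chkM n (2 * coreA l 12 + chkW n) (2 * chkT N l 12) (1000000 - 2 * chkS N l 12)
def chk (n : ℕ) : Bool := chkL n (4 ^ n - 1) (smallL (4 ^ n - 1))

theorem numOK_chk {n : ℕ} (hn : 0 < n) (h : chk n = true) : NumOK n := by
  unfold chk chkL chkM at h
  obtain ⟨S, hS⟩ : ∃ S, S = chkS (4 ^ n - 1) (smallL (4 ^ n - 1)) 12 := ⟨_, rfl⟩
  obtain ⟨T, hT⟩ : ∃ T, T = chkT (4 ^ n - 1) (smallL (4 ^ n - 1)) 12 := ⟨_, rfl⟩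
  obtain ⟨A, hA⟩ : ∃ A, A = coreA (smallL (4 ^ n - 1)) 12 := ⟨_, rfl⟩
  rw [← hS, ← hT, ← hA] at h
  simp only [Bool.and_eq_true, decide_eq_true_eq] at h
  obtain ⟨⟨h1, h2⟩, h3⟩ := h
  have h1' : (2:ℝ) * S < 1000000 := by exact_mod_cast h1
  refine numOK_of 12 A T (chkW n) (S / 1000000) (hA ▸ split_core hn (by norm_num))
    (hT ▸ split_sie hn) ?_ ?_ (by linarith) (by omega) ?_
  · refine (split_sum hn).trans (le_of_eq ?_)
    rw [hS]; unfold chkS; push_cast; ring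
  · intro K _ _ hK
    have := PP_card_le hn hK
    unfold chkW
    omega
  · obtain ⟨d, hd⟩ : ∃ d, d = 1000000 - 2 * S := ⟨_, rfl⟩
    rw [← hd] at h3
    have hd' : (d : ℝ) = 1000000 - 2 * S := by
      rw [hd, Nat.cast_sub h1.le]; push_cast; ring
    have ht : ((2 * T - 1 : ℕ) : ℝ) = ((2 * T : ℕ) : ℝ) - 1 := by
      rw [Nat.cast_sub (by omega)]; norm_num
    have h4 : (6 * 2 ^ n * 2 ^ (2 * A + chkW n) * (2 * d + 1000000 * (((2 * T : ℕ) : ℝ) - 1)) + 6 * d : ℝ)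
        < d * (4 ^ n + 6 * 2 ^ n) := by
      rw [← ht]; exact_mod_cast h3
    have e : (1 - 2 * (S / 1000000) : ℝ) = d / 1000000 := by rw [hd']; ring
    rw [e]
    have e1 : (6 * 2 ^ n * 2 ^ (2 * A + chkW n) * (2 * (d / 1000000) + ((2 * T : ℕ) : ℝ) - 1) : ℝ) =
      (6 * 2 ^ n * 2 ^ (2 * A + chkW n) * (2 * d + 1000000 * (((2 * T : ℕ) : ℝ) - 1))) / 1000000 := by
      ring
    rw [e1, div_mul_eq_mul_div]
    refine div_lt_div_of_pos_right ?_ (by norm_num)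
    linarith

theorem chk_all : ∀ n < 221, n = 11 ∨ 13 ≤ n → n ≠ 15 → chk n = true := by
  decide +kernel

open Classical in
theorem numOK_15 : NumOK 15 := by
  intro K _ _ hK
  have hn : 0 < 15 := by norm_num
  obtain ⟨x2, x3, x4, h2, h3, h4, -, h5, h6, h7⟩ :=
    PP_data (K := K) (n := 15) (s := 0) (m := 15) hn hK (by norm_num)
  norm_num at h2 h3 h4 h5
  have g1 := split_core (n := 15) (b := 4) hn (by norm_num)
  have g2 := split_core (n := 15) (b := 8) hn (by norm_num)
  have g3 := split_sie (n := 15) (b := 4) hn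
  have g4 := split_sie (n := 15) (b := 8) hn
  have g5 := split_sum (n := 15) (b := 4) hn
  have g6 := split_sum (n := 15) (b := 8) hn
  have e1 : coreA (smallL (4 ^ 15 - 1)) 4 = 1 := by decide +kernel
  have e2 : coreA (smallL (4 ^ 15 - 1)) 8 = 2 := by decide +kernel
  have e3 : sieT (smallL (4 ^ 15 - 1)) 4 = 4 := by decide +kernel
  have e4 : sieT (smallL (4 ^ 15 - 1)) 8 = 3 := by decide +kernel
  have e5 : sieS (smallL (4 ^ 15 - 1)) 4 ≤ 272700 := by decide +kernel
  have e6 : sieS (smallL (4 ^ 15 - 1)) 8 ≤ 129900 := by decide +kernel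
  have e7 : bigT (4 ^ 15 - 1) (smallL (4 ^ 15 - 1)) = 1 := by decide +kernel
  have e5' : (sieS (smallL (4 ^ 15 - 1)) 4 : ℝ) ≤ 272700 := by exact_mod_cast e5
  have e6' : (sieS (smallL (4 ^ 15 - 1)) 8 : ℝ) ≤ 129900 := by exact_mod_cast e6
  rw [e1] at g1
  rw [e2] at g2
  rw [e3, e7] at g3
  rw [e4, e7] at g4
  rw [e7] at g5 g6
  refine ⟨fun p => p < 4, fun p => p < 8, fun P => P.natDegree = 1, 6, 15, 0.214, by norm_num,
    by norm_num, ?_, ?_, ?_, ?_⟩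
  · calc _ ≤ 1 + (2 + 3) := Nat.add_le_add (le_of_eq_of_le (by congr!) g1)
          (Nat.add_le_add (le_of_eq_of_le (by congr!) g2) (le_of_eq_of_le (by congr!) h5.le))
      _ ≤ _ := by omega
  · calc _ ≤ 5 + (4 + (x2 + x3 + x4)) := Nat.add_le_add (le_of_eq_of_le (by congr!) g3)
          (Nat.add_le_add (le_of_eq_of_le (by congr!) g4) (le_of_eq_of_le (by congr!) h6.le))
      _ ≤ _ := by omega
  · have h8 : (x2 : ℝ) + 2 * x4 ≤ 6 := by
      have : x2 + 2 * x4 ≤ 6 := by omega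
      exact_mod_cast this
    have h9 : (x3 : ℝ) = 0 := by
      have : x3 = 0 := by omega
      exact_mod_cast this
    have h10 : (0:ℝ) ≤ x4 := by positivity
    have q1 := g5.trans (show _ ≤ (0.27661 : ℝ) by
      rw [div_le_iff₀ (by norm_num)]; push_cast at e5' ⊢; linarith)
    have q2 := g6.trans (show _ ≤ (0.13381 : ℝ) by
      rw [div_le_iff₀ (by norm_num)]; push_cast at e6' ⊢; linarith)
    have q3 := h7.trans (show _ ≤ (0.375 : ℝ) by
      rw [h9]; norm_num; linarith)
    calc _ ≤ (1 - (0.27661 + (0.13381 + 0.375)) : ℝ) := by norm_num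
      _ ≤ _ := sub_le_sub_left (add_le_add (le_of_eq_of_le (by congr!) q1)
          (add_le_add (le_of_eq_of_le (by congr!) q2) (le_of_eq_of_le (by congr!) q3))) _
  · norm_num

end Stp

namespace Stp
open Polynomial

theorem core_big {n b : ℕ} (hn : 0 < n) :
    ((4 ^ n - 1).primeFactors.filter (fun p => p < b)).card ≤ 10 + 8 * (b / 30) := by
  have hsub : (4 ^ n - 1).primeFactors.filter (fun p => p < b) ⊆
      {3, 5} ∪ (Finset.Ico 0 (0 + b)).filter (fun p => Nat.Coprime 30 p) := by
    intro p hp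
    rw [Finset.mem_filter] at hp
    have hpp := Nat.prime_of_mem_primeFactors hp.1
    have h2 := odd_four_pow n hn hp.1
    by_cases h3 : p = 3
    · simp [h3]
    by_cases h5 : p = 5
    · simp [h5]
    refine Finset.mem_union_right _ (Finset.mem_filter.2 ⟨by simp; exact hp.2, ?_⟩)
    rw [Nat.coprime_comm, Nat.Prime.coprime_iff_not_dvd hpp]
    intro hd
    have hle := Nat.le_of_dvd (by norm_num) hd
    rw [show 30 = 2 * (3 * 5) by norm_num, hpp.dvd_mul, hpp.dvd_mul,
      Nat.prime_dvd_prime_iff_eq hpp Nat.prime_two, Nat.prime_dvd_prime_iff_eq hpp Nat.prime_three,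
      Nat.prime_dvd_prime_iff_eq hpp Nat.prime_five] at hd
    omega
  refine (Finset.card_le_card hsub).trans ((Finset.card_union_le _ _).trans ?_)
  have h1 := Nat.Ico_filter_coprime_le (a := 30) 0 b (by norm_num)
  have h2 : Nat.totient 30 = 8 := by decide +kernel
  rw [h2] at h1
  have h3 : ({3, 5} : Finset ℕ).card = 2 := by decide
  omega

theorem sie_big {n b : ℕ} (hb : 128 ≤ b) :
    7 * ((4 ^ n - 1).primeFactors.filter (fun p => ¬ p < b)).card ≤ 2 * n := by
  obtain ⟨Q, hQ⟩ : ∃ Q, Q = (4 ^ n - 1).primeFactors.filter (fun p => ¬ p < b) := ⟨_, rfl⟩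
  rw [← hQ]
  rcases Nat.eq_zero_or_pos n with h0 | hn
  · subst h0
    simp at hQ
    simp [hQ]
  have hN : 4 ^ 1 ≤ 4 ^ n := Nat.pow_le_pow_right (by norm_num) hn
  have hdN : (∏ p ∈ Q, p) ∣ 4 ^ n - 1 :=
    (Finset.prod_dvd_prod_of_subset _ _ _ (hQ ▸ Finset.filter_subset _ _)).trans
      (Nat.prod_primeFactors_dvd _)
  have h1 : 128 ^ Q.card ≤ ∏ p ∈ Q, p := by
    refine Finset.pow_card_le_prod _ _ _ fun p hp => ?_
    rw [hQ, Finset.mem_filter] at hp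
    omega
  have h2 := Nat.le_of_dvd (by omega) hdN
  have h4 : 2 ^ (7 * Q.card) ≤ 2 ^ (2 * n) := by
    rw [pow_mul, pow_mul]; norm_num; omega
  exact (Nat.pow_le_pow_iff_right (by norm_num)).1 h4

theorem numOK_big {n : ℕ} (hn : 221 ≤ n) : NumOK n := by
  have hn0 : 0 < n := by omega
  obtain ⟨b, hb⟩ : ∃ b, b = 3 * n / 4 := ⟨_, rfl⟩
  have hb1 : 128 ≤ b := by omega
  have hT := sie_big (n := n) hb1
  have hnR : (221:ℝ) ≤ n := by exact_mod_cast hn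
  refine numOK_of b (10 + 8 * (b / 30)) (2 * n / 7) ((n + 43) / 4) 0.385 (core_big hn0) (by omega)
    ?_ ?_ (by norm_num) (by omega) ?_
  · have hbR : (3 * n - 3 : ℝ) ≤ 4 * b := by
      have : 3 * n ≤ 4 * b + 3 := by omega
      have h : ((3 * n : ℕ) : ℝ) ≤ ((4 * b + 3 : ℕ) : ℝ) := by exact_mod_cast this
      push_cast at h; linarith
    have hb0 : (0:ℝ) < b := by linarith
    have h1 : ∀ p ∈ (4 ^ n - 1).primeFactors.filter (fun p : ℕ => ¬ p < b), 1 / ((p : ℕ) : ℝ) ≤ 1 / b := by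
      intro p hp
      rw [Finset.mem_filter] at hp
      have : (b:ℝ) ≤ p := by exact_mod_cast (not_lt.1 hp.2)
      exact one_div_le_one_div_of_le hb0 this
    refine (Finset.sum_le_card_nsmul _ _ _ h1).trans ?_
    rw [nsmul_eq_mul, mul_one_div, div_le_iff₀ hb0]
    have hTR : (7 * (((4 ^ n - 1).primeFactors.filter (fun p : ℕ => ¬ p < b)).card : ℝ)) ≤ 2 * n := by
      exact_mod_cast hT
    linarith
  · intro K _ _ hK
    have h := PP_card_le hn0 hK
    have h1 : Nat.gcd n 15 ≤ 15 := Nat.gcd_le_right _ (by norm_num)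
    have h2 : Nat.gcd n 63 ≤ 63 := Nat.gcd_le_right _ (by norm_num)
    have h3 : Nat.gcd n 3 ≤ 3 := Nat.gcd_le_right _ (by norm_num)
    have h4 : 0 < Nat.gcd n 3 := Nat.gcd_pos_of_pos_left _ hn0
    have h5 : n / Nat.gcd n 4096 ≤ n := Nat.div_le_self _ _
    omega
  · obtain ⟨a, ha⟩ : ∃ a, a = 2 * (10 + 8 * (b / 30)) + (n + 43) / 4 := ⟨_, rfl⟩
    rw [← ha]
    have hexp : a + (8 + n / 16) ≤ n := by omega
    have h1 : 15 * n ≤ 2 ^ (8 + n / 16) := by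
      have : n / 16 < 2 ^ (n / 16) := Nat.lt_two_pow_self
      rw [pow_add]; omega
    have h2 : 2 ^ a * (15 * n) ≤ 2 ^ n := by
      calc 2 ^ a * (15 * n) ≤ 2 ^ a * 2 ^ (8 + n / 16) := Nat.mul_le_mul_left _ h1
        _ = 2 ^ (a + (8 + n / 16)) := (pow_add _ _ _).symm
        _ ≤ 2 ^ n := Nat.pow_le_pow_right (by norm_num) hexp
    have h3 : (2:ℝ) ^ a * (15 * n) ≤ 2 ^ n := by exact_mod_cast h2
    have h4 : ((2 * (2 * n / 7) : ℕ) : ℝ) ≤ 4 * n / 7 := by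
      have : 7 * (2 * (2 * n / 7)) ≤ 4 * n := by omega
      have h : ((7 * (2 * (2 * n / 7)) : ℕ) : ℝ) ≤ ((4 * n : ℕ) : ℝ) := by exact_mod_cast this
      push_cast at h ⊢; linarith
    have hp : (0:ℝ) < 2 ^ n := by positivity
    have h2n : (2:ℝ) ≤ 2 ^ n := by
      calc (2:ℝ) = 2 ^ 1 := by norm_num
        _ ≤ 2 ^ n := pow_le_pow_right₀ (by norm_num) hn0
    have h44 : (4:ℝ) ^ n = 2 ^ n * 2 ^ n := by
      rw [← mul_pow]; norm_num
    calc (6 * 2 ^ n * 2 ^ a * (2 * (1 - 2 * 0.385) + ((2 * (2 * n / 7) : ℕ) : ℝ) - 1) : ℝ)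
        ≤ 6 * 2 ^ n * 2 ^ a * (0.575 * n) := by
          apply mul_le_mul_of_nonneg_left _ (by positivity)
          linarith
      _ = 0.23 * (2 ^ n * (2 ^ a * (15 * n))) := by ring
      _ ≤ 0.23 * (2 ^ n * 2 ^ n) := by gcongr
      _ < (1 - 2 * 0.385) * (4 ^ n - 6 + 6 * 2 ^ n) := by
          rw [h44]; norm_num; nlinarith

theorem numOK_all {n : ℕ} (h : n = 11 ∨ 13 ≤ n) : NumOK n := by
  by_cases h1 : 221 ≤ n
  · exact numOK_big h1
  by_cases h2 : n = 15
  · rw [h2]; exact numOK_15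
  exact numOK_chk (by omega) (chk_all n (by omega) h h2)

theorem memB_of {n : ℕ} (hn : 0 < n) (h : NumOK n) : memB 3 2 4 n := by
  intro K L _ _ _ _ _ hK hL f hf
  obtain ⟨f1, f2, h20, rfl, hd1, hd2, hcop, k, g, hk0, hgm, hi, hgX, hk, h1, h2⟩ := hf
  have h0 : f1 * f2 ≠ 0 := by
    intro h0; rw [h0] at h2; exact h2 (dvd_zero _)
  obtain ⟨c1, c2, cp, a, t, δ, q1, q2, q3, q4, q5, q6⟩ := h K hK
  obtain ⟨α, e1, e2, e3, e4, e5⟩ := crit K L n hn hK hL f1 f2 g k h0 hcop hi hgX hgm h1 h2 hk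
    (by omega) c1 c2 cp a t δ q1 q2 q3 q4 q5 q6
  have hfin : n = Module.finrank K L := by
    have := Module.card_eq_pow_finrank (K := K) (V := L)
    rw [hK, hL] at this
    exact Nat.pow_right_injective (le_refl 2) (Nat.pow_left_injective two_ne_zero (by
      simp only [← pow_mul, mul_comm _ 2]
      rw [pow_mul, pow_mul]; exact this))
  have hev : ratEval (algebraMap L[X] (RatFunc L) f1 / algebraMap L[X] (RatFunc L) f2) α =
      f1.eval α / f2.eval α := by
    obtain ⟨x, hx⟩ : ∃ x, x = algebraMap L[X] (RatFunc L) f1 / algebraMap L[X] (RatFunc L) f2 :=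
      ⟨_, rfl⟩
    rw [← hx]
    have hm := (RatFunc.num_mul_eq_mul_denom_iff h20).2 hx
    have hdv : x.denom ∣ f2 := hx ▸ RatFunc.denom_div_dvd f1 f2
    have hd0 : x.denom.eval α ≠ 0 := fun h => e3 (Polynomial.eval_eq_zero_of_dvd_of_eval_eq_zero hdv h)
    have hm' := congrArg (Polynomial.eval α) hm
    rw [Polynomial.eval_mul, Polynomial.eval_mul] at hm'
    unfold ratEval RatFunc.eval
    rw [Polynomial.eval₂_id, Polynomial.eval₂_id, div_eq_div_iff hd0 e3]
    exact hm'
  refine ⟨α, prim_of α e1 ?_, normal_of n hfin α e5, ?_⟩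
  · rw [hL]; exact fun p hp => (e4 p hp).1
  · rw [hev]
    refine prim_of _ (div_ne_zero e2 e3) ?_
    rw [hL]; exact fun p hp => (e4 p hp).2

end Stp

theorem stmt13 (n : ℕ) (hn : 3 ≤ n) (h : n = 11 ∨ 13 ≤ n) :
    memB 3 2 4 n := by
  exact Stp.memB_of (by omega) (Stp.numOK_all h)
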